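/- Let n ≥ 2, m = 2.46, ε₀ = √((m−1)/(m+1)) = √(73/173) (≈ 0.6495), and let θ ∈ (2 arccos ε₀, π). Let T > 0, M > 0, and let u : C_θ × [0,T) → ℝ be continuous, twice continuously differentiable in x and once continuously differentiable in t on C_θ × (0,T), and satisfy: (a) |∂_t u(x,t) + Δu(x,t)| ≤ M(|u(x,t)| + |∇u(x,t)|) for all (x,t) ∈ C_θ × (0,T); (b) |u(x,t)| ≤ M e^{M|x|²} for all (x,t) ∈ C_θ × (0,T); and (c) u(x,0) = 0 for all x ∈ C_θ. Then u(x,t) = 0 for all (x,t) ∈ C_θ × (0,T). -/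

import Mathlib

open Set

/-- The open cone `C_θ = {x : x₁ > |x| cos(θ/2)}` in `ℝⁿ`. -/
def cone {n : ℕ} (hn : 0 < n) (θ : ℝ) : Set (EuclideanSpace ℝ (Fin n)) :=
  {x | ‖x‖ * Real.cos (θ / 2) < x ⟨0, hn⟩}

/-- The Laplacian (in the `x` variables) of `g : ℝⁿ → ℝ` at `x`. -/
noncomputable def lap {n : ℕ} (g : EuclideanSpace ℝ (Fin n) → ℝ)
    (x : EuclideanSpace ℝ (Fin n)) : ℝ :=
  ∑ i : Fin n, iteratedFDeriv ℝ 2 g x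
    ![EuclideanSpace.single i 1, EuclideanSpace.single i 1]

namespace CU
open Set MeasureTheory Filter Topology
open scoped ContDiff

def HasD2 (φ : ℝ → ℝ) (q : ℝ) : Prop :=
  ∃ φ' : ℝ → ℝ, (∀ᶠ h in 𝓝 (0:ℝ), HasDerivAt φ (φ' h) h) ∧ HasDerivAt φ' q 0

lemma HasD2.add {φ ψ : ℝ → ℝ} {q r : ℝ} (h1 : HasD2 φ q) (h2 : HasD2 ψ r) :
    HasD2 (fun h => φ h + ψ h) (q + r) := by
  obtain ⟨φ', a1, b1⟩ := h1
  obtain ⟨ψ', a2, b2⟩ := h2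
  exact ⟨fun h => φ' h + ψ' h, by filter_upwards [a1, a2] with h u v using u.add v, b1.add b2⟩

lemma HasD2.cmul {φ : ℝ → ℝ} {q : ℝ} (c : ℝ) (h1 : HasD2 φ q) :
    HasD2 (fun h => c * φ h) (c * q) := by
  obtain ⟨φ', a1, b1⟩ := h1
  exact ⟨fun h => c * φ' h, by filter_upwards [a1] with h u using u.const_mul c, b1.const_mul c⟩

lemma HasD2.sub {φ ψ : ℝ → ℝ} {q r : ℝ} (h1 : HasD2 φ q) (h2 : HasD2 ψ r) :
    HasD2 (fun h => φ h - ψ h) (q - r) := by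
  obtain ⟨φ', a1, b1⟩ := h1
  obtain ⟨ψ', a2, b2⟩ := h2
  exact ⟨fun h => φ' h - ψ' h, by filter_upwards [a1, a2] with h u v using u.sub v, b1.sub b2⟩

lemma HasD2.congr {φ ψ : ℝ → ℝ} {q : ℝ} (h1 : HasD2 φ q) (h : ψ =ᶠ[𝓝 0] φ) : HasD2 ψ q := by
  obtain ⟨φ', a1, b1⟩ := h1
  refine ⟨φ', ?_, b1⟩
  filter_upwards [a1, h.eventuallyEq_nhds] with z hz hz2
  exact hz.congr_of_eventuallyEq hz2

lemma HasD2.quad (a b c : ℝ) : HasD2 (fun h => a + b * h + c * h ^ 2) (2 * c) := by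
  refine ⟨fun h => b + 2 * c * h, Eventually.of_forall fun h => ?_, ?_⟩
  · exact ((((hasDerivAt_id h).const_mul b).const_add a).add ((hasDerivAt_pow 2 h).const_mul c)).congr_deriv
      (by simp; ring)
  · exact (((hasDerivAt_id (0:ℝ)).const_mul (2*c)).const_add b).congr_deriv (by simp)

lemma HasD2.nonneg {φ : ℝ → ℝ} {q : ℝ} (h1 : HasD2 φ q) (hm : IsLocalMin φ 0) : 0 ≤ q := by
  obtain ⟨φ', a1, b1⟩ := h1
  by_contra! hq
  have hd : deriv φ =ᶠ[𝓝 0] φ' := by filter_upwards [a1] with h u using u.deriv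
  have hd2 : deriv (deriv φ) 0 = q := by rw [hd.deriv_eq, b1.deriv]
  have hmax : IsLocalMax φ 0 := isLocalMax_of_deriv_deriv_neg (by rw [hd2]; exact hq) hm.deriv_eq_zero
    a1.self_of_nhds.continuousAt
  have hconst : φ =ᶠ[𝓝 0] fun _ => φ 0 := by
    filter_upwards [hm, hmax] with h u v using le_antisymm v u
  have h3 : deriv φ =ᶠ[𝓝 0] deriv (fun _ => φ 0) := hconst.deriv
  have : deriv (deriv φ) 0 = 0 := by
    rw [h3.deriv_eq]; simp
  linarith

lemma HasD2.nonpos {φ : ℝ → ℝ} {q : ℝ} (h1 : HasD2 φ q) (hm : IsLocalMax φ 0) : q ≤ 0 := by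
  have := (h1.cmul (-1)).nonneg (by simpa using hm.neg)
  linarith

section E
variable {E : Type*} [NormedAddCommGroup E] [NormedSpace ℝ E]

lemma HasD2.line {f : E → ℝ} {x : E} (hf : ContDiffAt ℝ 2 f x) (v : E) :
    HasD2 (fun h : ℝ => f (x + h • v)) (iteratedFDeriv ℝ 2 f x ![v, v]) := by
  have hl : ∀ h : ℝ, HasDerivAt (fun h : ℝ => x + h • v) v h := fun h => by
    simpa using ((hasDerivAt_id h).smul_const v).const_add x
  have hx : Tendsto (fun h : ℝ => x + h • v) (𝓝 0) (𝓝 x) := by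
    have := (hl 0).continuousAt.tendsto
    simpa using this
  refine ⟨fun h => fderiv ℝ f (x + h • v) v, ?_, ?_⟩
  · have : ∀ᶠ z in 𝓝 x, ContDiffAt ℝ 2 f z := hf.eventually (by simp)
    filter_upwards [hx.eventually this] with h hh
    exact (hh.differentiableAt (by simp)).hasFDerivAt.comp_hasDerivAt h (hl h)
  · have hd : DifferentiableAt ℝ (fderiv ℝ f) x :=
      (hf.fderiv_right (m := 1) (by norm_num)).differentiableAt (by simp)
    have hd' : HasFDerivAt (fderiv ℝ f) (fderiv ℝ (fderiv ℝ f) x) (x + (0:ℝ) • v) := by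
      simpa using hd.hasFDerivAt
    have h1 := hd'.comp_hasDerivAt 0 (hl 0)
    have h2 := h1.clm_apply (hasDerivAt_const 0 v)
    refine h2.congr_deriv ?_
    rw [iteratedFDeriv_two_apply]
    simp

lemma grad_le {f : E → ℝ} {x : E} {L : ℝ} (hf : DifferentiableAt ℝ f x) (hL : 0 ≤ L)
    (h : ∀ᶠ z in 𝓝 x, f z - f x ≤ L * ‖z - x‖) : ‖fderiv ℝ f x‖ ≤ L := by
  have key : ∀ v, fderiv ℝ f x v ≤ L * ‖v‖ := by
    intro v
    have hl : HasDerivAt (fun h : ℝ => x + h • v) v 0 := by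
      simpa using ((hasDerivAt_id (0:ℝ)).smul_const v).const_add x
    have hf' : HasFDerivAt f (fderiv ℝ f x) (x + (0:ℝ) • v) := by simpa using hf.hasFDerivAt
    have h1 : HasDerivAt (fun h : ℝ => f (x + h • v)) (fderiv ℝ f x v) 0 := hf'.comp_hasDerivAt 0 hl
    have h2 := h1.tendsto_slope_zero_right
    refine le_of_tendsto h2 ?_
    have hx : Tendsto (fun h : ℝ => x + h • v) (𝓝[>] 0) (𝓝 x) := by
      have := hl.continuousAt.tendsto
      simp only [zero_smul, add_zero] at this
      exact this.mono_left nhdsWithin_le_nhds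
    filter_upwards [hx.eventually h, self_mem_nhdsWithin] with t ht ht0
    have ht0 : 0 < t := ht0
    simp only [zero_add, zero_smul, add_zero, smul_eq_mul, add_sub_cancel_left, norm_smul, Real.norm_eq_abs,
      abs_of_pos ht0] at ht ⊢
    rw [inv_mul_le_iff₀ ht0]
    linarith
  refine ContinuousLinearMap.opNorm_le_bound _ hL fun v => ?_
  rw [Real.norm_eq_abs, abs_le]
  have := key (-v)
  simp at this
  exact ⟨by linarith, key v⟩
end E

section heat
variable {n : ℕ}
local notation "E" => EuclideanSpace ℝ (Fin n)

lemma lap_basis (v : OrthonormalBasis (Fin n) ℝ E) (f : E → ℝ) (x : E) :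
    lap f x = ∑ i, iteratedFDeriv ℝ 2 f x ![v i, v i] := by
  have h1 := congrFun (InnerProductSpace.laplacian_eq_iteratedFDeriv_orthonormalBasis f v) x
  have h2 := congrFun (InnerProductSpace.laplacian_eq_iteratedFDeriv_orthonormalBasis f
    (EuclideanSpace.basisFun (Fin n) ℝ)) x
  rw [lap, ← h1, h2]
  simp

noncomputable def heat (u : E → ℝ → ℝ) (x : E) (t : ℝ) : ℝ := deriv (u x) t + lap (fun y => u y t) x
end heat
end CU

namespace CU
open Set MeasureTheory Filter Topology
open scoped ContDiff
section
variable {n : ℕ}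
local notation "E" => EuclideanSpace ℝ (Fin n)

lemma omega_lip {A ρ a b r : ℝ} (hA : 0 ≤ A) (hρ : 0 < ρ) (ha : 0 ≤ a) (hb : 0 ≤ b) (hab : a + b ≤ ρ)
    (hr : |a - b| ≤ r) : A * (a - a^2/ρ) - A * (b - b^2/ρ) ≤ A * r := by
  have e : A * (a - a^2/ρ) - A * (b - b^2/ρ) = A * ((a-b) * (1 - (a+b)/ρ)) := by ring
  rw [e]
  refine mul_le_mul_of_nonneg_left ?_ hA
  have h1 : 0 ≤ 1 - (a+b)/ρ := by rw [sub_nonneg, div_le_one hρ]; exact hab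
  have h2 : 1 - (a+b)/ρ ≤ 1 := by have : 0 ≤ (a+b)/ρ := by positivity
                                  linarith
  calc (a-b) * (1 - (a+b)/ρ) ≤ |a-b| * (1 - (a+b)/ρ) := mul_le_mul_of_nonneg_right (le_abs_self _) h1
    _ ≤ |a-b| * 1 := mul_le_mul_of_nonneg_left h2 (abs_nonneg _)
    _ ≤ r := by linarith

lemma grad_est_aux {x y : E} {v : E} {r : ℝ} (hr : r = ‖x - y‖) (hr0 : 0 < r) (h : ℝ)
    (e : E) (he : e = r⁻¹ • (x - y)) (hh : 0 ≤ r + 2 * h * inner ℝ e v) :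
    ‖(x + h • v) - (y + h • (v - (2 * inner ℝ e v) • e))‖ = r + 2 * h * inner ℝ e v := by
  have h1 : x - y = r • e := by rw [he, smul_smul, mul_inv_cancel₀ hr0.ne', one_smul]
  have h2 : (x + h • v) - (y + h • (v - (2 * inner ℝ e v) • e)) = (r + 2 * h * inner ℝ e v) • e := by
    have : (x + h • v) - (y + h • (v - (2 * inner ℝ e v) • e)) = (x - y) + (2 * h * inner ℝ e v) • e := by
      module
    rw [this, h1, add_smul]
  have h3 : ‖e‖ = 1 := by rw [he, norm_smul, ← hr, Real.norm_eq_abs, abs_of_pos (by positivity), inv_mul_cancel₀ hr0.ne']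
  rw [h2, norm_smul, h3, mul_one, Real.norm_eq_abs, abs_of_nonneg hh]

lemma refl_basis (e : E) (he : ‖e‖ = 1) : ∃ w : OrthonormalBasis (Fin n) ℝ E,
    ∀ i, w i = EuclideanSpace.basisFun (Fin n) ℝ i - (2 * inner ℝ e (EuclideanSpace.basisFun (Fin n) ℝ i)) • e := by
  refine ⟨(EuclideanSpace.basisFun (Fin n) ℝ).map (Submodule.reflection (ℝ ∙ e)ᗮ), fun i => ?_⟩
  rw [OrthonormalBasis.map_apply, Submodule.reflection_orthogonal_apply, Submodule.reflection_singleton_apply, he]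
  simp only [RCLike.ofReal_one]
  module

lemma right_deriv_le {g : ℝ → ℝ} {t b g' : ℝ} (hg : HasDerivAt g g' t) (hb : t < b)
    (h : ∀ s ∈ Icc t b, g s ≤ g t) : g' ≤ 0 := by
  have h2 := hg.tendsto_slope_zero_right
  refine le_of_tendsto h2 ?_
  have : ∀ᶠ s in 𝓝[>] (0:ℝ), s < b - t := eventually_nhdsWithin_of_eventually_nhds (eventually_lt_nhds (by linarith))
  filter_upwards [this, self_mem_nhdsWithin] with s hs hs0
  have hs0 : 0 < s := hs0
  have := h (t+s) ⟨by linarith, by linarith⟩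
  rw [smul_eq_mul]
  exact mul_nonpos_of_nonneg_of_nonpos (by positivity) (by linarith)

lemma lap_diff {f : E → ℝ} {x y x0 : E} {A B ρ r : ℝ} (hfx : ContDiffAt ℝ 2 f x) (hfy : ContDiffAt ℝ 2 f y)
    (hr : r = ‖x - y‖) (hr0 : 0 < r)
    (hmax : ∀ᶠ p in 𝓝 (x, y), f p.1 - f p.2 - A * (‖p.1 - p.2‖ - ‖p.1 - p.2‖^2/ρ) - B * ‖p.1 - x0‖^2
      ≤ f x - f y - A * (‖x - y‖ - ‖x - y‖^2/ρ) - B * ‖x - x0‖^2) :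
    lap f x - lap f y ≤ - (8 * A / ρ) + 2 * B * n := by
  set e : E := r⁻¹ • (x - y) with he
  have hen : ‖e‖ = 1 := by rw [he, norm_smul, ← hr, Real.norm_eq_abs, abs_of_pos (by positivity), inv_mul_cancel₀ hr0.ne']
  obtain ⟨w, hw⟩ := refl_basis e hen
  set v := EuclideanSpace.basisFun (Fin n) ℝ with hv
  have key : ∀ i, iteratedFDeriv ℝ 2 f x ![v i, v i] - iteratedFDeriv ℝ 2 f y ![w i, w i]
      + 8 * A / ρ * (inner ℝ e (v i))^2 - 2 * B ≤ 0 := by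
    intro i
    set c := inner ℝ e (v i) with hcdef
    have hvn : ‖v i‖ = 1 := v.orthonormal.1 i
    have d1 := HasD2.line hfx (v i)
    have d2 := HasD2.line hfy (w i)
    have d3 := HasD2.quad (A * (r - r^2/ρ)) (A * (2 * c - 4 * r * c /ρ)) (- (A * 4 * c^2/ρ))
    have d4 := HasD2.quad (B * ‖x - x0‖^2) (B * (2 * inner ℝ (x - x0) (v i))) B
    have d := ((d1.sub d2).sub d3).sub d4
    have hm := d.nonpos ?_
    · calc _ = _ := ?_
        _ ≤ 0 := hm
      ring
    · have hcont : Tendsto (fun h : ℝ => (x + h • v i, y + h • w i)) (𝓝 0) (𝓝 (x, y)) := by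
        have : Continuous (fun h : ℝ => (x + h • v i, y + h • w i)) := by fun_prop
        have := this.tendsto 0
        simpa using this
      have hpos : ∀ᶠ h : ℝ in 𝓝 0, 0 < r + 2 * h * c := by
        have : Continuous (fun h : ℝ => r + 2 * h * c) := by fun_prop
        exact this.continuousAt.eventually (lt_mem_nhds (by simpa using hr0))
      filter_upwards [hcont.eventually hmax, hpos] with h h1 h2
      have h3 : ‖(x + h • v i) - (y + h • w i)‖ = r + 2 * h * c := by
        rw [hw i]; exact grad_est_aux hr hr0 h e he h2.le
      have h4 : ‖x + h • v i - x0‖^2 = ‖x - x0‖^2 + 2 * inner ℝ (x - x0) (v i) * h + h^2 := by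
        rw [show x + h • v i - x0 = (x - x0) + h • v i by abel, norm_add_sq_real, norm_smul, hvn, inner_smul_right]
        simp; ring
      simp only [h3, h4, ← hr] at h1
      simp only [zero_smul, add_zero, mul_zero]
      have e1 : ∀ z : ℝ, (A * (r - r^2/ρ)) + (A * (2 * c - 4 * r * c /ρ)) * z + (- (A * 4 * c^2/ρ)) * z^2
        = A * ((r + 2 * z * c) - (r + 2 * z * c)^2/ρ) := fun z => by ring
      have e2 := e1 h
      have e3 := e1 0
      simp only [mul_zero, add_zero] at e3
      rw [e2]
      simp only [ne_eq, OfNat.ofNat_ne_zero, not_false_eq_true, zero_pow, mul_zero, add_zero, zero_mul] at h1 ⊢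
      linarith
  have hs := Finset.sum_nonpos (fun i (_ : i ∈ Finset.univ) => key i)
  rw [Finset.sum_sub_distrib, Finset.sum_add_distrib, Finset.sum_sub_distrib, ← lap_basis v, ← lap_basis w,
    ← Finset.mul_sum] at hs
  have hp : ∑ i, (inner ℝ e (v i))^2 = 1 := by
    have := v.sum_sq_norm_inner_left e
    rw [hen] at this
    simpa using this
  rw [hp] at hs
  simp at hs
  linarith
end
end CU

namespace CU
open Set MeasureTheory Filter Topology
open scoped ContDiff
section
variable {n : ℕ}
local notation "E" => EuclideanSpace ℝ (Fin n)

set_option maxHeartbeats 2000000 in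
theorem grad_est {u : E → ℝ → ℝ} {x0 : E} {t0 ρ M F0 K : ℝ} (hρ : 0 < ρ) (hM : 0 ≤ M) (hF : 0 ≤ F0) (hK : 0 < K)
    (hρM : ρ * M ≤ 1)
    (hc : ContinuousOn (fun p : E × ℝ => u p.1 p.2) (Metric.closedBall x0 ρ ×ˢ Icc t0 (t0 + ρ^2)))
    (hx : ∀ x ∈ Metric.closedBall x0 ρ, ∀ t ∈ Icc t0 (t0 + ρ^2), ContDiffAt ℝ 2 (fun y => u y t) x)
    (ht : ∀ x ∈ Metric.closedBall x0 ρ, ∀ t ∈ Icc t0 (t0 + ρ^2), DifferentiableAt ℝ (u x) t)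
    (he : ∀ x ∈ Metric.closedBall x0 ρ, ∀ t ∈ Icc t0 (t0 + ρ^2),
      |heat u x t| ≤ F0 + M * ‖fderiv ℝ (fun y => u y t) x‖)
    (hb : ∀ x ∈ Metric.closedBall x0 ρ, ∀ t ∈ Icc t0 (t0 + ρ^2), |u x t| ≤ K) :
    ‖fderiv ℝ (fun y => u y t0) x0‖ ≤ (100 * n + 100) * (K / ρ + ρ * F0) := by
  set A : ℝ := (100 * n + 100) * (K / ρ + ρ * F0) with hAdef
  set B : ℝ := 8 * K / ρ^2 with hBdef
  have hA : 0 ≤ A := by positivity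
  have hB : 0 < B := by positivity
  have hBρ : B * ρ^2 = 8 * K := by rw [hBdef]; field_simp
  have hn : (0:ℝ) ≤ n := Nat.cast_nonneg n
  have hAρ : 100 * K ≤ A * ρ := by
    have : A * ρ = (100 * n + 100) * (K + ρ^2 * F0) := by rw [hAdef]; field_simp
    rw [this]
    have h1 : 0 ≤ (n:ℝ) * K := by positivity
    have h2 : 0 ≤ (n:ℝ) * (ρ^2 * F0) := by positivity
    have h3 : 0 ≤ ρ^2 * F0 := by positivity
    linarith
  let D : Set (E × E × ℝ) := {p | ‖p.1 - x0‖ ≤ ρ/2 ∧ ‖p.1 - p.2.1‖ ≤ ρ/4 ∧ p.2.2 ∈ Icc t0 (t0 + ρ^2)}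
  let Φ : E × E × ℝ → ℝ := fun p => u p.1 p.2.2 - u p.2.1 p.2.2
    - A * (‖p.1 - p.2.1‖ - ‖p.1 - p.2.1‖^2/ρ) - B * ‖p.1 - x0‖^2 - B * (p.2.2 - t0)
  have hDx : ∀ p ∈ D, p.1 ∈ Metric.closedBall x0 ρ := fun p hp => by
    rw [mem_closedBall_iff_norm]; linarith [hp.1]
  have hDy : ∀ p ∈ D, p.2.1 ∈ Metric.closedBall x0 ρ := fun p hp => by
    rw [mem_closedBall_iff_norm]
    have : ‖p.2.1 - x0‖ ≤ ‖p.1 - x0‖ + ‖p.1 - p.2.1‖ := by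
      rw [norm_sub_rev p.1 p.2.1]
      calc _ = ‖(p.1 - x0) + (p.2.1 - p.1)‖ := by congr 1; abel
        _ ≤ _ := norm_add_le _ _
    linarith [hp.1, hp.2.1]
  have hDc : IsCompact D := by
    have hsub : D ⊆ Metric.closedBall x0 ρ ×ˢ (Metric.closedBall x0 ρ ×ˢ Icc t0 (t0 + ρ^2)) :=
      fun p hp => ⟨hDx p hp, hDy p hp, hp.2.2⟩
    refine IsCompact.of_isClosed_subset ((isCompact_closedBall _ _).prod ((isCompact_closedBall _ _).prod isCompact_Icc)) ?_ hsub
    have c1 : IsClosed {p : E × E × ℝ | ‖p.1 - x0‖ ≤ ρ/2} := isClosed_le (by fun_prop) (by fun_prop)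
    have c2 : IsClosed {p : E × E × ℝ | ‖p.1 - p.2.1‖ ≤ ρ/4} := isClosed_le (by fun_prop) (by fun_prop)
    have c3 : IsClosed {p : E × E × ℝ | p.2.2 ∈ Icc t0 (t0 + ρ^2)} := isClosed_Icc.preimage (by fun_prop)
    exact c1.inter (c2.inter c3)
  have hΦc : ContinuousOn Φ D := by
    have h1 : ContinuousOn (fun p : E × E × ℝ => u p.1 p.2.2) D :=
      hc.comp (f := fun p : E × E × ℝ => (p.1, p.2.2)) (by fun_prop) (fun p hp => ⟨hDx p hp, hp.2.2⟩)
    have h2 : ContinuousOn (fun p : E × E × ℝ => u p.2.1 p.2.2) D :=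
      hc.comp (f := fun p : E × E × ℝ => (p.2.1, p.2.2)) (by fun_prop) (fun p hp => ⟨hDy p hp, hp.2.2⟩)
    exact (((h1.sub h2).sub (by fun_prop)).sub (by fun_prop)).sub (by fun_prop)
  have main : ∀ p ∈ D, Φ p ≤ 0 := by
    by_contra! hcon
    obtain ⟨p0, hp0, hp0'⟩ := hcon
    obtain ⟨⟨x, y, t⟩, hp, hmax⟩ := hDc.exists_isMaxOn ⟨p0, hp0⟩ hΦc
    have hpos : 0 < Φ (x, y, t) := lt_of_lt_of_le hp0' (hmax hp0)
    have hxb := hDx _ hp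
    have hyb := hDy _ hp
    obtain ⟨hp1, hp2, hp3⟩ := hp
    simp only at hp1 hp2 hp3 hxb hyb
    have hux := hb x hxb t hp3
    have huy := hb y hyb t hp3
    set r := ‖x - y‖ with hr
    have hr0' : 0 ≤ r := norm_nonneg _
    have hpos' : 0 < u x t - u y t - A * (r - r^2/ρ) - B * ‖x - x0‖^2 - B * (t - t0) := hpos
    have hω : 0 ≤ A * (r - r^2/ρ) := by
      refine mul_nonneg hA ?_
      have : r - r^2/ρ = r * (1 - r/ρ) := by ring
      rw [this]
      refine mul_nonneg hr0' ?_
      rw [sub_nonneg, div_le_one hρ]; linarith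
    have hB1 : 0 ≤ B * ‖x - x0‖^2 := by positivity
    have hB2 : 0 ≤ B * (t - t0) := mul_nonneg hB.le (by linarith [hp3.1])
    have hu2 : u x t - u y t ≤ 2 * K := by linarith [(abs_le.1 hux).2, (abs_le.1 huy).1]
    have hr0 : 0 < r := by
      rcases hr0'.eq_or_lt with h | h
      · have : x = y := by rw [← sub_eq_zero, ← norm_eq_zero]; exact h.symm
        subst this
        linarith
      · exact h
    have hr4 : r < ρ/4 := by
      refine lt_of_le_of_ne hp2 fun h => ?_
      have : A * (r - r^2/ρ) = A * ρ * (3/16) := by rw [h]; field_simp; ring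
      linarith
    have hx2 : ‖x - x0‖ < ρ/2 := by
      refine lt_of_le_of_ne hp1 fun h => ?_
      have : B * ‖x - x0‖^2 = B * ρ^2 / 4 := by rw [h]; ring
      linarith
    have ht2 : t < t0 + ρ^2 := by
      refine lt_of_le_of_ne hp3.2 fun h => ?_
      have : B * (t - t0) = B * ρ^2 := by rw [h]; ring
      linarith
    have hev : ∀ᶠ p : E × E in 𝓝 (x, y), ‖p.1 - x0‖ < ρ/2 ∧ ‖p.1 - p.2‖ < ρ/4 := by
      have c1 : ContinuousAt (fun p : E × E => ‖p.1 - x0‖) (x,y) := by fun_prop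
      have c2 : ContinuousAt (fun p : E × E => ‖p.1 - p.2‖) (x,y) := by fun_prop
      exact (c1.eventually (gt_mem_nhds hx2)).and (c2.eventually (gt_mem_nhds hr4))
    have hev2 : ∀ᶠ p : E × E in 𝓝 (x, y), Φ (p.1, p.2, t) ≤ Φ (x, y, t) := by
      filter_upwards [hev] with p hp
      exact hmax (show (p.1, p.2, t) ∈ D from ⟨hp.1.le, hp.2.le, hp3⟩)
    have gx : ‖fderiv ℝ (fun y => u y t) x‖ ≤ A + B * ρ := by
      refine grad_le ((hx x hxb t hp3).differentiableAt (by simp)) (by positivity) ?_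
      have htd : Tendsto (fun z : E => (z, y)) (𝓝 x) (𝓝 (x, y)) := by
        have : Continuous (fun z : E => (z, y)) := by fun_prop
        exact this.tendsto x
      filter_upwards [htd.eventually hev, htd.eventually hev2] with z h1 h2
      simp only [Φ] at h1 h2
      have h3 := omega_lip (A := A) (ρ := ρ) (a := ‖z - y‖) (b := ‖x - y‖) (r := ‖z - x‖) hA hρ (norm_nonneg _) (norm_nonneg _)
        (by linarith [h1.2]) (by
          have := abs_norm_sub_norm_le (z - y) (x - y)
          simpa using this)
      have h4 : ‖z - x0‖^2 - ‖x - x0‖^2 ≤ ‖z - x‖ * ρ := by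
        have h5 : ‖z - x0‖ - ‖x - x0‖ ≤ ‖z - x‖ := by
          have := norm_sub_norm_le (z - x0) (x - x0)
          simpa using this
        have h6 : ‖z - x0‖^2 - ‖x - x0‖^2 = (‖z - x0‖ - ‖x - x0‖) * (‖z - x0‖ + ‖x - x0‖) := by ring
        rw [h6]
        calc _ ≤ ‖z - x‖ * (‖z - x0‖ + ‖x - x0‖) := mul_le_mul_of_nonneg_right h5 (by positivity)
          _ ≤ _ := mul_le_mul_of_nonneg_left (by linarith [h1.1]) (norm_nonneg _)
      have h7 := mul_le_mul_of_nonneg_left h4 hB.le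
      linarith
    have gy : ‖fderiv ℝ (fun y => u y t) y‖ ≤ A := by
      have : ‖fderiv ℝ (fun y => - u y t) y‖ ≤ A := by
        refine grad_le ((hx y hyb t hp3).differentiableAt (by simp)).neg (by positivity) ?_
        have htd : Tendsto (fun z : E => (x, z)) (𝓝 y) (𝓝 (x, y)) := by
          have : Continuous (fun z : E => (x, z)) := by fun_prop
          exact this.tendsto y
        filter_upwards [htd.eventually hev, htd.eventually hev2] with z h1 h2
        simp only [Φ] at h1 h2
        have h3 := omega_lip (A := A) (ρ := ρ) (a := ‖x - z‖) (b := ‖x - y‖) (r := ‖z - y‖) hA hρ (norm_nonneg _) (norm_nonneg _)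
          (by linarith [h1.2]) (by
            have := abs_norm_sub_norm_le (x - z) (x - y)
            rw [norm_sub_rev z y]
            simpa using this)
        linarith
      rwa [fderiv_fun_neg, norm_neg] at this
    have hl := lap_diff (A := A) (B := B) (ρ := ρ) (x0 := x0) (hx x hxb t hp3) (hx y hyb t hp3) hr hr0 (by
      filter_upwards [hev2] with p h
      simp only [Φ] at h
      linarith)
    have htm : deriv (u x) t - deriv (u y) t - B ≤ 0 := by
      have d1 := (ht x hxb t hp3).hasDerivAt
      have d2 := (ht y hyb t hp3).hasDerivAt
      have d3 : HasDerivAt (fun s : ℝ => B * (s - t0)) B t := by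
        simpa using ((hasDerivAt_id t).sub_const t0).const_mul B
      refine right_deriv_le ((d1.sub d2).sub d3) ht2 fun s hs => ?_
      have h := hmax (show (x, y, s) ∈ D from ⟨hp1, hp2, ⟨by linarith [hs.1, hp3.1], hs.2⟩⟩)
      have h : Φ (x, y, s) ≤ Φ (x, y, t) := h
      simp only [Φ] at h
      simp only [Pi.sub_apply]
      linarith
    have e1 := (abs_le.1 (he x hxb t hp3)).1
    have e2 := (abs_le.1 (he y hyb t hp3)).2
    simp only [heat] at e1 e2
    have m1 : M * ‖fderiv ℝ (fun y => u y t) x‖ ≤ M * (A + B * ρ) := mul_le_mul_of_nonneg_left gx hM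
    have m2 : M * ‖fderiv ℝ (fun y => u y t) y‖ ≤ M * A := mul_le_mul_of_nonneg_left gy hM
    have f1 : 8 * A / ρ ≤ 2 * B * n + B + 2 * F0 + M * (2 * A + B * ρ) := by linarith
    have f2 : 8 * (A * ρ) ≤ (2 * B * n + B + 2 * F0) * ρ^2 + (ρ * M) * (2 * (A * ρ) + B * ρ^2) := by
      have := mul_le_mul_of_nonneg_right f1 (sq_nonneg ρ)
      have e3 : 8 * A / ρ * ρ^2 = 8 * (A * ρ) := by field_simp
      rw [e3] at this
      linarith
    have f3 : (ρ * M) * (2 * (A * ρ) + B * ρ^2) ≤ 1 * (2 * (A * ρ) + B * ρ^2) :=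
      mul_le_mul_of_nonneg_right hρM (by positivity)
    have hAe : A * ρ = (100 * n + 100) * (K + ρ^2 * F0) := by rw [hAdef]; field_simp
    have g1 : 0 ≤ (n:ℝ) * K := by positivity
    have g2 : 0 ≤ (n:ℝ) * (ρ^2 * F0) := by positivity
    have g3 : 0 ≤ ρ^2 * F0 := by positivity
    have g4 : (2 * B * n + B + 2 * F0) * ρ^2 = 16 * (n * K) + 8 * K + 2 * (ρ^2 * F0) := by
      have : (2 * B * n + B + 2 * F0) * ρ^2 = (B * ρ^2) * (2 * n + 1) + 2 * (ρ^2 * F0) := by ring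
      rw [this, hBρ]; ring
    linarith
  have : ‖fderiv ℝ (fun y => - u y t0) x0‖ ≤ A := by
    have ht0 : t0 ∈ Icc t0 (t0 + ρ^2) := ⟨le_rfl, by linarith [sq_nonneg ρ]⟩
    have hx0 : x0 ∈ Metric.closedBall x0 ρ := Metric.mem_closedBall_self hρ.le
    refine grad_le ((hx x0 hx0 t0 ht0).differentiableAt (by simp)).neg hA ?_
    filter_upwards [Metric.ball_mem_nhds x0 (show 0 < ρ/4 by positivity)] with z hz
    rw [mem_ball_iff_norm, norm_sub_rev] at hz
    have h := main (x0, z, t0) ⟨by simp only [sub_self, norm_zero]; linarith, hz.le, ht0⟩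
    simp only [Φ, sub_self, norm_zero] at h
    have h2 : A * (‖x0 - z‖^2/ρ) ≥ 0 := by positivity
    rw [norm_sub_rev z x0]
    linarith
  rwa [fderiv_fun_neg, norm_neg] at this
end
end CU

namespace CU
open Set MeasureTheory Filter Topology
open scoped ContDiff
section
variable {n : ℕ}
local notation "E" => EuclideanSpace ℝ (Fin n)

structure Sol (Ω : Set E) (τ T M : ℝ) (u : E → ℝ → ℝ) : Prop where
  op : IsOpen Ω
  M0 : 0 < M
  cont : ContinuousOn (fun p : E × ℝ => u p.1 p.2) (Ω ×ˢ Iio T)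
  zero : ∀ x ∈ Ω, ∀ t ≤ τ, u x t = 0
  hx : ∀ x ∈ Ω, ∀ t ∈ Ioo τ T, ContDiffAt ℝ 2 (fun y => u y t) x
  ht : ∀ x ∈ Ω, ∀ t ∈ Ioo τ T, DifferentiableAt ℝ (u x) t
  heq : ∀ x ∈ Ω, ∀ t ∈ Ioo τ T, |heat u x t| ≤ M * (|u x t| + ‖fderiv ℝ (fun y => u y t) x‖)

variable {Ω : Set (EuclideanSpace ℝ (Fin n))} {τ T M : ℝ} {u : EuclideanSpace ℝ (Fin n) → ℝ → ℝ}

lemma Sol.ev0 (S : Sol Ω τ T M u) {x : E} (hx : x ∈ Ω) {t : ℝ} (ht : t ≤ τ) :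
    (fun y => u y t) =ᶠ[𝓝 x] fun _ => 0 := by
  filter_upwards [S.op.mem_nhds hx] with y hy using S.zero y hy t ht

lemma Sol.g0 (S : Sol Ω τ T M u) {x : E} (hx : x ∈ Ω) {t : ℝ} (ht : t ≤ τ) :
    fderiv ℝ (fun y => u y t) x = 0 := by
  rw [(S.ev0 hx ht).fderiv_eq]; simp

lemma Sol.cd (S : Sol Ω τ T M u) {x : E} (hx : x ∈ Ω) {t : ℝ} (ht : t < T) :
    ContDiffAt ℝ 2 (fun y => u y t) x := by
  rcases le_or_gt t τ with h | h
  · exact contDiffAt_const.congr_of_eventuallyEq (S.ev0 hx h)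
  · exact S.hx x hx t ⟨h, ht⟩

lemma Sol.bdd1 (S : Sol Ω τ T M u) {x0 : E} (hx0 : x0 ∈ Ω) {t0 : ℝ} (ht0 : t0 < T) :
    ∃ R C : ℝ, 0 < R ∧ R ≤ 1 ∧ 0 < C ∧ t0 + R < T ∧ Metric.closedBall x0 R ⊆ Ω ∧
      ∀ x ∈ Metric.closedBall x0 R, ∀ t ∈ Icc (t0 - R) (t0 + R),
        |u x t| ≤ C ∧ ‖fderiv ℝ (fun y => u y t) x‖ ≤ C := by
  obtain ⟨r, hr, hrΩ⟩ := Metric.isOpen_iff.1 S.op x0 hx0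
  obtain ⟨R, hR0, hR⟩ : ∃ R : ℝ, 0 < R ∧ R < min (min (r/2) 1) (min ((T-t0)/2) (1/M)) :=
    exists_between (by have := S.M0; refine lt_min (lt_min (by linarith) one_pos) (lt_min (by linarith) (by positivity)))
  simp only [lt_min_iff] at hR
  obtain ⟨⟨h1, h2⟩, h3, h4⟩ := hR
  have hM := S.M0
  have hsub : Metric.closedBall x0 (2*R) ⊆ Ω := (Metric.closedBall_subset_ball (by linarith)).trans hrΩ
  have hcomp : IsCompact (Metric.closedBall x0 (2*R) ×ˢ Icc (t0 - R) (t0 + 2*R)) := (isCompact_closedBall _ _).prod isCompact_Icc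
  have hcs : Metric.closedBall x0 (2*R) ×ˢ Icc (t0 - R) (t0 + 2*R) ⊆ Ω ×ˢ Iio T :=
    prod_mono hsub (fun t ht => by simp only [mem_Iio]; linarith [ht.2])
  obtain ⟨K0, hK0⟩ := hcomp.exists_bound_of_continuousOn (S.cont.mono hcs)
  set K := max K0 1
  have hKpos : 0 < K := lt_of_lt_of_le one_pos (le_max_right _ _)
  have hK : ∀ x ∈ Metric.closedBall x0 (2*R), ∀ t ∈ Icc (t0 - R) (t0 + 2*R), |u x t| ≤ K := fun x hx t ht =>
    (hK0 (x, t) ⟨hx, ht⟩).trans (le_max_left _ _)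
  set C := K + (100 * n + 100) * (K / R + R * (M * K))
  have hC : 0 ≤ (100 * n + 100) * (K / R + R * (M * K)) := by positivity
  refine ⟨R, C, hR0, h2.le, by positivity, by linarith, (Metric.closedBall_subset_closedBall (by linarith)).trans hsub, fun x hx t ht => ?_⟩
  have hx2 : x ∈ Metric.closedBall x0 (2*R) := Metric.closedBall_subset_closedBall (by linarith) hx
  refine ⟨(hK x hx2 t ⟨ht.1, by linarith [ht.2]⟩).trans (by simp only [C]; linarith), ?_⟩
  rcases le_or_gt t τ with h | h
  · rw [S.g0 (hsub hx2) h, norm_zero]; positivity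
  have hRR : R^2 ≤ R := by nlinarith
  have hb : ∀ z ∈ Metric.closedBall x R, z ∈ Metric.closedBall x0 (2*R) := fun z hz => by
    rw [Metric.mem_closedBall] at *
    linarith [dist_triangle z x x0]
  have hti : ∀ s ∈ Icc t (t + R^2), s ∈ Icc (t0-R) (t0+2*R) ∧ s ∈ Ioo τ T := fun s hs => by
    refine ⟨⟨?_, ?_⟩, ?_, ?_⟩ <;> linarith [hs.1, hs.2, ht.1, ht.2]
  have := grad_est (u := u) (x0 := x) (t0 := t) (ρ := R) (M := M) (F0 := M * K) (K := K) hR0 hM.le (by positivity) hKpos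
    (by rw [lt_div_iff₀ hM] at h4; linarith)
    (S.cont.mono fun p hp => hcs ⟨hb _ hp.1, (hti _ hp.2).1⟩)
    (fun z hz s hs => S.hx z (hsub (hb z hz)) s (hti s hs).2)
    (fun z hz s hs => S.ht z (hsub (hb z hz)) s (hti s hs).2)
    (fun z hz s hs => (S.heq z (hsub (hb z hz)) s (hti s hs).2).trans (by
      have := mul_le_mul_of_nonneg_left (hK z (hb z hz) s (hti s hs).1) hM.le
      linarith))
    (fun z hz s hs => hK z (hb z hz) s (hti s hs).1)
  refine this.trans ?_
  simp only [C]; linarith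

lemma heat_diff {u : E → ℝ → ℝ} {x y : E} {t : ℝ} (h1 : ContDiffAt ℝ 2 (fun z => u z t) x)
    (h2 : ContDiffAt ℝ 2 (fun z => u z t) (x + y)) (h3 : DifferentiableAt ℝ (u x) t)
    (h4 : DifferentiableAt ℝ (u (x+y)) t) :
    heat (fun z s => u (z + y) s - u z s) x t = heat u (x+y) t - heat u x t := by
  have hs : ContDiffAt ℝ 2 (fun z => u (z + y) t) x := by
    have := h2.comp x (f := fun z => z + y) (by fun_prop)
    exact this
  simp only [heat, lap]
  have a1 : deriv (fun s => u (x + y) s - u x s) t = deriv (u (x+y)) t - deriv (u x) t := deriv_fun_sub h4 h3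
  rw [a1]
  have a2 : iteratedFDeriv ℝ 2 (fun z => u (z + y) t - u z t) x = iteratedFDeriv ℝ 2 (fun z => u z t) (x+y)
      - iteratedFDeriv ℝ 2 (fun z => u z t) x := by
    have := iteratedFDeriv_sub_apply hs h1
    have e : (fun z => u (z + y) t - u z t) = (fun z => u (z + y) t) - (fun z => u z t) := rfl
    have h5 := iteratedFDeriv_comp_add_right' (𝕜 := ℝ) (f := fun z => u z t) 2 y
    rw [e, this, ← congrFun h5 x]
  rw [a2]
  simp only [_root_.sub_apply, Finset.sum_sub_distrib]
  ring

lemma Sol.bdd2 (S : Sol Ω τ T M u) {x0 : E} (hx0 : x0 ∈ Ω) {t0 : ℝ} (ht0 : t0 < T) :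
    ∃ R C : ℝ, 0 < R ∧ 0 < C ∧ t0 + R < T ∧ Metric.closedBall x0 R ⊆ Ω ∧
      ∀ t ∈ Icc (t0 - R) (t0 + R), ∀ x ∈ Metric.closedBall x0 R, ∀ x' ∈ Metric.closedBall x0 R, 
       ‖fderiv ℝ (fun y => u y t) x' - fderiv ℝ (fun y => u y t) x‖ ≤ C * √‖x' - x‖ := by
  obtain ⟨R, C, hR0, hR1, hC, hRT, hsub, hb⟩ := S.bdd1 hx0 ht0
  set C' := 6 * C / R + (100 * n + 100) * (C + 4 * M * C)
  have hM := S.M0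
  refine ⟨R/3, C', by linarith, by positivity, by linarith, (Metric.closedBall_subset_closedBall (by linarith)).trans hsub, ?_⟩
  intro t ht x hx x' hx'
  have big : ∀ z ∈ Metric.closedBall x0 (R/3), z ∈ Metric.closedBall x0 R := fun z hz =>
    Metric.closedBall_subset_closedBall (by linarith) hz
  have htb : t ∈ Icc (t0-R) (t0+R) := ⟨by linarith [ht.1], by linarith [ht.2]⟩
  rcases le_or_gt t τ with h | h
  · rw [S.g0 (hsub (big _ hx)) h, S.g0 (hsub (big _ hx')) h]; simp; positivity
  set y := x' - x with hy
  have hx'y : x' = x + y := by rw [hy]; abel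
  have p2 : 0 ≤ (100 * n + 100) * (C + 4 * M * C) := by positivity
  have p1 : 0 ≤ 6 * C / R := by positivity
  rcases eq_or_ne y 0 with hy0 | hy0
  · rw [hx'y, hy0]; simp
  have hyn : 0 < ‖y‖ := norm_pos_iff.2 hy0
  set ρ := √‖y‖ with hρ
  have hρ0 : 0 < ρ := Real.sqrt_pos.2 hyn
  have hρ2 : ρ^2 = ‖y‖ := Real.sq_sqrt hyn.le
  rcases le_or_gt ρ (R/3) with hl | hl
  · have hyR : ‖y‖ ≤ R/3 := by rw [← hρ2]; nlinarith
    have b1 : ∀ z ∈ Metric.closedBall x ρ, z ∈ Metric.closedBall x0 R := fun z hz => by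
      rw [Metric.mem_closedBall] at *
      linarith [dist_triangle z x x0]
    have b2 : ∀ z ∈ Metric.closedBall x ρ, z + y ∈ Metric.closedBall x0 R := fun z hz => by
      rw [Metric.mem_closedBall] at *
      have : dist (z+y) z = ‖y‖ := by simp
      linarith [dist_triangle z x x0, dist_triangle (z+y) z x0]
    have hti : ∀ s ∈ Icc t (t + ρ^2), s ∈ Icc (t0-R) (t0+R) ∧ s ∈ Ioo τ T := fun s hs => by
      rw [hρ2] at hs
      refine ⟨⟨?_, ?_⟩, ?_, ?_⟩ <;> linarith [hs.1, hs.2, ht.1, ht.2]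
    have key := grad_est (u := fun z s => u (z + y) s - u z s) (x0 := x) (t0 := t) (ρ := ρ) (M := 0) (F0 := 4 * M * C)
      (K := C * ‖y‖) hρ0 le_rfl (by positivity) (by positivity) (by simp)
      (by
        refine ContinuousOn.sub ?_ (S.cont.mono fun p hp => ⟨hsub (b1 _ hp.1), (hti _ hp.2).2.2⟩)
        exact S.cont.comp (f := fun p : E × ℝ => (p.1 + y, p.2)) (by fun_prop) fun p hp => ⟨hsub (b2 _ hp.1), (hti _ hp.2).2.2⟩)
      (fun z hz s hs => by
        have h1 := S.hx z (hsub (b1 z hz)) s (hti s hs).2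
        have h2 := S.hx _ (hsub (b2 z hz)) s (hti s hs).2
        exact (h2.comp z (f := fun z => z + y) (by fun_prop)).sub h1)
      (fun z hz s hs => (S.ht _ (hsub (b2 z hz)) s (hti s hs).2).sub (S.ht z (hsub (b1 z hz)) s (hti s hs).2))
      (fun z hz s hs => by
        rw [heat_diff (S.hx z (hsub (b1 z hz)) s (hti s hs).2) (S.hx _ (hsub (b2 z hz)) s (hti s hs).2)
          (S.ht z (hsub (b1 z hz)) s (hti s hs).2) (S.ht _ (hsub (b2 z hz)) s (hti s hs).2)]
        have h1 := S.heq z (hsub (b1 z hz)) s (hti s hs).2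
        have h2 := S.heq _ (hsub (b2 z hz)) s (hti s hs).2
        have k1 := hb z (b1 z hz) s (hti s hs).1
        have k2 := hb _ (b2 z hz) s (hti s hs).1
        have m1 := mul_le_mul_of_nonneg_left (add_le_add k1.1 k1.2) hM.le
        have m2 := mul_le_mul_of_nonneg_left (add_le_add k2.1 k2.2) hM.le
        have := abs_sub (heat u (z+y) s) (heat u z s)
        linarith)
      (fun z hz s hs => by
        have := (convex_closedBall x0 R).norm_image_sub_le_of_norm_fderiv_le (𝕜 := ℝ) (f := fun z => u z s) (C := C)
          (fun w hw => (S.hx w (hsub hw) s (hti s hs).2).differentiableAt (by simp))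
          (fun w hw => (hb w hw s (hti s hs).1).2) (b1 z hz) (b2 z hz)
        simpa using this)
    have e1 : fderiv ℝ (fun z => u (z + y) t - u z t) x = fderiv ℝ (fun y => u y t) x' - fderiv ℝ (fun y => u y t) x := by
      rw [fderiv_fun_sub, fderiv_comp_add_right (f := fun z => u z t), ← hx'y]
      · have h2 := S.hx _ (hsub (big _ hx')) t ⟨h, by linarith [ht.2]⟩
        rw [hx'y] at h2
        exact (h2.comp x (f := fun z => z + y) (by fun_prop)).differentiableAt (by simp)
      · exact (S.hx _ (hsub (big _ hx)) t ⟨h, by linarith [ht.2]⟩).differentiableAt (by simp)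
    rw [e1] at key
    refine key.trans ?_
    have e2 : C * ‖y‖ / ρ = C * ρ := by rw [← hρ2]; field_simp
    rw [e2]
    have : 0 ≤ 6 * C / R * ρ := by positivity
    simp only [C']
    linarith
  · have n1 := (hb x (big _ hx) t htb).2
    have n2 := (hb x' (big _ hx') t htb).2
    have := norm_sub_le (fderiv ℝ (fun y => u y t) x') (fderiv ℝ (fun y => u y t) x)
    have h5 : 2 * C ≤ 6 * C / R * ρ := by
      rw [div_mul_eq_mul_div, le_div_iff₀ hR0]; nlinarith
    have h6 : 0 ≤ (100 * n + 100) * (C + 4 * M * C) * ρ := by positivity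
    simp only [C']
    linarith

theorem Sol.gcont (S : Sol Ω τ T M u) (v : E) :
    ContinuousOn (fun p : E × ℝ => fderiv ℝ (fun y => u y p.2) p.1 v) (Ω ×ˢ Iio T) := by
  rintro ⟨x0, t0⟩ ⟨hx0, ht0⟩
  refine ContinuousAt.continuousWithinAt ?_
  simp only [mem_Iio] at hx0 ht0
  obtain ⟨R, C, hR0, hC, hRT, hsub, hb⟩ := S.bdd2 hx0 ht0
  rw [Metric.continuousAt_iff']
  intro ε hε
  have hh : Tendsto (fun h : ℝ => C * √(h * ‖v‖) * ‖v‖) (𝓝[>] 0) (𝓝 0) := by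
    have : Continuous (fun h : ℝ => C * √(h * ‖v‖) * ‖v‖) := by fun_prop
    have := this.tendsto 0
    simp only [zero_mul, Real.sqrt_zero, mul_zero] at this
    exact this.mono_left nhdsWithin_le_nhds
  have hh2 : Tendsto (fun h : ℝ => h * ‖v‖) (𝓝[>] 0) (𝓝 0) := by
    have : Continuous (fun h : ℝ => h * ‖v‖) := by fun_prop
    have := this.tendsto 0
    simp only [zero_mul] at this
    exact this.mono_left nhdsWithin_le_nhds
  obtain ⟨h, ⟨hh1, hh3⟩, hpos⟩ := ((hh.eventually (gt_mem_nhds (show 0 < ε/4 by positivity))).and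
    (hh2.eventually (gt_mem_nhds (show 0 < R/2 by positivity)))).and self_mem_nhdsWithin |>.exists
  have hpos : 0 < h := hpos
  have key : ∀ x ∈ Metric.closedBall x0 (R/2), ∀ t ∈ Icc (t0-R) (t0+R),
      |(u (x + h • v) t - u x t)/h - fderiv ℝ (fun y => u y t) x v| ≤ ε/4 := by
    intro x hx t ht
    have hvn : ‖h • v‖ = h * ‖v‖ := by rw [norm_smul, Real.norm_eq_abs, abs_of_pos hpos]
    have hx' : x ∈ Metric.closedBall x0 R := Metric.closedBall_subset_closedBall (by linarith) hx
    have hb1 : ∀ w ∈ Metric.closedBall x (h * ‖v‖), w ∈ Metric.closedBall x0 R := fun w hw => by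
      rw [Metric.mem_closedBall] at *
      linarith [dist_triangle w x x0]
    have := (convex_closedBall x (h * ‖v‖)).norm_image_sub_le_of_norm_fderiv_le' (𝕜 := ℝ) (f := fun z => u z t)
      (C := C * √(h * ‖v‖)) (φ := fderiv ℝ (fun y => u y t) x) (x := x) (y := x + h • v)
          (fun w hw => (S.cd (hsub (hb1 w hw)) (by linarith [ht.2])).differentiableAt (by simp))
          (fun w hw => (hb t ht x hx' w (hb1 w hw)).trans (mul_le_mul_of_nonneg_left (Real.sqrt_le_sqrt (by
              rwa [mem_closedBall_iff_norm] at hw)) hC.le)) (Metric.mem_closedBall_self (by positivity)) (by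
            rw [mem_closedBall_iff_norm, add_sub_cancel_left, hvn])
    rw [add_sub_cancel_left, hvn, map_smul, Real.norm_eq_abs] at this
    have e : (u (x + h • v) t - u x t)/h - fderiv ℝ (fun y => u y t) x v
      = (u (x + h • v) t - u x t - h • fderiv ℝ (fun y => u y t) x v)/h := by
      simp only [smul_eq_mul]; field_simp
    rw [e, abs_div, abs_of_pos hpos, div_le_iff₀ hpos]
    refine this.trans ?_
    have := mul_le_mul_of_nonneg_left hh1.le hpos.le
    linarith
  have hcc : ContinuousAt (fun p : E × ℝ => (u (p.1 + h • v) p.2 - u p.1 p.2)/h) (x0, t0) := by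
    have hop : IsOpen (Ω ×ˢ Iio T) := S.op.prod isOpen_Iio
    have hm : x0 + h • v ∈ Ω := hsub (by
      rw [mem_closedBall_iff_norm, add_sub_cancel_left, norm_smul, Real.norm_eq_abs, abs_of_pos hpos]; linarith)
    have c1 : ContinuousAt (fun p : E × ℝ => u p.1 p.2) (x0, t0) := S.cont.continuousAt (hop.mem_nhds ⟨hx0, ht0⟩)
    have c2 : ContinuousAt (fun p : E × ℝ => u p.1 p.2) (x0 + h • v, t0) := S.cont.continuousAt (hop.mem_nhds ⟨hm, ht0⟩)
    have c3 : ContinuousAt (fun p : E × ℝ => u (p.1 + h • v) p.2) (x0, t0) :=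
      ContinuousAt.comp (f := fun p : E × ℝ => (p.1 + h • v, p.2)) (g := fun p : E × ℝ => u p.1 p.2) c2 (by fun_prop)
    exact (c3.sub c1).div_const _
  rw [Metric.continuousAt_iff'] at hcc
  have hn : Metric.closedBall x0 (R/2) ×ˢ Icc (t0-R) (t0+R) ∈ 𝓝 (x0, t0) :=
    prod_mem_nhds (Metric.closedBall_mem_nhds _ (by linarith)) (Icc_mem_nhds (by linarith) (by linarith))
  filter_upwards [hcc (ε/4) (by positivity), hn] with p hp hp2
  have k1 := key p.1 hp2.1 p.2 hp2.2
  have k2 := key x0 (Metric.mem_closedBall_self (by linarith)) t0 ⟨by linarith, by linarith⟩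
  rw [Real.dist_eq] at hp ⊢
  rw [abs_le] at k1 k2
  rw [abs_lt] at hp ⊢
  constructor <;> linarith [k1.1, k1.2, k2.1, k2.2, hp.1, hp.2]
end
end CU

namespace CU
open Set MeasureTheory Filter Topology
open scoped ContDiff

section car
variable {Y : Type*} [NormedAddCommGroup Y] [NormedSpace ℝ Y]

lemma two_le_inf : (2 : WithTop ℕ∞) ≤ ∞ := by
  have : ((2 : ℕ∞) : WithTop ℕ∞) ≤ ∞ := WithTop.coe_le_coe.2 le_top
  exact this

noncomputable def d (a : Y) (f : Y → ℝ) : Y → ℝ := fun y => fderiv ℝ f y a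

lemma d_mul {a : Y} {f g : Y → ℝ} {y : Y} (hf : DifferentiableAt ℝ f y)
    (hg : DifferentiableAt ℝ g y) :
    d a (fun y => f y * g y) y = d a f y * g y + f y * d a g y := by
  simp only [d]
  rw [fderiv_fun_mul hf hg]
  simp; ring

lemma d_add {a : Y} {f g : Y → ℝ} {y : Y} (hf : DifferentiableAt ℝ f y)
    (hg : DifferentiableAt ℝ g y) :
    d a (fun y => f y + g y) y = d a f y + d a g y := by
  simp only [d]
  rw [fderiv_fun_add hf hg]
  simp

lemma d_sub {a : Y} {f g : Y → ℝ} {y : Y} (hf : DifferentiableAt ℝ f y)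
    (hg : DifferentiableAt ℝ g y) :
    d a (fun y => f y - g y) y = d a f y - d a g y := by
  simp only [d]
  rw [fderiv_fun_sub hf hg]
  simp

lemma d_cmul {a : Y} {c : ℝ} {f : Y → ℝ} {y : Y} (hf : DifferentiableAt ℝ f y) :
    d a (fun y => c * f y) y = c * d a f y := by
  simp only [d]
  rw [fderiv_const_mul hf]
  simp

lemma d_sum {a : Y} {ι : Type*} {s : Finset ι} {f : ι → Y → ℝ} {y : Y}
    (hf : ∀ i ∈ s, DifferentiableAt ℝ (f i) y) :
    d a (fun y => ∑ i ∈ s, f i y) y = ∑ i ∈ s, d a (f i) y := by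
  simp only [d]
  rw [fderiv_fun_sum hf]
  simp

lemma d_contDiffAt {a : Y} {f : Y → ℝ} {y : Y} (hf : ContDiffAt ℝ ∞ f y) :
    ContDiffAt ℝ ∞ (d a f) y := by
  have := hf.fderiv_right (m := ∞) (by simp)
  exact this.clm_apply contDiffAt_const

lemma d_contDiff {a : Y} {f : Y → ℝ} (hf : ContDiff ℝ ∞ f) :
    ContDiff ℝ ∞ (d a f) :=
  contDiff_iff_contDiffAt.2 fun _ => d_contDiffAt hf.contDiffAt

lemma d_comm {a b : Y} {f : Y → ℝ} {y : Y} (hf : ContDiffAt ℝ ∞ f y) :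
    d a (d b f) y = d b (d a f) y := by
  have h := hf.isSymmSndFDerivAt (by simpa using two_le_inf)
  have hd : DifferentiableAt ℝ (fderiv ℝ f) y :=
    (hf.fderiv_right (m := ∞) (by simp)).differentiableAt (by simp)
  have e : ∀ c b : Y, d c (d b f) y = fderiv ℝ (fderiv ℝ f) y c b := by
    intro c b
    show fderiv ℝ (fun z => fderiv ℝ f z b) y c = _
    rw [fderiv_clm_apply hd (differentiableAt_const b)]
    simp
  rw [e, e]; exact h.eq a b

lemma d_congr {a : Y} {f g : Y → ℝ} {y : Y} (h : f =ᶠ[𝓝 y] g) : d a f =ᶠ[𝓝 y] d a g := by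
  filter_upwards [h.fderiv (𝕜 := ℝ)] with z hz
  simp [d, hz]

lemma d_zero_of {a : Y} {f : Y → ℝ} {y : Y} (h : f =ᶠ[𝓝 y] fun _ => 0) :
    d a f =ᶠ[𝓝 y] fun _ => 0 := by
  filter_upwards [d_congr (a := a) h] with z hz
  rw [hz]; simp [d]

variable [MeasurableSpace Y] [BorelSpace Y] [FiniteDimensional ℝ Y] (ν : Measure Y)
  [ν.IsAddHaarMeasure]

lemma integral_d {a : Y} {f : Y → ℝ} (hf : ContDiff ℝ ∞ f) (hc : HasCompactSupport f) :
    Integrable (d a f) ν ∧ ∫ y, d a f y ∂ν = 0 := by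
  have hc' : HasCompactSupport (d a f) := by
    refine HasCompactSupport.of_support_subset_isCompact hc ?_
    intro y hy
    by_contra h
    apply hy
    exact (d_zero_of (a := a) (notMem_tsupport_iff_eventuallyEq.1 h)).self_of_nhds
  have hi : Integrable (d a f) ν := (d_contDiff hf).continuous.integrable_of_hasCompactSupport hc'
  have hi0 : Integrable f ν := hf.continuous.integrable_of_hasCompactSupport hc
  refine ⟨hi, ?_⟩
  have := integral_mul_fderiv_eq_neg_fderiv_mul_of_integrable (𝕜 := ℝ) (μ := ν)
    (f := fun _ : Y => (1 : ℝ)) (g := f) (v := a) (by simp) (by simp only [one_mul]; exact hi)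
    (by simpa using hi0) (by intros; fun_prop)
    (by intros; exact (hf.differentiable (by simp)).differentiableAt)
  simpa [d] using this

theorem carleman {ι : Type*} [Fintype ι] (e : ι → Y) (τ : Y) (v V L G : Y → ℝ) (p : ι → Y → ℝ)
    (hv : ContDiff ℝ ∞ v) (hc : HasCompactSupport v)
    (hV : ∀ y ∈ tsupport v, ContDiffAt ℝ ∞ V y)
    (hL : ∀ y ∈ tsupport v, ContDiffAt ℝ ∞ L y)
    (hG : ∀ y ∈ tsupport v, ContDiffAt ℝ ∞ G y)
    (hp : ∀ i, ∀ y ∈ tsupport v, ContDiffAt ℝ ∞ (p i) y)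
    (hdiv : ∀ y ∈ tsupport v, ∑ i, d (e i) (p i) y = L y)
    (R : Y → ℝ) (hR : Integrable R ν)
    (hRle : ∀ y ∈ tsupport v, R y ≤ 4 * ∑ i, ∑ j, d (e i) (p j) y * d (e i) v y * d (e j) v y
      + 2 * G y * ∑ i, (d (e i) v y) ^ 2 + v y ^ 2 * (- d τ V y + 2 * ∑ i, d (e i) V y * p i y
        - ∑ i, d (e i) (d (e i) L) y - ∑ i, d (e i) (d (e i) G) y - 2 * G y * V y - G y ^ 2))
    (hR0 : ∀ y ∉ tsupport v, R y = 0)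
    (Z : Y → ℝ) (hZ : Integrable Z ν) (hZ0 : ∀ y, 0 ≤ Z y)
    (hZle : ∀ y ∈ tsupport v, (∑ i, d (e i) (d (e i) v) y + V y * v y + d τ v y
      - 2 * ∑ i, p i y * d (e i) v y - L y * v y) ^ 2 ≤ Z y) :
    ∫ y, R y ∂ν ≤ ∫ y, Z y ∂ν := by
  classical
  set W : ι → Y → ℝ := fun i y => 2 * (d (e i) v y * d τ v y) - 2 * (d (e i) v y * (L y * v y))
    + d (e i) L y * (v y * v y) - 2 * (G y * (v y * d (e i) v y)) + d (e i) G y * (v y * v y)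
    - 2 * (V y * (p i y * (v y * v y))) - 4 * (d (e i) v y * ∑ j, p j y * d (e j) v y)
    + 2 * (p i y * ∑ j, d (e j) v y * d (e j) v y) with hW
  set Wt : Y → ℝ := fun y => V y * (v y * v y) - ∑ j, d (e j) v y * d (e j) v y with hWt
  have hdv : ∀ a, ContDiff ℝ ∞ (d a v) := fun a => d_contDiff hv
  have hdL : ∀ a, ∀ y ∈ tsupport v, ContDiffAt ℝ ∞ (d a L) y := fun a y hy => d_contDiffAt (hL y hy)
  have hdG : ∀ a, ∀ y ∈ tsupport v, ContDiffAt ℝ ∞ (d a G) y := fun a y hy => d_contDiffAt (hG y hy)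
  have key : ∀ F : Y → ℝ, (∀ y ∈ tsupport v, ContDiffAt ℝ ∞ F y) →
      (∀ y, v y = 0 → (∀ a, d a v y = 0) → F y = 0) → ContDiff ℝ ∞ F ∧ HasCompactSupport F := by
    intro F h1 h2
    have h3 : ∀ y ∉ tsupport v, F =ᶠ[𝓝 y] fun _ => 0 := by
      intro y hy
      have ho : IsOpen (tsupport v)ᶜ := (isClosed_tsupport v).isOpen_compl
      filter_upwards [ho.mem_nhds hy] with z hz
      refine h2 z (image_eq_zero_of_notMem_tsupport hz) fun a => ?_
      exact (d_zero_of (a := a) (notMem_tsupport_iff_eventuallyEq.1 hz)).self_of_nhds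
    constructor
    · rw [contDiff_iff_contDiffAt]
      intro y
      by_cases hy : y ∈ tsupport v
      · exact h1 y hy
      · exact contDiffAt_const.congr_of_eventuallyEq (h3 y hy)
    · refine HasCompactSupport.of_support_subset_isCompact hc ?_
      intro y hy
      by_contra h
      exact hy (h3 y h).self_of_nhds
  have kW : ∀ i, ContDiff ℝ ∞ (W i) ∧ HasCompactSupport (W i) := by
    intro i
    apply key
    · intro y hy
      have := hV y hy; have := hL y hy; have := hG y hy; have := fun i => hp i y hy
      have := hdL (e i) y hy; have := hdG (e i) y hy
      have := hv.contDiffAt (x := y)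
      have := fun a => (hdv a).contDiffAt (x := y)
      have h1 : ContDiffAt ℝ ∞ (fun y => ∑ j, p j y * d (e j) v y) y :=
        ContDiffAt.sum fun j _ => (hp j y hy).mul (this _)
      have h2 : ContDiffAt ℝ ∞ (fun y => ∑ j, d (e j) v y * d (e j) v y) y :=
        ContDiffAt.sum fun j _ => (this _).mul (this _)
      simp only [hW]
      fun_prop
    · intro y h1 h2
      simp [hW, h1, h2]
  have kt : ContDiff ℝ ∞ Wt ∧ HasCompactSupport Wt := by
    apply key
    · intro y hy
      have := hV y hy
      have := hv.contDiffAt (x := y)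
      have := fun a => (hdv a).contDiffAt (x := y)
      have h2 : ContDiffAt ℝ ∞ (fun y => ∑ j, d (e j) v y * d (e j) v y) y :=
        ContDiffAt.sum fun j _ => (this _).mul (this _)
      simp only [hWt]
      fun_prop
    · intro y h1 h2
      simp [hWt, h1, h2]
  have hInt0 : Integrable (fun y => R y + (∑ i, d (e i) (W i) y + d τ Wt y)) ν := by
    refine hR.add (Integrable.add ?_ (integral_d ν kt.1 kt.2).1)
    exact integrable_finsetSum _ fun i _ => (integral_d ν (kW i).1 (kW i).2).1
  have hzero : ∫ y, (R y + (∑ i, d (e i) (W i) y + d τ Wt y)) ∂ν = ∫ y, R y ∂ν := by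
    rw [integral_add hR, integral_add, integral_finsetSum]
    · rw [(integral_d ν kt.1 kt.2).2, Finset.sum_eq_zero]
      · simp
      · intro i _; exact (integral_d ν (kW i).1 (kW i).2).2
    · intro i _; exact (integral_d ν (kW i).1 (kW i).2).1
    · exact integrable_finsetSum _ fun i _ => (integral_d ν (kW i).1 (kW i).2).1
    · exact (integral_d ν kt.1 kt.2).1
    · exact Integrable.add (integrable_finsetSum _ fun i _ => (integral_d ν (kW i).1 (kW i).2).1)
        (integral_d ν kt.1 kt.2).1
  rw [← hzero]
  refine integral_mono hInt0 hZ fun y => ?_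
  by_cases hy : y ∈ tsupport v
  swap
  · have h0 : ∀ (F : Y → ℝ) a, (tsupport F ⊆ tsupport v) → d a F y = 0 := by
      intro F a hF
      exact (d_zero_of (a := a)
        (notMem_tsupport_iff_eventuallyEq.1 (fun h => hy (hF h)))).self_of_nhds
    have hts : ∀ F : Y → ℝ, (∀ y, v y = 0 → (∀ a, d a v y = 0) → F y = 0) →
        tsupport F ⊆ tsupport v := by
      intro F hF
      refine closure_minimal ?_ (isClosed_tsupport v)
      intro z hz
      by_contra h
      refine hz (hF z (image_eq_zero_of_notMem_tsupport h) fun a => ?_)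
      exact (d_zero_of (a := a) (notMem_tsupport_iff_eventuallyEq.1 h)).self_of_nhds
    have e1 : ∀ i, d (e i) (W i) y = 0 := fun i => h0 _ _ (hts _ (by
      intro y h1 h2; simp [hW, h1, h2]))
    have e2 : d τ Wt y = 0 := h0 _ _ (hts _ (by intro y h1 h2; simp [hWt, h1, h2]))
    simp [e1, e2, hR0 y hy, hZ0 y]
  have dV := (hV y hy).differentiableAt (by simp)
  have dL := (hL y hy).differentiableAt (by simp)
  have dG := (hG y hy).differentiableAt (by simp)
  have dp := fun i => (hp i y hy).differentiableAt (by simp)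
  have ddL := fun a => (hdL a y hy).differentiableAt (by simp)
  have ddG := fun a => (hdG a y hy).differentiableAt (by simp)
  have dv := (hv.contDiffAt (x := y)).differentiableAt (by simp)
  have ddv := fun a => ((hdv a).contDiffAt (x := y)).differentiableAt (by simp)
  have dS1 : DifferentiableAt ℝ (fun y => ∑ j, p j y * d (e j) v y) y :=
    DifferentiableAt.fun_sum fun j _ => (dp j).mul (ddv _)
  have dS2 : DifferentiableAt ℝ (fun y => ∑ j, d (e j) v y * d (e j) v y) y :=
    DifferentiableAt.fun_sum fun j _ => (ddv _).mul (ddv _)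
  have eS1 : ∀ a, d a (fun y => ∑ j, p j y * d (e j) v y) y
      = ∑ j, (d a (p j) y * d (e j) v y + p j y * d a (d (e j) v) y) := by
    intro a
    rw [d_sum (fun j _ => (dp j).fun_mul (ddv _))]
    exact Finset.sum_congr rfl fun j _ => d_mul (dp j) (ddv _)
  have eS2 : ∀ a, d a (fun y => ∑ j, d (e j) v y * d (e j) v y) y
      = ∑ j, (d a (d (e j) v) y * d (e j) v y + d (e j) v y * d a (d (e j) v) y) := by
    intro a
    rw [d_sum (fun j _ => (ddv _).fun_mul (ddv _))]
    exact Finset.sum_congr rfl fun j _ => d_mul (ddv _) (ddv _)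
  have eWt : d τ Wt y = d τ V y * (v y * v y) + V y * (d τ v y * v y + v y * d τ v y)
      - ∑ j, (d τ (d (e j) v) y * d (e j) v y + d (e j) v y * d τ (d (e j) v) y) := by
    simp only [hWt]
    rw [d_sub (by fun_prop) dS2, d_mul dV (by fun_prop), d_mul dv dv, eS2]
  have eW : ∀ i, d (e i) (W i) y =
      2 * (d (e i) (d (e i) v) y * d τ v y + d (e i) v y * d (e i) (d τ v) y)
      - 2 * (d (e i) (d (e i) v) y * (L y * v y)
          + d (e i) v y * (d (e i) L y * v y + L y * d (e i) v y))
      + (d (e i) (d (e i) L) y * (v y * v y) + d (e i) L y * (d (e i) v y * v y + v y * d (e i) v y))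
      - 2 * (d (e i) G y * (v y * d (e i) v y) +
          G y * (d (e i) v y * d (e i) v y + v y * d (e i) (d (e i) v) y))
      + (d (e i) (d (e i) G) y * (v y * v y) + d (e i) G y * (d (e i) v y * v y + v y * d (e i) v y))
      - 2 * (d (e i) V y * (p i y * (v y * v y)) + V y * (d (e i) (p i) y * (v y * v y) +
          p i y * (d (e i) v y * v y + v y * d (e i) v y)))
      - 4 * (d (e i) (d (e i) v) y * (∑ j, p j y * d (e j) v y) + d (e i) v y *
          ∑ j, (d (e i) (p j) y * d (e j) v y + p j y * d (e i) (d (e j) v) y))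
      + 2 * (d (e i) (p i) y * (∑ j, d (e j) v y * d (e j) v y) + p i y *
         ∑ j, (d (e i) (d (e j) v) y * d (e j) v y + d (e j) v y * d (e i) (d (e j) v) y)) := by
    intro i
    have := dp i
    have := ddv (e i)
    have := ddv τ
    have := ddL (e i)
    have := ddG (e i)
    simp only [hW]
    rw [d_add (by fun_prop) (by fun_prop), d_sub (by fun_prop) (by fun_prop),
      d_sub (by fun_prop) (by fun_prop), d_add (by fun_prop) (by fun_prop),
      d_sub (by fun_prop) (by fun_prop), d_add (by fun_prop) (by fun_prop),
      d_sub (by fun_prop) (by fun_prop), d_cmul (by fun_prop), d_cmul (by fun_prop),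
      d_cmul (by fun_prop), d_cmul (by fun_prop), d_cmul (by fun_prop), d_cmul (by fun_prop),
      d_mul (by fun_prop) (by fun_prop), d_mul (by fun_prop) (by fun_prop),
      d_mul (f := L) (by fun_prop) (by fun_prop),
      d_mul (f := d (e i) L) (by fun_prop) (by fun_prop),
      d_mul (f := v) (g := v) (by fun_prop) (by fun_prop),
      d_mul (f := G) (by fun_prop) (by fun_prop),
      d_mul (f := v) (g := d (e i) v) (by fun_prop) (by fun_prop),
      d_mul (f := d (e i) G) (by fun_prop) (by fun_prop),
      d_mul (f := v) (g := v) (by fun_prop) (by fun_prop),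
      d_mul (f := V) (by fun_prop) (by fun_prop),
      d_mul (f := p i) (by fun_prop) (by fun_prop),
      d_mul (f := v) (g := v) (by fun_prop) (by fun_prop),
      d_mul (f := d (e i) v) (by fun_prop) (by fun_prop), eS1,
      d_mul (f := p i) (by fun_prop) (by fun_prop), eS2]
  have hle := hRle y hy
  have hz := hZle y hy
  have hL' := hdiv y hy
  refine le_trans ?_ hz
  have hsq : ∀ S A g : ℝ, -2 * g * S - g ^ 2 + 2 * S * A ≤ (S + A) ^ 2 := by
    intro S A g; nlinarith [sq_nonneg (S + g), sq_nonneg A]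
  have h1 := hsq (∑ i, d (e i) (d (e i) v) y + V y * v y)
    (d τ v y - 2 * ∑ i, p i y * d (e i) v y - L y * v y) (G y * v y)
  have hfin : 4 * ∑ i, ∑ j, d (e i) (p j) y * d (e i) v y * d (e j) v y
      + 2 * G y * ∑ i, (d (e i) v y) ^ 2 + v y ^ 2 * (- d τ V y + 2 * ∑ i, d (e i) V y * p i y
        - ∑ i, d (e i) (d (e i) L) y - ∑ i, d (e i) (d (e i) G) y - 2 * G y * V y - G y ^ 2)
      + (∑ i, d (e i) (W i) y + d τ Wt y) = -2 * (G y * v y) *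
        (∑ i, d (e i) (d (e i) v) y + V y * v y) - (G y * v y) ^ 2
      + 2 * (∑ i, d (e i) (d (e i) v) y + V y * v y) *
        (d τ v y - 2 * ∑ i, p i y * d (e i) v y - L y * v y) := by
    rw [eWt]
    simp only [eW]
    have hsym : ∑ i, d (e i) v y * ∑ j, p j y * d (e i) (d (e j) v) y
        = ∑ i, p i y * ∑ j, d (e j) v y * d (e i) (d (e j) v) y := by
      simp only [Finset.mul_sum]
      rw [Finset.sum_comm]
      refine Finset.sum_congr rfl fun i _ => Finset.sum_congr rfl fun j _ => ?_
      rw [d_comm (a := e i) hv.contDiffAt]; ring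
    have hPP : ∑ i, ∑ j, d (e i) (p j) y * d (e i) v y * d (e j) v y
        = ∑ i, d (e i) v y * ∑ j, d (e i) (p j) y * d (e j) v y := by
      simp only [Finset.mul_sum]
      refine Finset.sum_congr rfl fun i _ => Finset.sum_congr rfl fun j _ => ?_
      ring
    have hτ : ∀ j, d τ (d (e j) v) y = d (e j) (d τ v) y := fun j => d_comm hv.contDiffAt
    simp only [hτ]
    have c1 : ∀ i, ∑ j, (d (e i) (p j) y * d (e j) v y + p j y * d (e i) (d (e j) v) y)
      = ∑ j, d (e i) (p j) y * d (e j) v y + ∑ j, p j y * d (e i) (d (e j) v) y :=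
        fun i => Finset.sum_add_distrib
    have c2 : ∀ i, ∑ j, (d (e i) (d (e j) v) y * d (e j) v y + d (e j) v y * d (e i) (d (e j) v) y)
      = 2 * ∑ j, d (e j) v y * d (e i) (d (e j) v) y := by
      intro i; rw [Finset.mul_sum]; exact Finset.sum_congr rfl fun j _ => by ring
    have c3 : ∑ j, (d (e j) (d τ v) y * d (e j) v y + d (e j) v y * d (e j) (d τ v) y)
      = 2 * ∑ j, d (e j) v y * d (e j) (d τ v) y := by
      rw [Finset.mul_sum]; exact Finset.sum_congr rfl fun j _ => by ring
    simp only [c1, c2, c3]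
    rw [hPP]
    set S1 := ∑ j, p j y * d (e j) v y
    have s2 : ∑ i, (d (e i) v y) ^ 2 = ∑ j, d (e j) v y * d (e j) v y :=
      Finset.sum_congr rfl fun j _ => by ring
    rw [s2]
    set S2 := ∑ j, d (e j) v y * d (e j) v y
    have expand : ∀ i, (2 * (d (e i) (d (e i) v) y * d τ v y + d (e i) v y * d (e i) (d τ v) y)
      - 2 * (d (e i) (d (e i) v) y * (L y * v y)
          + d (e i) v y * (d (e i) L y * v y + L y * d (e i) v y))
      + (d (e i) (d (e i) L) y * (v y * v y) + d (e i) L y * (d (e i) v y * v y + v y * d (e i) v y))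
      - 2 * (d (e i) G y * (v y * d (e i) v y) +
          G y * (d (e i) v y * d (e i) v y + v y * d (e i) (d (e i) v) y))
      + (d (e i) (d (e i) G) y * (v y * v y) + d (e i) G y * (d (e i) v y * v y + v y * d (e i) v y))
      - 2 * (d (e i) V y * (p i y * (v y * v y)) + V y * (d (e i) (p i) y * (v y * v y) +
          p i y * (d (e i) v y * v y + v y * d (e i) v y)))
      - 4 * (d (e i) (d (e i) v) y * S1 + d (e i) v y *
          (∑ j, d (e i) (p j) y * d (e j) v y + ∑ j, p j y * d (e i) (d (e j) v) y))
      + 2 * (d (e i) (p i) y * S2 + p i y *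
         (2 * ∑ j, d (e j) v y * d (e i) (d (e j) v) y)))
      = d (e i) (d (e i) v) y * (2 * d τ v y - 2 * L y * v y - 2 * G y * v y - 4 * S1)
        + (d (e i) v y * d (e i) (d τ v) y) * 2
        + (d (e i) v y * d (e i) v y) * (-2 * L y - 2 * G y)
        + d (e i) (d (e i) L) y * (v y ^ 2) + d (e i) (d (e i) G) y * (v y ^ 2)
        + (d (e i) V y * p i y) * (- 2 * v y ^ 2) + d (e i) (p i) y * (-2 * V y * v y ^ 2 + 2 * S2)
        + (p i y * d (e i) v y) * (- 4 * V y * v y)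
        + (d (e i) v y * ∑ j, d (e i) (p j) y * d (e j) v y) * (-4)
        + (d (e i) v y * ∑ j, p j y * d (e i) (d (e j) v) y) * (-4)
        + (p i y * ∑ j, d (e j) v y * d (e i) (d (e j) v) y) * 4 := by
      intro i; ring
    simp only [expand, Finset.sum_add_distrib, ← Finset.sum_mul]
    rw [hsym, hL']
    ring
  calc _ ≤ _ := by
        show R y + (∑ i, d (e i) (W i) y + d τ Wt y) ≤ _
        exact add_le_add_left hle _
    _ = _ := hfin
    _ ≤ _ := h1
    _ = _ := by ring
end car
end CU

namespace CU

lemma pol_i (c : ℝ) (h0 : 13/20 ≤ c) (h1 : c ≤ 1) :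
    0 ≤ ((999/500)*(499/500)*(c^2+c^3-5577/8000)+(c*(2*c+3*c^2)-999/500*(c^2+c^3-5577/8000)))*(2+6*c)-(499/500)^2*(2*c+3*c^2)^2 := by
  have ha : 0 ≤ c - 13/20 := by linarith
  have hb : 0 ≤ 1 - c := by linarith
  have e : ((999/500)*(499/500)*(c^2+c^3-5577/8000)+(c*(2*c+3*c^2)-999/500*(c^2+c^3-5577/8000)))*(2+6*c)-(499/500)^2*(2*c+3*c^2)^2 - 0 = 131225924271/600250000 * (c - 13/20) ^ 0 * (1 - c) ^ 4 + 385316075391/300125000 * (c - 13/20) ^ 1 * (1 - c) ^ 3 + 847002601791/300125000 * (c - 13/20) ^ 2 * (1 - c) ^ 2 + 825759759477/300125000 * (c - 13/20) ^ 3 * (1 - c) ^ 1 + 7529124846/7503125 * (c - 13/20) ^ 4 * (1 - c) ^ 0 := by ring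
  have : 0 ≤ ((999/500)*(499/500)*(c^2+c^3-5577/8000)+(c*(2*c+3*c^2)-999/500*(c^2+c^3-5577/8000)))*(2+6*c)-(499/500)^2*(2*c+3*c^2)^2 - 0 := by rw [e]; positivity
  linarith

lemma pol_ii (c : ℝ) (h0 : 13/20 ≤ c) (h1 : c ≤ 1) :
    1/10 ≤ ((999/500)^3*(499/500)*(c^2+c^3-5577/8000)^3+2*(999/500)*(499/500)*(c^2+c^3-5577/8000)*((1-c^2)*(2*c+3*c^2)^2)+((1-c^2)*(2*c+3*c^2)^2)*((1-c^2)*(2+6*c)-(c*(2*c+3*c^2)-999/500*(c^2+c^3-5577/8000))))-(c*(2*c+3*c^2)-999/500*(c^2+c^3-5577/8000))*((999/500)^2*(c^2+c^3-5577/8000)^2+((1-c^2)*(2*c+3*c^2)^2)) := by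
  rcases le_total c (17/20) with h | h
  · have ha : 0 ≤ c - 13/20 := by linarith
    have hb : 0 ≤ 17/20 - c := by linarith
    have e : ((999/500)^3*(499/500)*(c^2+c^3-5577/8000)^3+2*(999/500)*(499/500)*(c^2+c^3-5577/8000)*((1-c^2)*(2*c+3*c^2)^2)+((1-c^2)*(2*c+3*c^2)^2)*((1-c^2)*(2+6*c)-(c*(2*c+3*c^2)-999/500*(c^2+c^3-5577/8000))))-(c*(2*c+3*c^2)-999/500*(c^2+c^3-5577/8000))*((999/500)^2*(c^2+c^3-5577/8000)^2+((1-c^2)*(2*c+3*c^2)^2)) - 1/10 = 21066293461/65536 * (c - 13/20) ^ 0 * (17/20 - c) ^ 9 + 68187538271322773/8192000000 * (c - 13/20) ^ 1 * (17/20 - c) ^ 8 + 213762907395592107/4096000000 * (c - 13/20) ^ 2 * (17/20 - c) ^ 7 + 40243046291221114162183/256000000000000 * (c - 13/20) ^ 3 * (17/20 - c) ^ 6 + 6988507780171550800573/25600000000000 * (c - 13/20) ^ 4 * (17/20 - c) ^ 5 + 74694115315067449975273/256000000000000 * (c - 13/20) ^ 5 * (17/20 - c) ^ 4 + 1240725521231618332873/6400000000000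 * (c - 13/20) ^ 6 * (17/20 - c) ^ 3 + 19794564131292729666321/256000000000000 * (c - 13/20) ^ 7 * (17/20 - c) ^ 2 + 429677586177484061017/25600000000000 * (c - 13/20) ^ 8 * (17/20 - c) ^ 1 + 390770391878545028389/256000000000000 * (c - 13/20) ^ 9 * (17/20 - c) ^ 0 := by ring
    have : 0 ≤ ((999/500)^3*(499/500)*(c^2+c^3-5577/8000)^3+2*(999/500)*(499/500)*(c^2+c^3-5577/8000)*((1-c^2)*(2*c+3*c^2)^2)+((1-c^2)*(2*c+3*c^2)^2)*((1-c^2)*(2+6*c)-(c*(2*c+3*c^2)-999/500*(c^2+c^3-5577/8000))))-(c*(2*c+3*c^2)-999/500*(c^2+c^3-5577/8000))*((999/500)^2*(c^2+c^3-5577/8000)^2+((1-c^2)*(2*c+3*c^2)^2)) - 1/10 := by rw [e]; positivity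
    linarith
  · have ha : 0 ≤ c - 17/20 := by linarith
    have hb : 0 ≤ 1 - c := by linarith
    have e : ((999/500)^3*(499/500)*(c^2+c^3-5577/8000)^3+2*(999/500)*(499/500)*(c^2+c^3-5577/8000)*((1-c^2)*(2*c+3*c^2)^2)+((1-c^2)*(2*c+3*c^2)^2)*((1-c^2)*(2+6*c)-(c*(2*c+3*c^2)-999/500*(c^2+c^3-5577/8000))))-(c*(2*c+3*c^2)-999/500*(c^2+c^3-5577/8000))*((999/500)^2*(c^2+c^3-5577/8000)^2+((1-c^2)*(2*c+3*c^2)^2)) - 1/10 = 390770391878545028389/19221679687500 * (c - 17/20) ^ 0 * (1 - c) ^ 9 + 3909402367674604985999/25628906250000 * (c - 17/20) ^ 1 * (1 - c) ^ 8 + 1941489382362863660887/4100625000000 * (c - 17/20) ^ 2 * (1 - c) ^ 7 + 106974033634371265536541/136687500000000 * (c - 17/20) ^ 3 * (1 - c) ^ 6 + 309096952657626937220929/410062500000000 * (c - 17/20) ^ 4 * (1 - c) ^ 5 + 50216529025584922669949/102515625000000 * (c - 17/20) ^ 5 * (1 - c) ^ 4 + 138586077476749204892153/410062500000000 * (c -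 17/20) ^ 6 * (1 - c) ^ 3 + 28387491807983409796121/102515625000000 * (c - 17/20) ^ 7 * (1 - c) ^ 2 + 61187993765271915492901/410062500000000 * (c - 17/20) ^ 8 * (1 - c) ^ 1 + 40403374462941917688967/1230187500000000 * (c - 17/20) ^ 9 * (1 - c) ^ 0 := by ring
    have : 0 ≤ ((999/500)^3*(499/500)*(c^2+c^3-5577/8000)^3+2*(999/500)*(499/500)*(c^2+c^3-5577/8000)*((1-c^2)*(2*c+3*c^2)^2)+((1-c^2)*(2*c+3*c^2)^2)*((1-c^2)*(2+6*c)-(c*(2*c+3*c^2)-999/500*(c^2+c^3-5577/8000))))-(c*(2*c+3*c^2)-999/500*(c^2+c^3-5577/8000))*((999/500)^2*(c^2+c^3-5577/8000)^2+((1-c^2)*(2*c+3*c^2)^2)) - 1/10 := by rw [e]; positivity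
    linarith

lemma pol_iii (c : ℝ) (h0 : 13/20 ≤ c) (h1 : c ≤ 1) :
    0 ≤ 1/2*((999/500)^2*(c^2+c^3-5577/8000)^2+((1-c^2)*(2*c+3*c^2)^2))-(c*(2*c+3*c^2)-999/500*(c^2+c^3-5577/8000))*(c^2+c^3-5577/8000) := by
  have ha : 0 ≤ c - 13/20 := by linarith
  have hb : 0 ≤ 1 - c := by linarith
  have e : 1/2*((999/500)^2*(c^2+c^3-5577/8000)^2+((1-c^2)*(2*c+3*c^2)^2))-(c*(2*c+3*c^2)-999/500*(c^2+c^3-5577/8000))*(c^2+c^3-5577/8000) - 0 = 34806057/33614 * (c - 13/20) ^ 0 * (1 - c) ^ 6 + 104989183/16807 * (c - 13/20) ^ 1 * (1 - c) ^ 5 + 129977875574103/8403500000 * (c - 13/20) ^ 2 * (1 - c) ^ 4 + 1688897208087/85750000 * (c - 13/20) ^ 3 * (1 - c) ^ 3 + 21840849923293/1680700000 * (c - 13/20) ^ 4 * (1 - c) ^ 2 + 15559867090541/4201750000 * (c - 13/20) ^ 5 * (1 - c) ^ 1 + 1213149978847/8403500000 * (c - 13/20) ^ 6 * (1 - c) ^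 0 := by ring
  have : 0 ≤ 1/2*((999/500)^2*(c^2+c^3-5577/8000)^2+((1-c^2)*(2*c+3*c^2)^2))-(c*(2*c+3*c^2)-999/500*(c^2+c^3-5577/8000))*(c^2+c^3-5577/8000) - 0 := by rw [e]; positivity
  linarith

lemma pol_N (c : ℝ) (h0 : 13/20 ≤ c) (h1 : c ≤ 1) :
    3 ≤ ((999/500)^2*(c^2+c^3-5577/8000)^2+((1-c^2)*(2*c+3*c^2)^2)) := by
  have ha : 0 ≤ c - 13/20 := by linarith
  have hb : 0 ≤ 1 - c := by linarith
  have e : ((999/500)^2*(c^2+c^3-5577/8000)^2+((1-c^2)*(2*c+3*c^2)^2)) - 3 = 51642399/117649 * (c - 13/20) ^ 0 * (1 - c) ^ 6 + 509809240/117649 * (c - 13/20) ^ 1 * (1 - c) ^ 5 + 461903409239721/29412250000 * (c - 13/20) ^ 2 * (1 - c) ^ 4 + 410622671464841/14706125000 * (c - 13/20) ^ 3 * (1 - c) ^ 3 + 152916908514051/5882450000 * (c - 13/20) ^ 4 * (1 - c) ^ 2 + 175634977420787/14706125000 * (c - 13/20) ^ 5 * (1 - c) ^ 1 + 60421759780929/29412250000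 * (c - 13/20) ^ 6 * (1 - c) ^ 0 := by ring
  have : 0 ≤ ((999/500)^2*(c^2+c^3-5577/8000)^2+((1-c^2)*(2*c+3*c^2)^2)) - 3 := by rw [e]; positivity
  linarith

lemma pol_a (c : ℝ) (h0 : 13/20 ≤ c) (h1 : c ≤ 1) :
    1 ≤ (999/500)*(499/500)*(c^2+c^3-5577/8000)+(c*(2*c+3*c^2)-999/500*(c^2+c^3-5577/8000)) := by
  have ha : 0 ≤ c - 13/20 := by linarith
  have hb : 0 ≤ 1 - c := by linarith
  have e : (999/500)*(499/500)*(c^2+c^3-5577/8000)+(c*(2*c+3*c^2)-999/500*(c^2+c^3-5577/8000)) - 1 = 5351/343 * (c - 13/20) ^ 0 * (1 - c) ^ 3 + 8487818189/85750000 * (c - 13/20) ^ 1 * (1 - c) ^ 2 + 14882748269/85750000 * (c - 13/20) ^ 2 * (1 - c) ^ 1 + 7989587423/85750000 * (c - 13/20) ^ 3 * (1 - c) ^ 0 := by ring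
  have : 0 ≤ (999/500)*(499/500)*(c^2+c^3-5577/8000)+(c*(2*c+3*c^2)-999/500*(c^2+c^3-5577/8000)) - 1 := by rw [e]; positivity
  linarith

end CU

namespace CU
open Set MeasureTheory Filter Topology
open scoped ContDiff

lemma scalar_ineq (c P P1 P2 γ N H X Z y η C C12 : ℝ) (h0 : 13/20 ≤ c) (h1 : c ≤ 1)
    (hP : P = c^2+c^3-5577/8000) (hP1 : P1 = 2*c+3*c^2) (hP2 : P2 = 2+6*c)
    (hγ : γ = c*P1-999/500*P) (hN : N = (999/500)^2*P^2+(1-c^2)*P1^2)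
    (hH : H = (999/500)^3*(499/500)*P^3+2*(999/500)*(499/500)*P*((1-c^2)*P1^2)
      + (1-c^2)*P1^2*((1-c^2)*P2-γ))
    (hX : 0 < X) (hZ : 4 * X ≤ Z) (hy0 : 0 ≤ y) (hy : y ≤ η * X) (hη : η ≤ 1/1000)
    (hηC : η * C ≤ 1/10) (hC : |C12| ≤ C) :
    1/2 * (X^2*N - X*(999/500)*P/2 + 1/16) + 1/2 * y ≤
    4*X^3*(H-γ*N) + 4*X*Z*(N-γ*P) + X^2*(-2*(499/500)*N-3*N+2*(999/500)*γ*P)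
      + Z*P*(3-999/500) + X*(P*((999/500)*(499/500)/4+(999/500)/2)+γ/4) + 1/16
      - y*(2*γ*X+1)^2 - y^2*X*C12 := by
  have a2 := pol_ii c h0 h1
  have a3 := pol_iii c h0 h1
  have a4 := pol_N c h0 h1
  rw [← hP, ← hP1, ← hP2, ← hγ, ← hN] at a2
  rw [← hP, ← hP1, ← hγ, ← hN] at a3
  rw [← hP, ← hP1, ← hN] at a4
  rw [← hH] at a2
  have hP0 : 0 ≤ P := by rw [hP]; nlinarith [mul_nonneg (sub_nonneg.2 h0) (sub_nonneg.2 h0), mul_nonneg (sub_nonneg.2 h0) (by linarith : (0:ℝ) ≤ c), pow_nonneg (sub_nonneg.2 h0) 3]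
  have hP3 : P ≤ 2 := by rw [hP]; nlinarith [mul_nonneg (sub_nonneg.2 h1) (by linarith : (0:ℝ) ≤ c), mul_nonneg (mul_nonneg (sub_nonneg.2 h1) (by linarith : (0:ℝ) ≤ c)) (by linarith : (0:ℝ) ≤ c)]
  have hP10 : 0 ≤ P1 := by rw [hP1]; nlinarith
  have hP15 : P1 ≤ 5 := by rw [hP1]; nlinarith
  have hγe : γ = 1/500*c^2+501/500*c^3+999/500*(5577/8000) := by rw [hγ, hP1, hP]; ring
  have hc3 : 0 ≤ c^3 := by positivity
  have hc3' : c^3 ≤ 1 := pow_le_one₀ (by linarith) h1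
  have hc2' : c^2 ≤ 1 := pow_le_one₀ (by linarith) h1
  have hγ0 : 0 ≤ γ := by rw [hγe]; positivity
  have hγ5 : γ ≤ 5 := by rw [hγe]; linarith
  have hγP : 0 ≤ γ * P := mul_nonneg hγ0 hP0
  have hη0 : 0 ≤ η := by
    by_contra h; push Not at h
    have := mul_neg_of_neg_of_pos h hX; linarith
  have t1 : 4*X^3*(1/10) ≤ 4*X^3*(H-γ*N) := by gcongr
  have t2 : 4*X*(4*X)*(1/2*N) ≤ 4*X*Z*(N-γ*P) := by
    have : 1/2*N ≤ N-γ*P := by linarith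
    have hZ0 : 0 ≤ Z := by linarith
    gcongr
  have t3 : 0 ≤ Z*P*(3-999/500) := by have : 0 ≤ Z := by linarith
                                      have := mul_nonneg this hP0; linarith
  have t4 : 0 ≤ X*(P*((999/500)*(499/500)/4+(999/500)/2)+γ/4) := by positivity
  have t5 : y*(2*γ*X+1)^2 ≤ (η*X)*(200*X^2+2) := by
    have : (2*γ*X+1)^2 ≤ 200*X^2+2 := by
      have h1 : 2*γ*X+1 ≤ 10*X+1 := by
        have := mul_le_mul_of_nonneg_right hγ5 hX.le
        linarith
      have h2 : 0 ≤ 2*γ*X+1 := by positivity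
      have h3 := pow_le_pow_left₀ h2 h1 2
      have h4 := sq_nonneg (10*X-1)
      linarith
    exact mul_le_mul hy this (sq_nonneg _) (by positivity)
  have t6 : y^2*X*C12 ≤ η * X^3 * (1/10) := by
    have hC0 : 0 ≤ C := (abs_nonneg _).trans hC
    calc y^2*X*C12 ≤ y^2*X*C := by gcongr; exact (le_abs_self _).trans hC
      _ ≤ (η*X)^2*X*C := by gcongr
      _ = η * X^3 * (η*C) := by ring
      _ ≤ _ := by gcongr
  have t7 : 0 ≤ X^2*(2*(999/500)*γ*P) := by positivity
  have hX3 : 0 < X^3 := by positivity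
  have t8 : X^3*η ≤ X^3*(1/1000) := by gcongr
  have t9 : η*X ≤ 1/1000*X := by gcongr
  have t10 : 0 ≤ X*P := by positivity
  have t11 : X^2*3 ≤ X^2*N := by gcongr
  have t12 := sq_nonneg (X-1/100)
  clear hP hP1 hP2 hγ hN hH hγe a2 a3
  linarith
end CU

namespace CU
open Set MeasureTheory Filter Topology
open scoped ContDiff

section weight
variable {n : ℕ}

abbrev YY (n : ℕ) := EuclideanSpace ℝ (Fin n) × ℝ

noncomputable def ev (i : Fin n) : YY n := (EuclideanSpace.single i 1, 0)
noncomputable def et : YY n := (0, 1)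

noncomputable def dl (i0 i : Fin n) : ℝ := if i = i0 then 1 else 0

lemma d_fst_coord (i j : Fin n) (y : YY n) :
    d (ev i) (fun y : YY n => y.1 j) y = dl i j := by
  have h : HasFDerivAt (fun y : YY n => y.1 j)
    ((EuclideanSpace.proj j : EuclideanSpace ℝ (Fin n) →L[ℝ] ℝ).comp
      (ContinuousLinearMap.fst ℝ _ ℝ)) y :=
    ((EuclideanSpace.proj j : EuclideanSpace ℝ (Fin n) →L[ℝ] ℝ).comp
      (ContinuousLinearMap.fst ℝ _ ℝ)).hasFDerivAt
  simp [d, h.fderiv, ev, dl]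

lemma dt_fst (g : EuclideanSpace ℝ (Fin n) → ℝ) (y : YY n) (hg : DifferentiableAt ℝ g y.1) :
    d et (fun y : YY n => g y.1) y = 0 := by
  have h := hg.hasFDerivAt.comp y (hasFDerivAt_fst (𝕜 := ℝ) (p := y))
  have : fderiv ℝ (fun y : YY n => g y.1) y = _ := h.fderiv
  simp [d, this, et]

lemma dx_snd (i : Fin n) (g : ℝ → ℝ) (y : YY n) (hg : DifferentiableAt ℝ g y.2) :
    d (ev i) (fun y : YY n => g y.2) y = 0 := by
  have h := hg.hasFDerivAt.comp y (hasFDerivAt_snd (𝕜 := ℝ) (p := y))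
  have : fderiv ℝ (fun y : YY n => g y.2) y = _ := h.fderiv
  simp [d, this, ev]

lemma dt_snd {g : ℝ → ℝ} {g' : ℝ} {y : YY n} (hg : HasDerivAt g g' y.2) :
    d et (fun y : YY n => g y.2) y = g' := by
  have h := hg.hasFDerivAt.comp y (hasFDerivAt_snd (𝕜 := ℝ) (p := y))
  have : fderiv ℝ (fun y : YY n => g y.2) y = _ := h.fderiv
  simp [d, this, et]

lemma norm_smooth {y : YY n} (hy : y.1 ≠ 0) : ContDiffAt ℝ ∞ (fun y : YY n => ‖y.1‖) y :=
  (contDiffAt_fst).norm ℝ hy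

lemma sum_sq (x : EuclideanSpace ℝ (Fin n)) : ∑ i, x i * x i = ‖x‖ ^ 2 := by
  rw [EuclideanSpace.norm_sq_eq]
  exact Finset.sum_congr rfl fun i _ => by simp [sq]

lemma d_normsq (i : Fin n) (y : YY n) : d (ev i) (fun y : YY n => ‖y.1‖ ^ 2) y = 2 * y.1 i := by
  have : (fun y : YY n => ‖y.1‖ ^ 2) = fun y : YY n => ∑ j, y.1 j * y.1 j := by
    ext y; rw [sum_sq]
  rw [this]
  have hd : ∀ j : Fin n, DifferentiableAt ℝ (fun y : YY n => y.1 j) y := fun j =>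
    ((EuclideanSpace.proj j : EuclideanSpace ℝ (Fin n) →L[ℝ] ℝ).comp
      (ContinuousLinearMap.fst ℝ _ ℝ)).differentiableAt
  rw [d_sum fun j _ => (hd j).fun_mul (hd j)]
  simp only [fun j => d_mul (a := ev i) (hd j) (hd j), d_fst_coord, dl]
  rw [Finset.sum_eq_single i]
  · simp; ring
  · intro b _ hb; simp [hb]
  · simp

lemma d_norm (i : Fin n) {y : YY n} (hy : y.1 ≠ 0) :
    d (ev i) (fun y : YY n => ‖y.1‖) y = y.1 i / ‖y.1‖ := by
  have h1 := (norm_smooth hy).differentiableAt (by simp)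
  have h2 := d_mul (a := ev i) h1 h1
  have h3 := d_normsq i y
  have h4 : (fun y : YY n => ‖y.1‖ ^ 2) = fun y : YY n => ‖y.1‖ * ‖y.1‖ := by ext; ring
  rw [h4, h2] at h3
  have : ‖y.1‖ ≠ 0 := norm_ne_zero_iff.2 hy
  field_simp
  linarith

lemma d_comp1 {a : YY n} {g : ℝ → ℝ} {g' : ℝ} {f : YY n → ℝ} {y : YY n} (hg : HasDerivAt g g' (f y))
    (hf : DifferentiableAt ℝ f y) : d a (fun y => g (f y)) y = g' * d a f y := by
  have h := hg.comp_hasFDerivAt y hf.hasFDerivAt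
  have : fderiv ℝ (fun y => g (f y)) y = _ := h.fderiv
  simp [d, this]

noncomputable def FF (i0 : Fin n) (β : ℝ) (p : Polynomial ℝ) (y : YY n) : ℝ :=
  ‖y.1‖ ^ β * p.eval (y.1 i0 / ‖y.1‖)

lemma coord_smooth (j : Fin n) (y : YY n) : ContDiffAt ℝ ∞ (fun y : YY n => y.1 j) y :=
    ((EuclideanSpace.proj j : EuclideanSpace ℝ (Fin n) →L[ℝ] ℝ).comp
      (ContinuousLinearMap.fst ℝ _ ℝ)).contDiff.contDiffAt

lemma cc_smooth (i0 : Fin n) {y : YY n} (hy : y.1 ≠ 0) :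
    ContDiffAt ℝ ∞ (fun y : YY n => y.1 i0 / ‖y.1‖) y :=
  (coord_smooth i0 y).div (norm_smooth hy) (norm_ne_zero_iff.2 hy)

lemma pw_smooth (β : ℝ) {y : YY n} (hy : y.1 ≠ 0) :
    ContDiffAt ℝ ∞ (fun y : YY n => ‖y.1‖ ^ β) y :=
  (norm_smooth hy).rpow_const_of_ne (norm_ne_zero_iff.2 hy)

lemma pol_smooth (i0 : Fin n) (p : Polynomial ℝ) {y : YY n} (hy : y.1 ≠ 0) :
    ContDiffAt ℝ ∞ (fun y : YY n => p.eval (y.1 i0 / ‖y.1‖)) y := by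
  have h := (Polynomial.contDiff_aeval (𝕜 := ℝ) p ∞).contDiffAt.comp y (cc_smooth i0 hy)
  simpa [Function.comp_def, Polynomial.aeval_def, Polynomial.eval₂_eq_eval_map] using h

lemma FF_smooth (i0 : Fin n) (β : ℝ) (p : Polynomial ℝ) {y : YY n} (hy : y.1 ≠ 0) :
    ContDiffAt ℝ ∞ (FF i0 β p) y := (pw_smooth β hy).mul (pol_smooth i0 p hy)

lemma d_FF (i0 i : Fin n) (β : ℝ) (p : Polynomial ℝ) {y : YY n} (hy : y.1 ≠ 0) :
    d (ev i) (FF i0 β p) y = ‖y.1‖ ^ β *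
      ((β * p.eval (y.1 i0 / ‖y.1‖) - y.1 i0 / ‖y.1‖ * p.derivative.eval (y.1 i0 / ‖y.1‖))
        / ‖y.1‖ ^ 2 * y.1 i + p.derivative.eval (y.1 i0 / ‖y.1‖) / ‖y.1‖ * dl i0 i) := by
  have hr : ‖y.1‖ ≠ 0 := norm_ne_zero_iff.2 hy
  have hr0 : 0 < ‖y.1‖ := norm_pos_iff.2 hy
  have h1 := (pw_smooth β hy).differentiableAt (by simp)
  have h2 := (pol_smooth i0 p hy).differentiableAt (by simp)
  have h3 := (norm_smooth hy).differentiableAt (by simp)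
  have h4 := (cc_smooth i0 hy).differentiableAt (by simp)
  have h5 := (coord_smooth i0 y).differentiableAt (by simp)
  have e1 : d (ev i) (fun y : YY n => ‖y.1‖ ^ β) y = ‖y.1‖ ^ β * β / ‖y.1‖ ^ 2 * y.1 i := by
    have := d_comp1 (a := ev i) (Real.hasDerivAt_rpow_const (x := ‖y.1‖) (p := β) (Or.inl hr)) h3
    rw [this, d_norm i hy, Real.rpow_sub_one hr]
    field_simp
  have e2 : d (ev i) (fun y : YY n => y.1 i0 / ‖y.1‖) y =
      dl i0 i / ‖y.1‖ - y.1 i0 / ‖y.1‖ * y.1 i / ‖y.1‖ ^ 2 := by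
    have h6 := d_mul (a := ev i) h4 h3
    have h7 : (fun y : YY n => y.1 i0 / ‖y.1‖ * ‖y.1‖) =ᶠ[𝓝 y] fun y : YY n => y.1 i0 := by
      have : ∀ᶠ z in 𝓝 y, z.1 ≠ 0 := by
        have : ContinuousAt (fun z : YY n => z.1) y := continuousAt_fst
        exact this.eventually_ne hy
      filter_upwards [this] with z hz
      field_simp [norm_ne_zero_iff.2 hz]
    rw [(d_congr (a := ev i) h7).self_of_nhds, d_fst_coord, d_norm i hy] at h6
    have : dl i i0 = dl i0 i := by simp [dl, eq_comm]
    rw [this] at h6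
    field_simp at h6 ⊢
    linarith
  have e3 : d (ev i) (fun y : YY n => p.eval (y.1 i0 / ‖y.1‖)) y =
     p.derivative.eval (y.1 i0 / ‖y.1‖) * (dl i0 i / ‖y.1‖ - y.1 i0 / ‖y.1‖ * y.1 i / ‖y.1‖ ^ 2) := by
    rw [← e2]
    exact d_comp1 (p.hasDerivAt _) h4
  show d (ev i) (fun y => ‖y.1‖ ^ β * p.eval (y.1 i0 / ‖y.1‖)) y = _
  rw [d_mul h1 h2, e1, e3]
  ring

noncomputable def p1 (β : ℝ) (p : Polynomial ℝ) : Polynomial ℝ :=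
  Polynomial.C β * p - Polynomial.X * p.derivative

noncomputable def gF (i0 : Fin n) (β : ℝ) (p : Polynomial ℝ) (i : Fin n) (y : YY n) : ℝ :=
  FF i0 (β - 2) (p1 β p) y * y.1 i + dl i0 i * FF i0 (β - 1) p.derivative y

lemma d_FF' (i0 i : Fin n) (β : ℝ) (p : Polynomial ℝ) {y : YY n} (hy : y.1 ≠ 0) :
    d (ev i) (FF i0 β p) y = gF i0 β p i y := by
  have hr : ‖y.1‖ ≠ 0 := norm_ne_zero_iff.2 hy
  have hr0 : 0 < ‖y.1‖ := norm_pos_iff.2 hy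
  rw [d_FF i0 i β p hy]
  simp only [gF, FF, p1]
  rw [Real.rpow_sub_one hr, show β - 2 = β - (2 : ℕ) by norm_num, Real.rpow_sub_natCast hr]
  simp
  field_simp

lemma dt_FF (i0 : Fin n) (β : ℝ) (p : Polynomial ℝ) {y : YY n} (hy : y.1 ≠ 0) :
    d et (FF i0 β p) y = 0 := by
  have h : DifferentiableAt ℝ (fun x => FF i0 β p (x, y.2)) y.1 := by
    have := ((FF_smooth i0 β p hy).differentiableAt (by simp))
    exact DifferentiableAt.comp (f := fun x : EuclideanSpace ℝ (Fin n) => (x, y.2)) y.1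
      (by simpa using this) (by fun_prop)
  exact dt_fst (fun x => FF i0 β p (x, y.2)) y h

lemma gF_smooth (i0 i : Fin n) (β : ℝ) (p : Polynomial ℝ) {y : YY n} (hy : y.1 ≠ 0) :
    ContDiffAt ℝ ∞ (gF i0 β p i) y :=
  ((FF_smooth i0 _ _ hy).mul (coord_smooth i y)).add (contDiffAt_const.mul (FF_smooth i0 _ _ hy))

lemma d_gF (i0 i j : Fin n) (β : ℝ) (p : Polynomial ℝ) {y : YY n} (hy : y.1 ≠ 0) :
    d (ev i) (gF i0 β p j) y = gF i0 (β - 2) (p1 β p) i y * y.1 j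
      + FF i0 (β - 2) (p1 β p) y * dl i j + dl i0 j * gF i0 (β - 1) p.derivative i y := by
  have h1 := (FF_smooth i0 (β - 2) (p1 β p) hy).differentiableAt (by simp)
  have h2 := (FF_smooth i0 (β - 1) p.derivative hy).differentiableAt (by simp)
  have h3 := (coord_smooth j y).differentiableAt (by simp)
  have : gF i0 β p j = fun y => FF i0 (β - 2) (p1 β p) y * y.1 j +
    dl i0 j * FF i0 (β - 1) p.derivative y := rfl
  rw [this, d_add (h1.fun_mul h3) (h2.const_mul _), d_mul h1 h3, d_cmul h2, d_fst_coord,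
    d_FF' _ _ _ _ hy, d_FF' _ _ _ _ hy]

lemma ne_ev {y : YY n} (hy : y.1 ≠ 0) : ∀ᶠ z in 𝓝 y, z.1 ≠ 0 := by
  have : ContinuousAt (fun z : YY n => z.1) y := continuousAt_fst
  exact this.eventually_ne hy

lemma gF_dot (i0 : Fin n) (β : ℝ) (p : Polynomial ℝ) {y : YY n} (hy : y.1 ≠ 0) (w : Fin n → ℝ) :
    ∑ i, gF i0 β p i y * w i = ‖y.1‖ ^ β *
      ((β * p.eval (y.1 i0 / ‖y.1‖) - y.1 i0 / ‖y.1‖ * p.derivative.eval (y.1 i0 / ‖y.1‖))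
        / ‖y.1‖ ^ 2 * (∑ i, y.1 i * w i) + p.derivative.eval (y.1 i0 / ‖y.1‖) / ‖y.1‖ * w i0) := by
  have h0 : ∑ i, dl i0 i * w i = w i0 := by simp [dl]
  rw [← h0, Finset.mul_sum, Finset.mul_sum, ← Finset.sum_add_distrib, Finset.mul_sum]
  refine Finset.sum_congr rfl fun i _ => ?_
  rw [← d_FF' _ _ _ _ hy, d_FF _ _ _ _ hy]
  ring

noncomputable def LL (n : ℕ) (β : ℝ) (p : Polynomial ℝ) : Polynomial ℝ :=
  (1 - Polynomial.X ^ 2) * p.derivative.derivative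
    - Polynomial.C ((n : ℝ) - 1) * Polynomial.X * p.derivative
    + Polynomial.C (β * (β + n - 2)) * p

lemma lap_gF (i0 : Fin n) (β : ℝ) (p : Polynomial ℝ) {y : YY n} (hy : y.1 ≠ 0) :
    ∑ i, d (ev i) (gF i0 β p i) y = FF i0 (β - 2) (LL n β p) y := by
  have hr : ‖y.1‖ ≠ 0 := norm_ne_zero_iff.2 hy
  have hr0 : 0 < ‖y.1‖ := norm_pos_iff.2 hy
  simp only [d_gF _ _ _ _ _ hy, Finset.sum_add_distrib]
  have e1 := gF_dot i0 (β - 2) (p1 β p) hy (fun i => y.1 i)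
  have e2 := gF_dot i0 (β - 1) p.derivative hy (fun i => dl i0 i)
  have e3 : ∑ i : Fin n, dl i0 i * gF i0 (β - 1) p.derivative i y
      = ∑ i : Fin n, gF i0 (β - 1) p.derivative i y * dl i0 i :=
    Finset.sum_congr rfl fun i _ => mul_comm _ _
  have e4 : ∑ i : Fin n, y.1 i * dl i0 i = y.1 i0 := by simp [dl]
  have e5 : ∑ i : Fin n, FF i0 (β - 2) (p1 β p) y * dl i i = n * FF i0 (β - 2) (p1 β p) y := by
    simp [dl]
  rw [e3, e1, e2, e4, e5, sum_sq]
  simp only [FF, p1, LL]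
  rw [Real.rpow_sub_one hr, show β - 2 = β - (2 : ℕ) by norm_num, Real.rpow_sub_natCast hr]
  simp [dl]
  have : y.1 i0 = (y.1 i0 / ‖y.1‖) * ‖y.1‖ := by field_simp
  generalize y.1 i0 / ‖y.1‖ = c at *
  rw [this]
  field_simp
  ring

end weight
end CU

namespace CU
open Set MeasureTheory Filter Topology
open scoped ContDiff

lemma Q_alg (n a h t ρ r c P P1 P2 γ N H C1 C2 N1 Vt VP V G Δ : ℝ) (ht : 0 < t) (hr : 0 < r)
    (h0 : 13/20 ≤ c) (h1 : c ≤ 1) (ha : 0 < a) (hh : 0 < h) (hρ : 0 < ρ)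
    (hP : P = c^2+c^3-5577/8000) (hP1 : P1 = 2*c+3*c^2) (hP2 : P2 = 2+6*c)
    (hγ : γ = c*P1-999/500*P) (hN : N = (999/500)^2*P^2+(1-c^2)*P1^2)
    (hN1 : N1 = 2*(999/500)^2*P*P1-2*c*P1^2+2*(1-c^2)*P1*P2)
    (hH : H = (999/500)^3*(499/500)*P^3+2*(999/500)*(499/500)*P*((1-c^2)*P1^2)
      + (1-c^2)*P1^2*((1-c^2)*P2-γ))
    (hht : h ≤ (t^4)⁻¹)
    (C η : ℝ) (hη : η ≤ 1/1000) (hηC : η * C ≤ 1/10) (hC : |C1 + 2 * C2| ≤ C)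
    (hy : 1 ≤ η * (a * h * ρ))
    (hVt : Vt = (2*a^2*h*(-4/t^5))*(ρ^2/r^2*N) + (-a*(999/500)/2*((-4/t^5)/t-h/t^2)-20*a/t^6)*(ρ*P)
      + (1/(8*t^3))*r^2)
    (hVP : VP = (a^2*h^2)*(a*h*(ρ*ρ^2/r^4*((2*(999/500)-2)*(999/500)*N*P+(1-c^2)*N1*P1))
        - (2*(999/500)-2)*(ρ^2/r^2*N)/(4*t))
      + (-a*(999/500)/2*(h/t)+4*a/t^5)*(a*h*(ρ*ρ/r^2*N)-(999/500)*ρ*P/(4*t))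
      + 2*(-1/(16*t^2))*(a*h*((999/500)*ρ*P)-r^2/(4*t)))
    (hV : V = (a^2*h^2)*(ρ^2/r^2*N)+(-a*(999/500)/2*(h/t)+4*a/t^5)*(ρ*P)+(-1/(16*t^2))*r^2)
    (hG : G = 2*a*h*(ρ/r^2*γ)+1/t)
    (hΔ : Δ = a*h*(ρ/r^4*C1)+2*a*h*(ρ/r^4*C2)) :
    1/(2*t)*((a^2*h^2*(ρ^2/r^2*N)-a*h*(999/500)*ρ*P/(2*t)+r^2/(16*t^2)) + 1/t) ≤
      -Vt+2*VP-Δ-2*G*V-G^2 := by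
  have key := scalar_ineq c P P1 P2 γ N H (a*h*t*ρ/r^2) (4*a*ρ/(t^3*r^2)) (t/r^2) η C (C1+2*C2)
    h0 h1 hP hP1 hP2 hγ hN hH (by positivity) ?_ (by positivity) ?_ hη hηC hC
  · have e : -Vt+2*VP-Δ-2*G*V-G^2 = r^2/t^3*(4*(a*h*t*ρ/r^2)^3*(H-γ*N) + 4*(a*h*t*ρ/r^2)*(4*a*ρ/(t^3*r^2))*(N-γ*P) + (a*h*t*ρ/r^2)^2*(-2*(499/500)*N-3*N+2*(999/500)*γ*P)
      + (4*a*ρ/(t^3*r^2))*P*(3-999/500) + (a*h*t*ρ/r^2)*(P*((999/500)*(499/500)/4+(999/500)/2)+γ/4) + 1/16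
      - (t/r^2)*(2*γ*(a*h*t*ρ/r^2)+1)^2 - (t/r^2)^2*(a*h*t*ρ/r^2)*(C1+2*C2)) := by
      have hH' : H = (499/500)*(999/500)*P*N + 1/2*(1-c^2)*N1*P1 := by
        rw [hH, hN, hN1, hγ]; ring
      rw [hVt, hVP, hV, hG, hΔ, hH']
      clear hVt hVP hV hG hΔ hH' key hH hN hN1 hγ hP hP1 hP2 hy
      field_simp
      ring
    have e2 : 1/(2*t)*((a^2*h^2*(ρ^2/r^2*N)-a*h*(999/500)*ρ*P/(2*t)+r^2/(16*t^2)) + 1/t)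
      = r^2/t^3*(1/2 * ((a*h*t*ρ/r^2)^2*N - (a*h*t*ρ/r^2)*(999/500)*P/2 + 1/16) + 1/2 * (t/r^2)) := by
      clear e hVt hVP hV hG hΔ key hH hN hN1 hγ hP hP1 hP2 hy
      field_simp
    rw [e, e2]
    exact mul_le_mul_of_nonneg_left key (by positivity)
  · calc 4*(a*h*t*ρ/r^2) = (4*a*t*ρ/r^2)*h := by ring
      _ ≤ (4*a*t*ρ/r^2)*(t^4)⁻¹ := by gcongr
      _ = _ := by field_simp
  · calc t/r^2 = t/r^2*1 := by ring
      _ ≤ t/r^2*(η * (a * h * ρ)) := by gcongr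
      _ = _ := by field_simp
end CU

namespace CU
open Set MeasureTheory Filter Topology
open scoped ContDiff

section W
variable {n : ℕ} (i0 : Fin n)

lemma gF_x (β : ℝ) (p : Polynomial ℝ) {y : YY n} (hy : y.1 ≠ 0) :
    ∑ i, gF i0 β p i y * y.1 i = β * ‖y.1‖ ^ β * p.eval (y.1 i0 / ‖y.1‖) := by
  have hr : ‖y.1‖ ≠ 0 := norm_ne_zero_iff.2 hy
  rw [gF_dot _ _ _ hy (fun i => y.1 i), sum_sq]
  field_simp
  ring

lemma gF_at (i : Fin n) (β : ℝ) (p : Polynomial ℝ) {y : YY n} (hy : y.1 ≠ 0) :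
    gF i0 β p i y = ‖y.1‖ ^ β *
      ((β * p.eval (y.1 i0 / ‖y.1‖) - y.1 i0 / ‖y.1‖ * p.derivative.eval (y.1 i0 / ‖y.1‖))
        / ‖y.1‖ ^ 2 * y.1 i + p.derivative.eval (y.1 i0 / ‖y.1‖) / ‖y.1‖ * dl i0 i) := by
  rw [← d_FF' _ _ _ _ hy, d_FF _ _ _ _ hy]

lemma gF_gF (β β' : ℝ) (p q : Polynomial ℝ) {y : YY n} (hy : y.1 ≠ 0) :
    ∑ i, gF i0 β p i y * gF i0 β' q i y = ‖y.1‖ ^ β * ‖y.1‖ ^ β' / ‖y.1‖ ^ 2 *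
      (β * β' * p.eval (y.1 i0 / ‖y.1‖) * q.eval (y.1 i0 / ‖y.1‖)
        + (1 - (y.1 i0 / ‖y.1‖) ^ 2) * p.derivative.eval (y.1 i0 / ‖y.1‖) *
          q.derivative.eval (y.1 i0 / ‖y.1‖)) := by
  have hr : ‖y.1‖ ≠ 0 := norm_ne_zero_iff.2 hy
  rw [gF_dot _ _ _ hy (fun i => gF i0 β' q i y)]
  have : ∑ i, y.1 i * gF i0 β' q i y = ∑ i, gF i0 β' q i y * y.1 i :=
    Finset.sum_congr rfl fun i _ => mul_comm _ _
  rw [this, gF_x _ _ _ hy, gF_at _ _ _ _ hy]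
  simp only [dl, if_true]
  have : y.1 i0 = (y.1 i0 / ‖y.1‖) * ‖y.1‖ := by field_simp
  generalize y.1 i0 / ‖y.1‖ = c at *
  rw [this]
  field_simp
  ring

lemma dx_mul (i : Fin n) {A : ℝ → ℝ} {Fx : YY n → ℝ} {y : YY n} (hA : DifferentiableAt ℝ A y.2)
    (hF : DifferentiableAt ℝ Fx y) :
    d (ev i) (fun y => A y.2 * Fx y) y = A y.2 * d (ev i) Fx y := by
  have : DifferentiableAt ℝ (fun y : YY n => A y.2) y :=
    DifferentiableAt.comp (f := fun y : YY n => y.2) y hA differentiableAt_snd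
  rw [d_mul this hF, dx_snd _ _ _ hA]; ring

lemma dt_mul {A : ℝ → ℝ} {A' : ℝ} {Fx : YY n → ℝ} {y : YY n} (hA : HasDerivAt A A' y.2)
    (hF : DifferentiableAt ℝ Fx y) :
    d et (fun y => A y.2 * Fx y) y = A' * Fx y + A y.2 * d et Fx y := by
  have : DifferentiableAt ℝ (fun y : YY n => A y.2) y :=
    DifferentiableAt.comp (f := fun y : YY n => y.2) y hA.differentiableAt differentiableAt_snd
  rw [d_mul this hF, dt_snd hA]

noncomputable def hh (s t : ℝ) : ℝ := (t ^ 4)⁻¹ - (s ^ 4)⁻¹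

lemma hh_deriv (s : ℝ) {t : ℝ} (ht : 0 < t) : HasDerivAt (hh s) (-4 / t ^ 5) t := by
  have := ((hasDerivAt_pow 4 t).inv (by positivity)).sub_const ((s ^ 4)⁻¹)
  refine this.congr_deriv ?_
  field_simp
  ring

lemma hh_smooth (s : ℝ) {t : ℝ} (ht : 0 < t) : ContDiffAt ℝ ∞ (hh s) t := by
  unfold hh
  exact ((contDiffAt_id.pow 4).inv (by simp; positivity)).sub contDiffAt_const

lemma tm_smooth {A : ℝ → ℝ} {y : YY n} (hA : ContDiffAt ℝ ∞ A y.2) :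
    ContDiffAt ℝ ∞ (fun y : YY n => A y.2) y := hA.comp y contDiffAt_snd

open Polynomial in
noncomputable def PP : Polynomial ℝ := X ^ 2 + X ^ 3 - C (5577 / 8000)
open Polynomial in
noncomputable def NN : Polynomial ℝ := C ((999/500)^2) * PP ^ 2 + (1 - X ^ 2) * (derivative PP) ^ 2

lemma PP_ev (c : ℝ) : PP.eval c = c^2+c^3-5577/8000 := by simp [PP]
lemma PP1_ev (c : ℝ) : PP.derivative.eval c = 2*c+3*c^2 := by simp [PP]; ring
lemma PP2_ev (c : ℝ) : PP.derivative.derivative.eval c = 2+6*c := by simp [PP]; ring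
lemma NN_ev (c : ℝ) : NN.eval c = (999/500)^2*PP.eval c^2+(1-c^2)*PP.derivative.eval c^2 := by
  simp [NN]
lemma NN1_ev (c : ℝ) : NN.derivative.eval c = 2*(999/500)^2*PP.eval c*PP.derivative.eval c
    -2*c*PP.derivative.eval c^2+2*(1-c^2)*PP.derivative.eval c*PP.derivative.derivative.eval c := by
  simp [NN, Polynomial.derivative_mul, Polynomial.derivative_pow]; ring

noncomputable def ph (s a : ℝ) (y : YY n) : ℝ :=
  (fun t => a * hh s t) y.2 * FF i0 (999/500) PP y + (fun t : ℝ => -1/(8*t)) y.2 * ‖y.1‖ ^ 2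
noncomputable def pp (s a : ℝ) (i : Fin n) (y : YY n) : ℝ :=
  (fun t => a * hh s t) y.2 * gF i0 (999/500) PP i y + (fun t : ℝ => -1/(4*t)) y.2 * y.1 i
noncomputable def VV (s a : ℝ) (y : YY n) : ℝ :=
  (fun t => a^2 * hh s t^2) y.2 * FF i0 (2*(999/500)-2) NN y
   + (fun t => -a*(999/500)/2*(hh s t/t)+4*a/t^5) y.2 * FF i0 (999/500) PP y
   + (fun t : ℝ => -1/(16*t^2)) y.2 * ‖y.1‖ ^ 2
noncomputable def Lf (s a : ℝ) (y : YY n) : ℝ :=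
  (fun t => a * hh s t) y.2 * FF i0 (999/500-2) (LL n (999/500) PP) y + (fun t : ℝ => -n/(4*t)) y.2
noncomputable def GG (s a : ℝ) (y : YY n) : ℝ :=
  (fun t => 2 * a * hh s t) y.2 * FF i0 (999/500-2) (-p1 (999/500) PP) y + (fun t : ℝ => 1/t) y.2

variable {i0} {s a : ℝ} {y : YY n}

lemma nsq_smooth : ContDiffAt ℝ ∞ (fun y : YY n => ‖y.1‖ ^ 2) y :=
  (contDiff_fst.norm_sq ℝ).contDiffAt

lemma div_smooth (k : ℝ) (m : ℕ) (q : ℝ) (hq : q ≠ 0) {t : ℝ} (ht : 0 < t) :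
    ContDiffAt ℝ ∞ (fun t : ℝ => k / (q * t ^ m)) t :=
  contDiffAt_const.div (contDiffAt_const.mul (contDiffAt_id.pow m)) (mul_ne_zero hq (pow_ne_zero _ ht.ne'))

lemma div_smooth1 (k : ℝ) (q : ℝ) (hq : q ≠ 0) {t : ℝ} (ht : 0 < t) :
    ContDiffAt ℝ ∞ (fun t : ℝ => k / (q * t)) t := by
  simpa using div_smooth k 1 q hq ht

lemma ph_smooth (hy : y.1 ≠ 0) (ht : 0 < y.2) : ContDiffAt ℝ ∞ (ph i0 s a) y :=
  ((tm_smooth (contDiffAt_const.mul (hh_smooth s ht))).mul (FF_smooth _ _ _ hy)).add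
    ((tm_smooth (div_smooth1 _ _ (by norm_num) ht)).mul nsq_smooth)

lemma pp_smooth (i : Fin n) (hy : y.1 ≠ 0) (ht : 0 < y.2) : ContDiffAt ℝ ∞ (pp i0 s a i) y :=
  ((tm_smooth (contDiffAt_const.mul (hh_smooth s ht))).mul (gF_smooth _ _ _ _ hy)).add
    ((tm_smooth (div_smooth1 _ _ (by norm_num) ht)).mul (coord_smooth i y))

lemma VV_c2 {t : ℝ} (ht : 0 < t) : ContDiffAt ℝ ∞ (fun t => -a*(999/500)/2*(hh s t/t)+4*a/t^5) t :=
  (contDiffAt_const.mul ((hh_smooth s ht).div contDiffAt_id ht.ne')).add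
    (by simpa using div_smooth (4*a) 5 1 one_ne_zero ht)

lemma VV_smooth (hy : y.1 ≠ 0) (ht : 0 < y.2) : ContDiffAt ℝ ∞ (VV i0 s a) y :=
  (((tm_smooth (contDiffAt_const.mul ((hh_smooth s ht).pow 2))).mul (FF_smooth _ _ _ hy)).add
    ((tm_smooth (VV_c2 ht)).mul (FF_smooth _ _ _ hy))).add
    ((tm_smooth (div_smooth _ _ _ (by norm_num) ht)).mul nsq_smooth)

lemma Lf_smooth (hy : y.1 ≠ 0) (ht : 0 < y.2) : ContDiffAt ℝ ∞ (Lf i0 s a) y :=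
  ((tm_smooth (contDiffAt_const.mul (hh_smooth s ht))).mul (FF_smooth _ _ _ hy)).add
    (tm_smooth (div_smooth1 _ _ (by norm_num) ht))

lemma GG_smooth (hy : y.1 ≠ 0) (ht : 0 < y.2) : ContDiffAt ℝ ∞ (GG i0 s a) y :=
  ((tm_smooth (contDiffAt_const.mul (hh_smooth s ht))).mul (FF_smooth _ _ _ hy)).add
    (tm_smooth (contDiffAt_const.div contDiffAt_id ht.ne'))

lemma d_ph (i : Fin n) (hy : y.1 ≠ 0) (ht : 0 < y.2) : d (ev i) (ph i0 s a) y = pp i0 s a i y := by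
  have h1 := (hh_smooth s ht).differentiableAt (by simp)
  have h2 := (FF_smooth i0 (999/500) PP hy).differentiableAt (by simp)
  have h3 := (div_smooth1 (-1) 8 (by norm_num) ht).differentiableAt (by simp)
  have h4 := (nsq_smooth (y := y)).differentiableAt (by simp)
  have k1 := (tm_smooth (contDiffAt_const.mul (hh_smooth s ht)) (A := fun t => a * hh s t)).differentiableAt (by simp)
  have k3 := (tm_smooth (div_smooth1 (-1) 8 (by norm_num) ht)).differentiableAt (by simp)
  unfold ph
  rw [d_add (k1.fun_mul h2) (k3.fun_mul h4), dx_mul i (h1.const_mul a) h2, dx_mul i h3 h4,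
    d_normsq, d_FF' _ _ _ _ hy, pp]
  congr 1
  field_simp
  ring

lemma dt_ph (hy : y.1 ≠ 0) (ht : 0 < y.2) :
    d et (ph i0 s a) y = ∑ i, pp i0 s a i y ^ 2 - VV i0 s a y := by
  have hr : ‖y.1‖ ≠ 0 := norm_ne_zero_iff.2 hy
  have h1 := (hh_deriv s ht).const_mul a
  have h2 := (FF_smooth i0 (999/500) PP hy).differentiableAt (by simp)
  have h3 : HasDerivAt (fun t : ℝ => -1/(8*t)) (1/(8*y.2^2)) y.2 := by
    have := ((hasDerivAt_id y.2).const_mul 8).inv (by simpa using ht.ne')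
    refine (this.const_mul (-1)).congr_deriv ?_ |>.congr_of_eventuallyEq ?_
    · simp; field_simp
    · filter_upwards with t; simp [neg_div]
  have h4 := (nsq_smooth (y := y)).differentiableAt (by simp)
  have k1 := (tm_smooth (contDiffAt_const.mul (hh_smooth s ht)) (A := fun t => a * hh s t)).differentiableAt (by simp)
  have k3 := (tm_smooth (div_smooth1 (-1) 8 (by norm_num) ht)).differentiableAt (by simp)
  have e5 : d et (fun y : YY n => ‖y.1‖ ^ 2) y = 0 :=
    dt_fst (fun x => ‖x‖ ^ 2) y (by simpa using (contDiff_norm_sq ℝ (n := ∞)).contDiffAt.differentiableAt (by simp))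
  have es : ∑ i, pp i0 s a i y ^ 2 = (a * hh s y.2)^2 * (∑ i, gF i0 (999/500) PP i y * gF i0 (999/500) PP i y)
     + 2 * (a * hh s y.2) * (-1/(4*y.2)) * (∑ i, gF i0 (999/500) PP i y * y.1 i)
     + (-1/(4*y.2))^2 * (∑ i, y.1 i * y.1 i) := by
    simp only [Finset.mul_sum, ← Finset.sum_add_distrib, pp]
    exact Finset.sum_congr rfl fun i _ => by ring
  rw [es, gF_gF _ _ _ _ _ hy, gF_x _ _ _ hy, sum_sq]
  unfold ph
  rw [d_add (k1.fun_mul h2) (k3.fun_mul h4), dt_mul h1 h2, dt_mul h3 h4,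
    e5, dt_FF _ _ _ hy, VV]
  simp only [FF, NN_ev]
  rw [show (2*(999/500) - 2:ℝ) = (999/500+999/500) - (2:ℕ) by norm_num, Real.rpow_sub_natCast hr,
    Real.rpow_add (norm_pos_iff.2 hy)]
  field_simp
  ring

end W
end CU

namespace CU
open Set MeasureTheory Filter Topology
open scoped ContDiff

section W
variable {n : ℕ} {i0 : Fin n} {s a : ℝ} {y : YY n}

lemma ds {f : YY n → ℝ} (h : ContDiffAt ℝ ∞ f y) : DifferentiableAt ℝ f y :=
  h.differentiableAt (by simp)

lemma dt_nsq : d et (fun y : YY n => ‖y.1‖ ^ 2) y = 0 :=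
    dt_fst (fun x => ‖x‖ ^ 2) y (by simpa using (contDiff_norm_sq ℝ (n := ∞)).contDiffAt.differentiableAt (by simp))

lemma dt_VV (hy : y.1 ≠ 0) (ht : 0 < y.2) : d et (VV i0 s a) y =
    (2*a^2*hh s y.2*(-4/y.2^5)) * FF i0 (2*(999/500)-2) NN y
    + (-a*(999/500)/2*((-4/y.2^5)/y.2-hh s y.2/y.2^2)-20*a/y.2^6)*FF i0 (999/500) PP y
    + (1/(8*y.2^3))*‖y.1‖^2 := by
  have t0 := ht.ne'
  have h1 : HasDerivAt (fun t => a^2 * hh s t^2) (2*a^2*hh s y.2*(-4/y.2^5)) y.2 :=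
    (((hh_deriv s ht).pow 2).const_mul (a^2)).congr_deriv (by norm_num; ring)
  have h2 : HasDerivAt (fun t => -a*(999/500)/2*(hh s t/t)+4*a/t^5)
      (-a*(999/500)/2*((-4/y.2^5)/y.2-hh s y.2/y.2^2)-20*a/y.2^6) y.2 := by
    refine ((((hh_deriv s ht).div (hasDerivAt_id _) t0).const_mul (-a*(999/500)/2)).add
      ((hasDerivAt_const _ (4*a)).div (hasDerivAt_pow 5 _) (pow_ne_zero _ t0))).congr_deriv ?_
    simp
    field_simp
    ring
  have h3 : HasDerivAt (fun t : ℝ => -1/(16*t^2)) (1/(8*y.2^3)) y.2 := by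
    refine ((hasDerivAt_const _ (-1:ℝ)).div ((hasDerivAt_pow 2 _).const_mul 16)
      (by positivity)).congr_deriv ?_
    simp
    field_simp
    ring
  have f1 := ds (FF_smooth i0 (2*(999/500)-2) NN hy)
  have f2 := ds (FF_smooth i0 (999/500) PP hy)
  have f3 := ds (nsq_smooth (y := y))
  have k1 := ds (tm_smooth (contDiffAt_const.mul ((hh_smooth s ht).pow 2)) (A := fun t => a^2 * hh s t^2))
  have k2 := ds (tm_smooth (VV_c2 (s := s) (a := a) ht))
  have k3 := ds (tm_smooth (div_smooth (-1) 2 16 (by norm_num) ht))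
  unfold VV
  rw [d_add ((k1.fun_mul f1).fun_add (k2.fun_mul f2)) (k3.fun_mul f3),
    d_add (k1.fun_mul f1) (k2.fun_mul f2), dt_mul h1 f1, dt_mul h2 f2, dt_mul h3 f3, dt_FF _ _ _ hy,
    dt_FF _ _ _ hy, dt_nsq]
  ring

lemma dx_VV (i : Fin n) (hy : y.1 ≠ 0) (ht : 0 < y.2) : d (ev i) (VV i0 s a) y =
    (a^2 * hh s y.2^2) * gF i0 (2*(999/500)-2) NN i y
    + (-a*(999/500)/2*(hh s y.2/y.2)+4*a/y.2^5)*gF i0 (999/500) PP i y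
    + (-1/(16*y.2^2))*(2 * y.1 i) := by
  have f1 := ds (FF_smooth i0 (2*(999/500)-2) NN hy)
  have f2 := ds (FF_smooth i0 (999/500) PP hy)
  have f3 := ds (nsq_smooth (y := y))
  have c1 : ContDiffAt ℝ ∞ (fun t => a^2 * hh s t^2) y.2 := contDiffAt_const.mul ((hh_smooth s ht).pow 2)
  have c2 := VV_c2 (s := s) (a := a) ht
  have c3 := (div_smooth (-1) 2 16 (by norm_num) ht)
  have k1 := ds (tm_smooth c1)
  have k2 := ds (tm_smooth c2)
  have k3 := ds (tm_smooth c3)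
  unfold VV
  rw [d_add ((k1.fun_mul f1).fun_add (k2.fun_mul f2)) (k3.fun_mul f3),
    d_add (k1.fun_mul f1) (k2.fun_mul f2), dx_mul i (c1.differentiableAt (by simp)) f1,
    dx_mul i (c2.differentiableAt (by simp)) f2, dx_mul i (c3.differentiableAt (by simp)) f3,
    d_FF' _ _ _ _ hy, d_FF' _ _ _ _ hy, d_normsq]

lemma dx_pp (i j : Fin n) (hy : y.1 ≠ 0) (ht : 0 < y.2) : d (ev i) (pp i0 s a j) y =
    a * hh s y.2 * d (ev i) (gF i0 (999/500) PP j) y + (-1/(4*y.2)) * dl i j := by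
  have c1 : ContDiffAt ℝ ∞ (fun t => a * hh s t) y.2 := contDiffAt_const.mul (hh_smooth s ht)
  have c3 := (div_smooth1 (-1) 4 (by norm_num) ht)
  have f1 := ds (gF_smooth i0 j (999/500) PP hy)
  have f3 := ds (coord_smooth j y)
  have k1 := ds (tm_smooth c1)
  have k3 := ds (tm_smooth c3)
  unfold pp
  rw [d_add (k1.fun_mul f1) (k3.fun_mul f3), dx_mul i (c1.differentiableAt (by simp)) f1,
   dx_mul i (c3.differentiableAt (by simp)) f3, d_fst_coord]

lemma div_pp (hy : y.1 ≠ 0) (ht : 0 < y.2) : ∑ i, d (ev i) (pp i0 s a i) y = Lf i0 s a y := by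
  simp only [dx_pp _ _ hy ht, Finset.sum_add_distrib, ← Finset.mul_sum, lap_gF _ _ _ hy, Lf]
  simp [dl]; ring

lemma lap_tF {A B : ℝ → ℝ} (hA : ∀ t, 0 < t → ContDiffAt ℝ ∞ A t) (hB : ∀ t, 0 < t → ContDiffAt ℝ ∞ B t)
    (β : ℝ) (p : Polynomial ℝ) (hy : y.1 ≠ 0) (ht : 0 < y.2) :
    ∑ i, d (ev i) (d (ev i) (fun y : YY n => A y.2 * FF i0 β p y + B y.2)) y =
      A y.2 * FF i0 (β-2) (LL n β p) y := by
  rw [← lap_gF _ _ _ hy, Finset.mul_sum]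
  refine Finset.sum_congr rfl fun i _ => ?_
  have hev : d (ev i) (fun y : YY n => A y.2 * FF i0 β p y + B y.2) =ᶠ[𝓝 y]
      fun y => A y.2 * gF i0 β p i y := by
    filter_upwards [ne_ev hy, (continuousAt_snd (p := y)).eventually (lt_mem_nhds ht)] with z hz htz
    have k1 := ds (tm_smooth (hA _ htz))
    have k2 := ds (tm_smooth (hB _ htz))
    have f1 := ds (FF_smooth i0 β p hz)
    rw [d_add (k1.fun_mul f1) k2, dx_mul i ((hA _ htz).differentiableAt (by simp)) f1,
      dx_snd _ _ _ ((hB _ htz).differentiableAt (by simp)), d_FF' _ _ _ _ hz]; ring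
  rw [(d_congr hev).self_of_nhds, dx_mul i ((hA _ ht).differentiableAt (by simp)) (ds (gF_smooth _ _ _ _ hy))]

lemma lap_Lf (hy : y.1 ≠ 0) (ht : 0 < y.2) : ∑ i, d (ev i) (d (ev i) (Lf i0 s a)) y =
   a * hh s y.2 * FF i0 (999/500-2-2) (LL n (999/500-2) (LL n (999/500) PP)) y :=
  lap_tF (A := fun t => a * hh s t) (B := fun t : ℝ => -n/(4*t)) (fun t ht => contDiffAt_const.mul (hh_smooth s ht))
    (fun t ht => div_smooth1 _ _ (by norm_num) ht) _ _ hy ht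

lemma lap_GG (hy : y.1 ≠ 0) (ht : 0 < y.2) : ∑ i, d (ev i) (d (ev i) (GG i0 s a)) y =
   2 * a * hh s y.2 * FF i0 (999/500-2-2) (LL n (999/500-2) (-p1 (999/500) PP)) y :=
  lap_tF (A := fun t => 2 * a * hh s t) (B := fun t : ℝ => 1/t) (fun t ht => contDiffAt_const.mul (hh_smooth s ht))
    (fun t ht => contDiffAt_const.div contDiffAt_id ht.ne') _ _ hy ht

lemma VV_pp (hy : y.1 ≠ 0) (ht : 0 < y.2) : ∑ i, d (ev i) (VV i0 s a) y * pp i0 s a i y =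
    (a^2 * hh s y.2^2) * (a * hh s y.2 * (∑ i, gF i0 (2*(999/500)-2) NN i y * gF i0 (999/500) PP i y)
       - (∑ i, gF i0 (2*(999/500)-2) NN i y * y.1 i)/(4*y.2))
    + (-a*(999/500)/2*(hh s y.2/y.2)+4*a/y.2^5)*(a * hh s y.2 * (∑ i, gF i0 (999/500) PP i y * gF i0 (999/500) PP i y)
       - (∑ i, gF i0 (999/500) PP i y * y.1 i)/(4*y.2))
    + 2*(-1/(16*y.2^2))*(a * hh s y.2 * (∑ i, gF i0 (999/500) PP i y * y.1 i) - (∑ i, y.1 i * y.1 i)/(4*y.2)) := by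
  simp only [dx_VV _ hy ht, Finset.mul_sum, Finset.sum_div, ← Finset.sum_add_distrib, ← Finset.sum_sub_distrib, pp]
  refine Finset.sum_congr rfl fun i _ => ?_
  field_simp
  ring

end W
end CU

namespace CU
open Set MeasureTheory Filter Topology
open scoped ContDiff

section W
variable {n : ℕ} {i0 : Fin n} {s a : ℝ} {y : YY n}

lemma c_le_one (x : EuclideanSpace ℝ (Fin n)) (_ : x ≠ 0) : |x i0 / ‖x‖| ≤ 1 := by
  rw [abs_div, abs_norm]
  exact div_le_one_of_le₀ (by simpa using EuclideanSpace.norm_eq x ▸ PiLp.norm_apply_le x i0) (norm_nonneg _)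

lemma sum_pp_sq (hy : y.1 ≠ 0) : ∑ i, pp i0 s a i y ^ 2 =
    a^2*hh s y.2^2*((‖y.1‖^(999/500:ℝ))^2/‖y.1‖^2*NN.eval (y.1 i0/‖y.1‖))
      -a*hh s y.2*(999/500)*‖y.1‖^(999/500:ℝ)*PP.eval (y.1 i0/‖y.1‖)/(2*y.2)+‖y.1‖^2/(16*y.2^2) := by
  have es : ∑ i, pp i0 s a i y ^ 2 = (a * hh s y.2)^2 * (∑ i, gF i0 (999/500) PP i y * gF i0 (999/500) PP i y)
     + 2 * (a * hh s y.2) * (-1/(4*y.2)) * (∑ i, gF i0 (999/500) PP i y * y.1 i)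
     + (-1/(4*y.2))^2 * (∑ i, y.1 i * y.1 i) := by
    simp only [Finset.mul_sum, ← Finset.sum_add_distrib, pp]
    exact Finset.sum_congr rfl fun i _ => by ring
  rw [es, gF_gF _ _ _ _ _ hy, gF_x _ _ _ hy, sum_sq, NN_ev]
  field_simp
  ring

lemma Q_cone (C η : ℝ) (hy : y.1 ≠ 0) (ht : 0 < y.2) (hc : 13/20 ≤ y.1 i0 / ‖y.1‖) (ha : 0 < a)
    (hh0 : 0 < hh s y.2) (hη : η ≤ 1/1000) (hηC : η * C ≤ 1/10)
    (hC : |(LL n (999/500-2) (LL n (999/500) PP)).eval (y.1 i0 / ‖y.1‖)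
      + 2 * (LL n (999/500-2) (-p1 (999/500) PP)).eval (y.1 i0 / ‖y.1‖)| ≤ C)
    (hB : 1 ≤ η * (a * hh s y.2 * ‖y.1‖^(999/500:ℝ))) :
    1/(2*y.2)*(∑ i, pp i0 s a i y ^ 2 + 1/y.2) ≤ - d et (VV i0 s a) y
      + 2 * ∑ i, d (ev i) (VV i0 s a) y * pp i0 s a i y
        - ∑ i, d (ev i) (d (ev i) (Lf i0 s a)) y - ∑ i, d (ev i) (d (ev i) (GG i0 s a)) y
         - 2 * GG i0 s a y * VV i0 s a y - GG i0 s a y ^ 2 := by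
  have hr0 : 0 < ‖y.1‖ := norm_pos_iff.2 hy
  have hr := hr0.ne'
  have r1 : ‖y.1‖ ^ (999/500-2:ℝ) = ‖y.1‖ ^ (999/500:ℝ) / ‖y.1‖^2 := by
    rw [show (999/500-2:ℝ) = 999/500 - (2:ℕ) by norm_num, Real.rpow_sub_natCast hr]
  have r2 : ‖y.1‖ ^ (999/500-2-2:ℝ) = ‖y.1‖ ^ (999/500:ℝ) / ‖y.1‖^4 := by
    rw [show (999/500-2-2:ℝ) = 999/500 - (4:ℕ) by norm_num, Real.rpow_sub_natCast hr]
  have r3 : ‖y.1‖ ^ (2*(999/500)-2:ℝ) = (‖y.1‖ ^ (999/500:ℝ))^2 / ‖y.1‖^2 := by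
    rw [show (2*(999/500)-2:ℝ) = (999/500+999/500) - (2:ℕ) by norm_num, Real.rpow_sub_natCast hr,
      Real.rpow_add hr0, ← sq]
  have hγe : (-p1 (999/500) PP).eval (y.1 i0 / ‖y.1‖) = y.1 i0 / ‖y.1‖*PP.derivative.eval (y.1 i0 / ‖y.1‖)
      -999/500*PP.eval (y.1 i0 / ‖y.1‖) := by simp [p1]
  rw [sum_pp_sq hy]
  have := Q_alg n a (hh s y.2) y.2 (‖y.1‖^(999/500:ℝ)) ‖y.1‖ (y.1 i0 / ‖y.1‖) _ _ _ _ _ _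
    ((LL n (999/500-2) (LL n (999/500) PP)).eval (y.1 i0 / ‖y.1‖))
    ((LL n (999/500-2) (-p1 (999/500) PP)).eval (y.1 i0 / ‖y.1‖)) _
    (d et (VV i0 s a) y) (∑ i, d (ev i) (VV i0 s a) y * pp i0 s a i y) (VV i0 s a y) (GG i0 s a y)
    (∑ i, d (ev i) (d (ev i) (Lf i0 s a)) y + ∑ i, d (ev i) (d (ev i) (GG i0 s a)) y) ht hr0 hc
    (le_of_abs_le (c_le_one _ hy)) ha hh0 (by positivity) (PP_ev _) (PP1_ev _) (PP2_ev _) hγe (NN_ev _) (NN1_ev _) rfl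
    ?_ C η hη hηC hC hB ?_ ?_ ?_ ?_ ?_
  · refine this.trans (le_of_eq ?_)
    ring
  · rw [hh]
    have : 0 ≤ (s^4)⁻¹ := by positivity
    linarith
  · rw [dt_VV hy ht]; simp only [FF, r3]
  · rw [VV_pp hy ht, gF_gF _ _ _ _ _ hy, gF_gF _ _ _ _ _ hy, gF_x _ _ _ hy, gF_x _ _ _ hy, sum_sq, r3]
    rw [NN_ev]
    field_simp
  · simp only [VV, FF, r3]
  · simp only [GG, FF, r1]
  · rw [lap_Lf hy ht, lap_GG hy ht]; simp only [FF, r2]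

lemma H_alg (P P1 P2 γ c q w : ℝ) (h1 : 1 ≤ (999/500)*(499/500)*P+γ)
    (h2 : 0 ≤ ((999/500)*(499/500)*P+γ)*P2-(499/500)^2*P1^2)
    (hγ : γ = c*P1-999/500*P) :
    0 ≤ ((999/500-2)*(-γ)-c*((999/500-1)*P1-c*P2))*q^2+2*((999/500-1)*P1-c*P2)*q*w+P2*w^2 := by
  have e : ((999/500-2)*(-γ)-c*((999/500-1)*P1-c*P2))*q^2+2*((999/500-1)*P1-c*P2)*q*w+P2*w^2
    = ((999/500)*(499/500)*P+γ)*q^2+2*(499/500*P1)*q*(w-c*q)+P2*(w-c*q)^2 := by rw [hγ]; ring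
  rw [e]
  generalize w - c*q = z at *
  generalize ((999/500)*(499/500)*P+γ) = A at *
  have : 0 ≤ A*(A*q^2+2*(499/500*P1)*q*z+P2*z^2) := by
    have : A*(A*q^2+2*(499/500*P1)*q*z+P2*z^2) = (A*q+499/500*P1*z)^2+(A*P2-(499/500)^2*P1^2)*z^2 := by ring
    rw [this]; positivity
  exact nonneg_of_mul_nonneg_right this (by linarith)

lemma H_cone (hy : y.1 ≠ 0) (ht : 0 < y.2) (hc : 13/20 ≤ y.1 i0 / ‖y.1‖) (ha : 0 < a)
    (hh0 : 0 < hh s y.2) (w : Fin n → ℝ) :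
    1/y.2 * ∑ i, w i ^ 2 ≤ 4 * ∑ i, ∑ j, d (ev i) (pp i0 s a j) y * w i * w j
      + 2 * GG i0 s a y * ∑ i, w i ^ 2 := by
  have hr0 : 0 < ‖y.1‖ := norm_pos_iff.2 hy
  have hr := hr0.ne'
  have c1 := le_of_abs_le (c_le_one (i0 := i0) _ hy)
  have r1 : ‖y.1‖ ^ (999/500-2:ℝ) = ‖y.1‖ ^ (999/500:ℝ) / ‖y.1‖^2 := by
    rw [show (999/500-2:ℝ) = 999/500 - (2:ℕ) by norm_num, Real.rpow_sub_natCast hr]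
  have r2 : ‖y.1‖ ^ (999/500-1:ℝ) = ‖y.1‖ ^ (999/500:ℝ) / ‖y.1‖ := by
    rw [Real.rpow_sub_one hr]
  have e1 : ∑ i, ∑ j, d (ev i) (pp i0 s a j) y * w i * w j = a * hh s y.2 *
    ((∑ i, gF i0 (999/500-2) (p1 (999/500) PP) i y * w i) * (∑ i, y.1 i * w i)
      + FF i0 (999/500-2) (p1 (999/500) PP) y * (∑ i, w i^2)
      + (∑ i, gF i0 (999/500-1) PP.derivative i y * w i) * w i0)
      + (-1/(4*y.2)) * (∑ i, w i^2) := by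
    have : ∀ i, ∑ j, d (ev i) (pp i0 s a j) y * w i * w j = a * hh s y.2 *
      (gF i0 (999/500-2) (p1 (999/500) PP) i y * w i * (∑ i, y.1 i * w i)
      + FF i0 (999/500-2) (p1 (999/500) PP) y * w i^2
      + gF i0 (999/500-1) PP.derivative i y * w i * w i0)
      + (-1/(4*y.2)) * w i^2 := by
      intro i
      have k1 : w i0 = ∑ j, dl i0 j * w j := by simp [dl]
      have k2 : w i ^ 2 = ∑ j, dl i j * (w i * w j) := by simp [dl, sq]
      rw [k1, k2]
      simp only [Finset.mul_sum, ← Finset.sum_add_distrib, dx_pp _ _ hy ht, d_gF _ _ _ _ _ hy]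
      exact Finset.sum_congr rfl fun j _ => by ring
    simp only [this, Finset.sum_add_distrib, ← Finset.mul_sum, ← Finset.sum_mul]
  rw [e1, gF_dot _ _ _ hy, gF_dot _ _ _ hy]
  have hγe : (p1 (999/500) PP).eval (y.1 i0 / ‖y.1‖) = -(y.1 i0 / ‖y.1‖*PP.derivative.eval (y.1 i0 / ‖y.1‖)
      -999/500*PP.eval (y.1 i0 / ‖y.1‖)) := by simp [p1]
  have hγd : (p1 (999/500) PP).derivative.eval (y.1 i0 / ‖y.1‖) =
     (999/500-1)*PP.derivative.eval (y.1 i0 / ‖y.1‖)-y.1 i0 / ‖y.1‖*PP.derivative.derivative.eval (y.1 i0 / ‖y.1‖) := by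
    simp [p1]; ring
  have hQ := H_alg (PP.eval (y.1 i0 / ‖y.1‖)) (PP.derivative.eval (y.1 i0 / ‖y.1‖)) (PP.derivative.derivative.eval (y.1 i0 / ‖y.1‖)) _ (y.1 i0 / ‖y.1‖) ((∑ i, y.1 i * w i)/‖y.1‖) (w i0)
    (by simpa only [PP_ev, PP1_ev] using pol_a (y.1 i0 / ‖y.1‖) hc c1)
    (by simpa only [PP_ev, PP1_ev, PP2_ev] using pol_i (y.1 i0 / ‖y.1‖) hc c1) rfl
  have hQ2 : 0 ≤ 4 * (a * hh s y.2 * (‖y.1‖ ^ (999/500:ℝ) / ‖y.1‖^2)) := by positivity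
  have hQ3 := mul_nonneg hQ2 hQ
  simp only [GG, FF, r1, r2, hγd, hγe, Polynomial.eval_neg]
  refine (le_add_of_nonneg_right hQ3).trans (le_of_eq ?_)
  field_simp
  ring

end W
end CU

namespace CU
open Set MeasureTheory Filter Topology
open scoped ContDiff

section W
variable {n : ℕ} {i0 : Fin n} {s a : ℝ} {y : YY n}

lemma c_big {c : ℝ} (h1 : |c| ≤ 1) (h : 0 < PP.eval c) : 13/20 ≤ c := by
  rw [PP_ev] at h
  rw [abs_le] at h1
  by_contra! hc
  rcases le_or_gt 0 c with h0 | h0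
  · nlinarith [mul_nonneg h0 h0, mul_nonneg h0 (mul_nonneg h0 h0)]
  · nlinarith [mul_nonneg (sq_nonneg (c+2/3)) (by linarith : 0 ≤ 1/3 - c), sq_nonneg c]

lemma P_le {c : ℝ} (h1 : |c| ≤ 1) : PP.eval c ≤ 2 := by
  rw [PP_ev]
  rw [abs_le] at h1
  nlinarith [sq_nonneg c, mul_nonneg (sq_nonneg c) (by linarith : 0 ≤ 1 - c)]

lemma glue {U F : YY n → ℝ} (hc : HasCompactSupport U) (h1 : ∀ y ∈ tsupport U, ContinuousAt F y)
    (h2 : ∀ y ∉ tsupport U, F y = 0) : Integrable F := by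
  have ho : IsOpen (tsupport U)ᶜ := (isClosed_tsupport U).isOpen_compl
  have : Continuous F := by
    rw [continuous_iff_continuousAt]
    intro y
    by_cases hy : y ∈ tsupport U
    · exact h1 y hy
    · have : F =ᶠ[𝓝 y] fun _ => 0 := by
        filter_upwards [ho.mem_nhds hy] with z hz
        exact h2 z hz
      exact continuousAt_const.congr this.symm
  refine this.integrable_of_hasCompactSupport (HasCompactSupport.intro hc h2)

lemma d_zero_off {U : YY n → ℝ} (a : YY n) (hy : y ∉ tsupport U) : d a U =ᶠ[𝓝 y] 0 := by
  exact (d_zero_of (a := a) (notMem_tsupport_iff_eventuallyEq.1 hy))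

lemma d_exp {φ : YY n → ℝ} (b : YY n) (h : DifferentiableAt ℝ φ y) :
    d b (fun y => Real.exp (φ y)) y = Real.exp (φ y) * d b φ y :=
  d_comp1 (Real.hasDerivAt_exp _) h

theorem carleman_cone (n : ℕ) (i0 : Fin n) : ∃ A0 : ℝ, 0 < A0 ∧ ∀ s a B : ℝ, 0 < s → s ≤ 1 → 0 < a → 0 < B →
    A0 ≤ a * B → ∀ U : YY n → ℝ, ContDiff ℝ ∞ U → HasCompactSupport U →
    (∀ y ∈ tsupport U, 0 < y.2 ∧ y.2 < s ∧ y.1 ≠ 0 ∧ B ≤ hh s y.2 * FF i0 (999/500) PP y) →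
    ∫ y, Real.exp (2 * ph i0 s a y) * (1/(4*s) * (∑ i, d (ev i) U y ^ 2 + U y ^ 2)) ≤
    ∫ y, Real.exp (2 * ph i0 s a y) * (∑ i, d (ev i) (d (ev i) U) y + d et U y) ^ 2 := by
  obtain ⟨C, hC⟩ : ∃ C : ℝ, ∀ c ∈ Icc (-1:ℝ) 1, |(LL n (999/500-2) (LL n (999/500) PP)).eval c
      + 2 * (LL n (999/500-2) (-p1 (999/500) PP)).eval c| ≤ C := by
    obtain ⟨C, hC⟩ := (isCompact_Icc (a := (-1:ℝ)) (b := 1)).exists_bound_of_continuousOn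
      (f := fun c => (LL n (999/500-2) (LL n (999/500) PP)).eval c
      + 2 * (LL n (999/500-2) (-p1 (999/500) PP)).eval c) (by fun_prop)
    exact ⟨C, hC⟩
  have hC0 : 0 ≤ C := (abs_nonneg _).trans (hC 0 (by simp))
  set η : ℝ := 1 / (1000 * (C + 1)) with hη
  have hη0 : 0 < η := by positivity
  have hη1 : η ≤ 1/1000 := by
    rw [hη]; apply one_div_le_one_div_of_le <;> linarith
  have hηC : η * C ≤ 1/10 := by
    rw [hη, one_div, inv_mul_le_iff₀ (by positivity)]; linarith
  refine ⟨2/η, by positivity, ?_⟩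
  intro s a B hs hs1 ha hB hAB U hU hcU hsup
  have hts : 0 < s := hs
  set v : YY n → ℝ := fun y => Real.exp (ph i0 s a y) * U y with hv
  have hφ : ∀ y ∈ tsupport U, ContDiffAt ℝ ∞ (ph i0 s a) y := fun y hy =>
    ph_smooth (hsup y hy).2.2.1 (hsup y hy).1
  have hE : ∀ y ∈ tsupport U, ContDiffAt ℝ ∞ (fun y => Real.exp (ph i0 s a y)) y := fun y hy =>
    (hφ y hy).exp
  have hsv : tsupport v ⊆ tsupport U := closure_mono fun y hy => by
    simp only [hv, Function.mem_support] at hy ⊢; exact right_ne_zero_of_mul hy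
  have hvU : ∀ y ∉ tsupport U, v =ᶠ[𝓝 y] 0 := by
    intro y hy
    filter_upwards [notMem_tsupport_iff_eventuallyEq.1 hy] with z hz
    simp [hv, hz]
  have hvs : ContDiff ℝ ∞ v := by
    rw [contDiff_iff_contDiffAt]
    intro y
    by_cases hy : y ∈ tsupport U
    · exact (hE y hy).mul hU.contDiffAt
    · exact contDiffAt_const.congr_of_eventuallyEq (hvU y hy)
  have hvc : HasCompactSupport v := hcU.of_isClosed_subset (isClosed_tsupport _) hsv
  have hdU : ∀ b, ContDiff ℝ ∞ (d b U) := fun b => d_contDiff hU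
  have e0 : ∀ b, ∀ y ∈ tsupport U, d b v y = Real.exp (ph i0 s a y) * (d b (ph i0 s a) y * U y + d b U y) := by
    intro b y hy
    rw [hv, d_mul (ds (hE y hy)) (ds hU.contDiffAt), d_exp _ (ds (hφ y hy))]; ring
  have e1 : ∀ i, ∀ y ∈ tsupport U, d (ev i) v y = Real.exp (ph i0 s a y) * (pp i0 s a i y * U y + d (ev i) U y) := by
    intro i y hy
    rw [e0 _ y hy, d_ph _ (hsup y hy).2.2.1 (hsup y hy).1]
  have e2 : ∀ i, ∀ y ∈ tsupport U, d (ev i) (d (ev i) v) y = Real.exp (ph i0 s a y) *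
      (pp i0 s a i y * (pp i0 s a i y * U y + d (ev i) U y) + d (ev i) (pp i0 s a i) y * U y
        + pp i0 s a i y * d (ev i) U y + d (ev i) (d (ev i) U) y) := by
    intro i y hy
    obtain ⟨ht, hts, hy0, -⟩ := hsup y hy
    have : d (ev i) v =ᶠ[𝓝 y] fun y => Real.exp (ph i0 s a y) * (pp i0 s a i y * U y + d (ev i) U y) := by
      filter_upwards [ne_ev hy0, (continuousAt_snd (p := y)).eventually (lt_mem_nhds ht)] with z hz htz
      have hφz := ph_smooth (i0 := i0) (s := s) (a := a) hz htz
      rw [hv, d_mul (ds hφz.exp) (ds hU.contDiffAt), d_exp _ (ds hφz), d_ph _ hz htz]; ring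
    have k1 := ds (pp_smooth (i0 := i0) (s := s) (a := a) i hy0 ht)
    have k2 := ds (hU.contDiffAt (x := y))
    have k3 := ds ((hdU (ev i)).contDiffAt (x := y))
    rw [(d_congr this).self_of_nhds, d_mul (ds (hE y hy)) ((k1.fun_mul k2).fun_add k3), d_exp _ (ds (hφ y hy)),
      d_add (k1.fun_mul k2) k3, d_mul k1 k2, d_ph _ hy0 ht]
    ring
  have : (volume : Measure (YY n)).IsAddHaarMeasure :=
    inferInstanceAs ((volume : Measure (EuclideanSpace ℝ (Fin n))).prod (volume : Measure ℝ)).IsAddHaarMeasure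
  refine carleman volume (fun i => ev i) et v (VV i0 s a) (Lf i0 s a) (GG i0 s a) (fun i => pp i0 s a i) hvs hvc
    (fun y hy => VV_smooth (hsup y (hsv hy)).2.2.1 (hsup y (hsv hy)).1)
    (fun y hy => Lf_smooth (hsup y (hsv hy)).2.2.1 (hsup y (hsv hy)).1)
    (fun y hy => GG_smooth (hsup y (hsv hy)).2.2.1 (hsup y (hsv hy)).1)
    (fun i y hy => pp_smooth i (hsup y (hsv hy)).2.2.1 (hsup y (hsv hy)).1)
    (fun y hy => div_pp (hsup y (hsv hy)).2.2.1 (hsup y (hsv hy)).1)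
    _ ?_ ?_ ?_ _ ?_ ?_ ?_
  · refine glue hcU (fun y hy => ?_) fun y hy => ?_
    · have := (hφ y hy).continuousAt
      have h1 := hU.continuous
      have h2 : ∀ i, Continuous (d (ev i) U) := fun i => (hdU _).continuous
      fun_prop
    · simp [image_eq_zero_of_notMem_tsupport hy, (d_zero_off _ hy).self_of_nhds]
  · intro y hy'
    have hy := hsv hy'
    obtain ⟨ht, hts, hy0, hBy⟩ := hsup y hy
    have hr0 : 0 < ‖y.1‖ := norm_pos_iff.2 hy0
    have hh0 : 0 < hh s y.2 := by
      rw [hh, sub_pos]; gcongr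
    have hcl := c_le_one (i0 := i0) _ hy0
    have hρ : 0 < ‖y.1‖^(999/500:ℝ) := by positivity
    have hBy' : B ≤ hh s y.2 * ‖y.1‖^(999/500:ℝ) * PP.eval (y.1 i0 / ‖y.1‖) := by
      rw [mul_assoc]; exact hBy
    have hPpos : 0 < PP.eval (y.1 i0 / ‖y.1‖) :=
      pos_of_mul_pos_right (hB.trans_le hBy') (by positivity)
    have hcb := c_big hcl hPpos
    have hB2 : 1 ≤ η * (a * hh s y.2 * ‖y.1‖^(999/500:ℝ)) := by
      have h1 : hh s y.2 * ‖y.1‖^(999/500:ℝ) * PP.eval (y.1 i0 / ‖y.1‖) ≤ hh s y.2 * ‖y.1‖^(999/500:ℝ) * 2 :=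
        mul_le_mul_of_nonneg_left (P_le hcl) (by positivity)
      have h2 : 2/η ≤ a * (hh s y.2 * ‖y.1‖^(999/500:ℝ) * 2) :=
        hAB.trans (mul_le_mul_of_nonneg_left (hBy'.trans h1) ha.le)
      rw [div_le_iff₀ hη0] at h2
      linarith
    have hQ := Q_cone C η hy0 ht hcb ha hh0 hη1 hηC (hC _ (abs_le.1 hcl)) hB2
    have hH := H_cone hy0 ht hcb ha hh0 (fun i => d (ev i) v y)
    refine le_trans ?_ (add_le_add hH (mul_le_mul_of_nonneg_left hQ (sq_nonneg (v y))))
    have hw : ∀ i, Real.exp (ph i0 s a y) * d (ev i) U y = d (ev i) v y - pp i0 s a i y * v y := by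
      intro i; rw [e1 i y hy, hv]; ring
    have hs1 : Real.exp (2 * ph i0 s a y) * (1/(4*s) * (∑ i, d (ev i) U y ^ 2 + U y ^ 2)) =
      1/(4*s) * (∑ i, (d (ev i) v y - pp i0 s a i y * v y)^2 + v y ^ 2) := by
      simp only [← hw, mul_pow, ← Finset.mul_sum]
      have hvy : v y = Real.exp (ph i0 s a y) * U y := rfl
      rw [two_mul, Real.exp_add, hvy]; ring
    rw [hs1]
    have hs2 : ∑ i, (d (ev i) v y - pp i0 s a i y * v y)^2 ≤ 2 * ∑ i, d (ev i) v y ^2 + 2 * (∑ i, pp i0 s a i y ^2) * v y^2 := by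
      simp only [Finset.mul_sum, Finset.sum_mul, ← Finset.sum_add_distrib]
      refine Finset.sum_le_sum fun i _ => ?_
      have := sq_nonneg (d (ev i) v y + pp i0 s a i y * v y)
      linarith
    have hA : 0 ≤ ∑ i, d (ev i) v y ^2 := Finset.sum_nonneg fun _ _ => sq_nonneg _
    have hP : 0 ≤ (∑ i, pp i0 s a i y ^2) := Finset.sum_nonneg fun _ _ => sq_nonneg _
    have t1 : 1 ≤ 1/y.2 := by rw [le_div_iff₀ ht]; linarith
    have t2 : 1/(4*s) ≤ 1/(4*y.2) := by gcongr
    have h3 : 1/(4*s) * (∑ i, (d (ev i) v y - pp i0 s a i y * v y)^2 + v y ^ 2) ≤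
        1/(4*y.2) * (2 * ∑ i, d (ev i) v y ^2 + 2 * (∑ i, pp i0 s a i y ^2) * v y^2 + v y^2) := by
      apply mul_le_mul t2 _ _ (by positivity)
      · linarith
      · exact add_nonneg (Finset.sum_nonneg fun _ _ => sq_nonneg _) (sq_nonneg _)
    refine h3.trans ?_
    have h4 : 1/(4*y.2) * (2 * ∑ i, d (ev i) v y ^2 + 2 * (∑ i, pp i0 s a i y ^2) * v y^2 + v y^2) =
      1/y.2 * ((1/2) * ∑ i, d (ev i) v y ^2 + (1/2)* (∑ i, pp i0 s a i y ^2) * v y^2 + 1/4 * v y^2) := by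
      field_simp; ring
    have h5 : 1 / y.2 * ∑ i, d (ev i) v y ^ 2 + v y ^ 2 * (1 / (2 * y.2) * (∑ i, pp i0 s a i y ^ 2 + 1 / y.2)) =
      1/y.2 * (∑ i, d (ev i) v y ^2 + (1/2)* (∑ i, pp i0 s a i y ^2) * v y^2 + 1/2 * v y^2*(1/y.2)) := by
      field_simp
      ring
    rw [h4, h5]
    refine mul_le_mul_of_nonneg_left ?_ (by positivity)
    have := mul_le_mul_of_nonneg_left t1 (sq_nonneg (v y))
    nlinarith [sq_nonneg (v y)]
  · intro y hy
    by_cases hyU : y ∈ tsupport U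
    · have hv0 : v =ᶠ[𝓝 y] 0 := notMem_tsupport_iff_eventuallyEq.1 hy
      have h0 : U y = 0 := by
        have := hv0.self_of_nhds
        simpa [hv, Real.exp_ne_zero] using this
      have h1 : ∀ i, d (ev i) U y = 0 := by
        intro i
        have := e1 i y hyU
        rw [(d_zero_of (a := ev i) hv0).self_of_nhds, h0] at this
        simpa [Real.exp_ne_zero] using this.symm
      simp [h0, h1]
    · simp [image_eq_zero_of_notMem_tsupport hyU, (d_zero_off _ hyU).self_of_nhds]
  · refine glue hcU (fun y hy => ?_) fun y hy => ?_
    · have := (hφ y hy).continuousAt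
      have h2 : Continuous (d et U) := (hdU _).continuous
      have h3 : ∀ i, Continuous (d (ev i) (d (ev i) U)) := fun i => (d_contDiff (hdU _)).continuous
      fun_prop
    · have : ∀ b, d b (d b U) y = 0 := fun b => (d_zero_of (d_zero_off b hy)).self_of_nhds
      simp [this, (d_zero_off _ hy).self_of_nhds]
  · intro y; positivity
  · intro y hy'
    have hy := hsv hy'
    obtain ⟨ht, hts, hy0, hBy⟩ := hsup y hy
    have hs1 : ∑ i, d (ev i) (d (ev i) v) y = Real.exp (ph i0 s a y) * ((∑ i, pp i0 s a i y ^ 2) * U y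
      + 2 * ∑ i, pp i0 s a i y * d (ev i) U y + Lf i0 s a y * U y + ∑ i, d (ev i) (d (ev i) U) y) := by
      rw [← div_pp hy0 ht]
      simp only [Finset.mul_sum, Finset.sum_mul, ← Finset.sum_add_distrib, e2 _ y hy]
      exact Finset.sum_congr rfl fun i _ => by ring
    have hs2 : ∑ i, pp i0 s a i y * d (ev i) v y = Real.exp (ph i0 s a y) * ((∑ i, pp i0 s a i y ^ 2) * U y
      + ∑ i, pp i0 s a i y * d (ev i) U y) := by
      simp only [Finset.mul_sum, Finset.sum_mul, ← Finset.sum_add_distrib, e1 _ y hy]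
      exact Finset.sum_congr rfl fun i _ => by ring
    rw [hs1, hs2, e0 _ y hy, dt_ph hy0 ht, two_mul (ph i0 s a y), Real.exp_add, hv]
    apply le_of_eq
    ring

end W
end CU

namespace CU
open Set MeasureTheory Filter Topology
open scoped ContDiff
section
variable {n : ℕ}
local notation "E" => EuclideanSpace ℝ (Fin n)

lemma int_gauss (n : ℕ) {b : ℝ} (hb : 0 < b) : Integrable (fun z : EuclideanSpace ℝ (Fin n) => Real.exp (-b * ‖z‖^2)) := by
  have := GaussianFourier.integrable_cexp_neg_mul_sq_norm_add (V := EuclideanSpace ℝ (Fin n)) (b := (b:ℂ)) (by simpa using hb) 0 0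
  have h2 := this.norm
  refine h2.congr (Eventually.of_forall fun z => ?_)
  simp only [Complex.norm_exp]
  congr 1
  have e : -(b:ℂ) * (‖z‖:ℂ)^2 + 0 * ((inner ℝ (0:EuclideanSpace ℝ (Fin n)) z : ℝ) : ℂ) = ((-b * ‖z‖^2 : ℝ) : ℂ) := by push_cast; ring
  rw [e, Complex.ofReal_re]

noncomputable def ga0 (z : EuclideanSpace ℝ (Fin n)) : ℝ := Real.exp (-(1/2) * ‖z‖^2)
noncomputable def ga (z : EuclideanSpace ℝ (Fin n)) : ℝ := ga0 z / ∫ w : EuclideanSpace ℝ (Fin n), ga0 w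

lemma Zpos : 0 < ∫ w : E, ga0 w := by
  have hi : Integrable (fun z : E => ga0 z) := int_gauss n (by norm_num)
  rw [integral_pos_iff_support_of_nonneg (f := fun z : E => ga0 z) (fun z => (Real.exp_pos _).le) hi]
  have : Function.support (fun z : E => ga0 z) = univ := by
    ext z; simp [ga0, Real.exp_ne_zero]
  rw [this]
  exact Measure.measure_univ_pos.2 (NeZero.ne _)

lemma ga_pos (z : E) : 0 < ga z := div_pos (Real.exp_pos _) Zpos
lemma ga_int : Integrable (fun z : E => ga z) := (int_gauss n (by norm_num)).div_const _
lemma ga_one : ∫ z : E, ga z = 1 := by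
  simp only [ga]; rw [integral_div, div_self Zpos.ne']
lemma ga_smooth : ContDiff ℝ ∞ (fun z : E => ga z) := by
  unfold ga ga0
  have : ContDiff ℝ ∞ (fun z : E => ‖z‖^2) := contDiff_norm_sq ℝ
  exact ((contDiff_const.mul this).exp).div_const _
lemma ga_cont : Continuous (fun z : E => ga z) := ga_smooth.continuous
lemma ga_int1 : Integrable (fun z : E => ga z * ‖z‖) := by
  have h := (int_gauss n (show (0:ℝ) < 1/4 by norm_num)).div_const (∫ w : E, ga0 w)
  refine h.mono' (ga_cont.mul continuous_norm).aestronglyMeasurable (Eventually.of_forall fun z => ?_)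
  rw [Real.norm_eq_abs, abs_of_nonneg (mul_nonneg (ga_pos z).le (norm_nonneg _)), ga, div_mul_eq_mul_div]
  refine div_le_div_of_nonneg_right ?_ Zpos.le
  have h1 : ‖z‖ ≤ Real.exp (1/4 * ‖z‖^2) := by
    have := Real.add_one_le_exp (1/4 * ‖z‖^2)
    nlinarith [sq_nonneg (‖z‖/2 - 1)]
  calc ga0 z * ‖z‖ ≤ ga0 z * Real.exp (1/4 * ‖z‖^2) := mul_le_mul_of_nonneg_left h1 (Real.exp_pos _).le
    _ = _ := by rw [ga0, ← Real.exp_add]; congr 1; ring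

lemma d_ga (i : Fin n) (z : E) : d (EuclideanSpace.single i 1) ga z = - (z i) * ga z := by
  have h : HasFDerivAt (fun z : E => ‖z‖^2) ((2:ℕ) • (innerSL ℝ z)) z := by
    exact (hasStrictFDerivAt_norm_sq z).hasFDerivAt
  have h2 := ((h.const_mul (-(1/2):ℝ)).exp).mul_const ((∫ w : E, ga0 w)⁻¹)
  have h3 := h2.congr_of_eventuallyEq (f₁ := fun z : E => ga z) (Eventually.of_forall fun w => by
    simp [ga, ga0, div_eq_mul_inv])
  simp only [d, h3.fderiv]
  simp [ga, ga0, EuclideanSpace.inner_single_right]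
  ring

structure Nice (f : YY n → ℝ) : Prop where
  sm : ContDiff ℝ ∞ f
  sx : ∃ R : ℝ, ∀ y, R < ‖y.1‖ → f y = 0
  b0 : ∃ C : ℝ, ∀ y, |f y| ≤ C
  b1 : ∃ C : ℝ, ∀ y, ‖fderiv ℝ f y‖ ≤ C

noncomputable def SG (f : YY n → ℝ) (y : YY n) (s : ℝ) : ℝ := ∫ z : EuclideanSpace ℝ (Fin n), ga z * f (y.1 + √(2*s) • z, y.2 + s)

lemma ga_bd_int {f : E → ℝ} (hf : Continuous f) {C : ℝ} (hC : ∀ y, |f y| ≤ C) : Integrable (fun z : E => ga z * f z) := by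
  refine (ga_int.mul_const C).mono' (ga_cont.mul hf).aestronglyMeasurable (Eventually.of_forall fun z => ?_)
  rw [Real.norm_eq_abs, abs_mul, abs_of_pos (ga_pos z)]
  exact mul_le_mul_of_nonneg_left (hC z) (ga_pos z).le

lemma SG_cont {f : YY n → ℝ} (hf : Continuous f) {C : ℝ} (hC : ∀ y, |f y| ≤ C) :
    Continuous (fun p : YY n × ℝ => SG f p.1 p.2) := by
  refine continuous_of_dominated (bound := fun z => ga z * C) (fun p => ?_) (fun p => Eventually.of_forall fun z => ?_)
    (ga_int.mul_const C) (Eventually.of_forall fun z => ?_)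
  · exact (ga_cont.mul (by fun_prop)).aestronglyMeasurable
  · rw [Real.norm_eq_abs, abs_mul, abs_of_pos (ga_pos z)]
    exact mul_le_mul_of_nonneg_left (hC _) (ga_pos z).le
  · fun_prop

lemma SG_zero (f : YY n → ℝ) (y : YY n) : SG f y 0 = f y := by
  simp only [SG, mul_zero, Real.sqrt_zero, zero_smul, add_zero]
  rw [integral_mul_const, ga_one, one_mul]

lemma SG_dx {f : YY n → ℝ} (hf : Nice f) (y a : YY n) (s h : ℝ) :
    HasDerivAt (fun h : ℝ => SG f (y + h • a) s) (SG (d a f) (y + h • a) s) h := by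
  obtain ⟨C0, hC0⟩ := hf.b0
  obtain ⟨C1, hC1⟩ := hf.b1
  have hfc := hf.sm.continuous
  have hdc : Continuous (d a f) := (d_contDiff hf.sm).continuous
  refine (hasDerivAt_integral_of_dominated_loc_of_deriv_le (bound := fun z => ga z * (C1 * ‖a‖)) (s := univ) univ_mem
    (Eventually.of_forall fun h => (ga_cont.mul (by fun_prop)).aestronglyMeasurable)
    (ga_bd_int (by fun_prop) fun _ => hC0 _)
    (F' := fun h z => ga z * d a f ((y + h • a).1 + √(2*s) • z, (y + h • a).2 + s))
    ((ga_cont.mul (by fun_prop)).aestronglyMeasurable)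
    (Eventually.of_forall fun z h _ => ?_)
    (ga_int.mul_const _) (Eventually.of_forall fun z h _ => ?_)).2
  · rw [Real.norm_eq_abs, abs_mul, abs_of_pos (ga_pos z)]
    refine mul_le_mul_of_nonneg_left ?_ (ga_pos z).le
    exact ((fderiv ℝ f _).le_opNorm a).trans (mul_le_mul_of_nonneg_right (hC1 _) (norm_nonneg _))
  · refine HasDerivAt.const_mul _ ?_
    have e : ∀ h : ℝ, ((y + h • a).1 + √(2*s) • z, (y + h • a).2 + s) = (y + (√(2*s) • z, s)) + h • a := fun h => by
      ext : 1
      · simp only [Prod.fst_add, Prod.smul_fst]; abel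
      · simp only [Prod.snd_add, Prod.smul_snd]; abel
    simp only [e]
    have h1 : HasDerivAt (fun h : ℝ => (y + (√(2*s) • z, s)) + h • a) a h := by
      simpa using ((hasDerivAt_id h).smul_const a).const_add (y + (√(2*s) • z, s))
    exact ((hf.sm.differentiable (by simp)) _).hasFDerivAt.comp_hasDerivAt h h1

lemma fd_sum (f : YY n → ℝ) (y : YY n) (z : E) : fderiv ℝ f y (z, 0) = ∑ i, z i * d (ev i) f y := by
  have : (z, (0:ℝ)) = ∑ i, z i • (ev i : YY n) := by
    ext j
    · simp [ev, Prod.fst_sum, Finset.sum_apply, Pi.single_apply]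
    · simp [ev, Prod.snd_sum]
  rw [this, map_sum]
  simp [d]

lemma ga_ibp {f : YY n → ℝ} (hf : ContDiff ℝ ∞ f) (hsx : ∃ R : ℝ, ∀ y, R < ‖y.1‖ → f y = 0) (i : Fin n) (x : E) (t : ℝ) {c : ℝ} (hc : 0 < c) :
    Integrable (fun z : E => ga z * (z i * f (x + c • z, t))) ∧ Integrable (fun z : E => ga z * d (ev i) f (x + c • z, t)) ∧
    ∫ z : E, ga z * (z i * f (x + c • z, t)) = c * ∫ z : E, ga z * d (ev i) f (x + c • z, t) := by
  obtain ⟨R, hR⟩ := hsx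
  have hcs : ∀ g : YY n → ℝ, (∀ y, R < ‖y.1‖ → g y = 0) → HasCompactSupport (fun z : E => g (x + c • z, t)) := fun g hg => by
    refine HasCompactSupport.intro (isCompact_closedBall (0:E) ((R + ‖x‖)/c)) fun z hz => hg _ ?_
    simp only [mem_closedBall_iff_norm, sub_zero, not_le] at hz
    rw [div_lt_iff₀ hc] at hz
    have h1 : ‖c • z‖ = c * ‖z‖ := by rw [norm_smul, Real.norm_eq_abs, abs_of_pos hc]
    have h2 : ‖c • z‖ ≤ ‖x + c • z‖ + ‖x‖ := by
      calc _ = ‖(x + c • z) - x‖ := by congr 1; abel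
        _ ≤ _ := norm_sub_le _ _
    simp only; linarith
  have hd0 : ∀ y : YY n, R < ‖y.1‖ → d (ev i) f y = 0 := fun y hy => by
    have : f =ᶠ[𝓝 y] fun _ => 0 := by
      have : ∀ᶠ w : YY n in 𝓝 y, R < ‖w.1‖ := (by fun_prop : Continuous (fun w : YY n => ‖w.1‖)).continuousAt.eventually (lt_mem_nhds hy)
      filter_upwards [this] with w hw using hR w hw
    exact (d_zero_of this).self_of_nhds
  have hsm : ContDiff ℝ ∞ (fun z : E => f (x + c • z, t)) := hf.comp (by fun_prop)
  have hdd : ∀ z, d (EuclideanSpace.single i 1) (fun z : E => f (x + c • z, t)) z = c * d (ev i) f (x + c • z, t) := fun z => by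
    have h1 : HasFDerivAt (fun z : E => (x + c • z, t)) (((c • ContinuousLinearMap.id ℝ E)).prod (0 : E →L[ℝ] ℝ)) z := by
      refine HasFDerivAt.prodMk ?_ (hasFDerivAt_const _ _)
      exact ((hasFDerivAt_id z).const_smul c).const_add x
    have h2 := ((hf.differentiable (by simp)) (x + c • z, t)).hasFDerivAt.comp z h1
    have h3 : fderiv ℝ (fun z : E => f (x + c • z, t)) z = _ := h2.fderiv
    simp only [d, h3]
    have : ((((c • ContinuousLinearMap.id ℝ E)).prod (0 : E →L[ℝ] ℝ)) (EuclideanSpace.single i 1)) = c • (ev i : YY n) := by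
      ext : 1 <;> simp [ev]
    rw [ContinuousLinearMap.comp_apply, this]; simp
  have key := integral_d (volume : Measure E) (a := EuclideanSpace.single i 1) (ga_smooth.mul hsm) ((hcs f hR).mul_left)
  have hpt : ∀ z, d (EuclideanSpace.single i 1) (fun z : E => ga z * f (x + c • z, t)) z
      = - (ga z * (z i * f (x + c • z, t))) + c * (ga z * d (ev i) f (x + c • z, t)) := fun z => by
    rw [d_mul (ga_smooth.differentiable (by simp) z) (hsm.differentiable (by simp) z), hdd, d_ga]; ring
  have i1 : Integrable (fun z : E => ga z * (z i * f (x + c • z, t))) := by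
    refine Continuous.integrable_of_hasCompactSupport ?_ ((hcs f hR).mul_left).mul_left
    have := hf.continuous
    exact ga_cont.mul ((by fun_prop : Continuous fun z : E => z i).mul (by fun_prop))
  have i2 : Integrable (fun z : E => ga z * d (ev i) f (x + c • z, t)) := by
    refine Continuous.integrable_of_hasCompactSupport ?_ (hcs (d (ev i) f) hd0).mul_left
    have := (d_contDiff (a := ev i) hf).continuous
    exact ga_cont.mul (by fun_prop)
  refine ⟨i1, i2, ?_⟩
  have k2 := key.2
  simp only [hpt] at k2
  rw [integral_add (f := fun z : E => - (ga z * (z i * f (x + c • z, t)))) i1.neg (i2.const_mul c), integral_neg, integral_const_mul] at k2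
  linarith

noncomputable def Lh (f : YY n → ℝ) (y : YY n) : ℝ := ∑ i, d (ev i) (d (ev i) f) y + d et f y

lemma SG_ds {f : YY n → ℝ} (hf : Nice f) (y : YY n) {s : ℝ} (hs : 0 < s) :
    HasDerivAt (fun s : ℝ => SG f y s) (SG (Lh f) y s) s := by
  obtain ⟨C0, hC0⟩ := hf.b0
  obtain ⟨C1, hC1⟩ := hf.b1
  have hfc := hf.sm.continuous
  have hfd : Continuous (fderiv ℝ f) := hf.sm.continuous_fderiv (by simp)
  have hC1' : 0 ≤ C1 := (norm_nonneg _).trans (hC1 0)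
  have hm := (hasDerivAt_integral_of_dominated_loc_of_deriv_le (μ := (volume : Measure E))
    (F := fun s z => ga z * f (y.1 + √(2*s) • z, y.2 + s)) (x₀ := s)
    (bound := fun z => C1 * (ga z * ‖z‖ * (√s)⁻¹ + ga z)) (s := Ioi (s/2)) (Ioi_mem_nhds (by linarith))
    (Eventually.of_forall fun h => (ga_cont.mul (by fun_prop)).aestronglyMeasurable)
    (ga_bd_int (by fun_prop) fun _ => hC0 _)
    (F' := fun s z => ga z * fderiv ℝ f (y.1 + √(2*s) • z, y.2 + s) ((√(2*s))⁻¹ • z, 1))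
    ((ga_cont.mul (by fun_prop)).aestronglyMeasurable)
    (Eventually.of_forall fun z s' hs' => ?_)
    (((ga_int1.mul_const _).add ga_int).const_mul _) (Eventually.of_forall fun z s' hs' => ?_))
  · refine hm.2.congr_deriv ?_
    have hc : 0 < √(2*s) := Real.sqrt_pos.2 (by linarith)
    have hex : ∀ z : E, ga z * fderiv ℝ f (y.1 + √(2*s) • z, y.2 + s) ((√(2*s))⁻¹ • z, 1)
        = (√(2*s))⁻¹ * ∑ i, ga z * (z i * d (ev i) f (y.1 + √(2*s) • z, y.2 + s)) + ga z * d et f (y.1 + √(2*s) • z, y.2 + s) := fun z => by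
      have : (((√(2*s))⁻¹ • z, 1) : YY n) = (√(2*s))⁻¹ • (z, 0) + et := by ext : 1 <;> simp [et]
      rw [this, map_add, map_smul, fd_sum, mul_add, ← Finset.mul_sum, smul_eq_mul, ← mul_assoc, ← mul_assoc, mul_comm (ga z)]
      rfl
    have hds : ∀ i : Fin n, ∃ R : ℝ, ∀ y, R < ‖y.1‖ → d (ev i) f y = 0 := fun i => by
      obtain ⟨R, hR⟩ := hf.sx
      refine ⟨R, fun y hy => ?_⟩
      have : f =ᶠ[𝓝 y] fun _ => 0 := by
        have : ∀ᶠ w : YY n in 𝓝 y, R < ‖w.1‖ := (by fun_prop : Continuous (fun w : YY n => ‖w.1‖)).continuousAt.eventually (lt_mem_nhds hy)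
        filter_upwards [this] with w hw using hR w hw
      exact (d_zero_of this).self_of_nhds
    have ib := fun i : Fin n => ga_ibp (d_contDiff (a := ev i) hf.sm) (hds i) i y.1 (y.2+s) hc
    have iet : Integrable (fun z : E => ga z * d et f (y.1 + √(2*s) • z, y.2 + s)) := by
      have := (d_contDiff (a := et) hf.sm).continuous
      refine ga_bd_int (C := C1 * ‖(et : YY n)‖) (by fun_prop) fun z => ?_
      exact ((fderiv ℝ f _).le_opNorm et).trans (mul_le_mul_of_nonneg_right (hC1 _) (norm_nonneg _))
    simp only [hex]
    rw [integral_add ((integrable_finsetSum _ fun i _ => (ib i).1).const_mul _) iet, integral_const_mul,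
      integral_finsetSum _ (fun i _ => (ib i).1)]
    simp only [fun i => (ib i).2.2]
    rw [← Finset.mul_sum, ← mul_assoc, inv_mul_cancel₀ hc.ne', one_mul, SG]
    simp only [Lh, mul_add, Finset.mul_sum]
    rw [integral_add (integrable_finsetSum _ fun i _ => (ib i).2.1) iet, integral_finsetSum _ (fun i _ => (ib i).2.1)]
  · have hs'' : s/2 < s' := hs'
    have h0 : √s ≤ √(2*s') := Real.sqrt_le_sqrt (by linarith)
    have h00 : 0 < √s := Real.sqrt_pos.2 hs
    rw [Real.norm_eq_abs, abs_mul, abs_of_pos (ga_pos z)]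
    have h1 := ((fderiv ℝ f (y.1 + √(2*s') • z, y.2 + s')).le_opNorm ((√(2*s'))⁻¹ • z, 1)).trans (mul_le_mul_of_nonneg_right (hC1 _) (norm_nonneg _))
    have h2 : ‖(((√(2*s'))⁻¹ • z, (1:ℝ)) : YY n)‖ ≤ ‖z‖ * (√s)⁻¹ + 1 := by
      rw [Prod.norm_def]
      refine max_le ?_ (by simp; positivity)
      simp only [norm_smul, norm_inv, Real.norm_eq_abs, abs_of_nonneg (Real.sqrt_nonneg _)]
      have : (√(2*s'))⁻¹ ≤ (√s)⁻¹ := inv_anti₀ h00 h0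
      nlinarith [norm_nonneg z]
    have h3 := mul_le_mul_of_nonneg_left h2 hC1'
    have h4 := mul_le_mul_of_nonneg_left (h1.trans h3) (ga_pos z).le
    rw [Real.norm_eq_abs] at h4
    refine h4.trans (le_of_eq (by ring))
  · have hs'' : 0 < s' := by have : s/2 < s' := hs'
                             linarith
    refine HasDerivAt.const_mul _ ?_
    have h1 : HasDerivAt (fun s : ℝ => √(2*s)) ((√(2*s'))⁻¹) s' := by
      have := ((hasDerivAt_id s').const_mul 2).sqrt (by simp; exact hs''.ne')
      refine this.congr_deriv ?_
      simp; ring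
    have h2 : HasDerivAt (fun s : ℝ => (y.1 + √(2*s) • z, y.2 + s)) ((√(2*s'))⁻¹ • z, 1) s' :=
      ((h1.smul_const z).const_add y.1).prodMk (by simpa using (hasDerivAt_id s').const_add y.2)
    exact ((hf.sm.differentiable (by simp)) _).hasFDerivAt.comp_hasDerivAt s' h2
end
end CU

namespace CU
open Set MeasureTheory Filter Topology
open scoped ContDiff
section
variable {Y : Type*} [NormedAddCommGroup Y] [NormedSpace ℝ Y] [MeasurableSpace Y] [BorelSpace Y] [FiniteDimensional ℝ Y]

structure Moll (ν : Measure Y) (ε : ℝ) (φ : Y → ℝ) : Prop where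
  nn : ∀ a, 0 ≤ φ a
  sm : ContDiff ℝ ∞ φ
  cs : HasCompactSupport φ
  one : ∫ a, φ a ∂ν = 1
  supp : ∀ a, ε ≤ ‖a‖ → φ a = 0

lemma exists_moll (ν : Measure Y) [ν.IsAddHaarMeasure] {ε : ℝ} (hε : 0 < ε) : ∃ φ : Y → ℝ, Moll ν ε φ := by
  let b : ContDiffBump (0 : Y) := ⟨ε/2, ε, by linarith, by linarith⟩
  refine ⟨b.normed ν, fun a => b.nonneg_normed a, b.contDiff_normed, b.hasCompactSupport_normed, b.integral_normed, fun a ha => ?_⟩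
  have : a ∉ Function.support (b.normed ν) := by
    rw [b.support_normed_eq]; simpa [b] using ha
  simpa using this

noncomputable def mo (ν : Measure Y) (φ w : Y → ℝ) (y : Y) : ℝ := ∫ a, φ a * w (y - a) ∂ν

variable {ν : Measure Y} [ν.IsAddHaarMeasure] {ε : ℝ} {φ w : Y → ℝ}

lemma Moll.int (hφ : Moll ν ε φ) : Integrable φ ν := hφ.sm.continuous.integrable_of_hasCompactSupport hφ.cs

lemma Moll.intm (hφ : Moll ν ε φ) {g : Y → ℝ} (hg : Continuous g) : Integrable (fun a => φ a * g a) ν :=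
  (hφ.sm.continuous.mul hg).integrable_of_hasCompactSupport hφ.cs.mul_right

lemma Moll.smooth (hφ : Moll ν ε φ) (hw : Continuous w) : ContDiff ℝ ∞ (mo ν φ w) := by
  have := hφ.cs.contDiff_convolution_left (ContinuousLinearMap.mul ℝ ℝ) hφ.sm (hw.locallyIntegrable (μ := ν))
  exact this

lemma Moll.close (hφ : Moll ν ε φ) (hw : Continuous w) {y : Y} {c δ : ℝ} (h : ∀ z, ‖z - y‖ < ε → |w z - c| ≤ δ) :
    |mo ν φ w y - c| ≤ δ := by
  have e : mo ν φ w y - c = ∫ a, φ a * (w (y - a) - c) ∂ν := by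
    simp only [mul_sub]
    rw [integral_sub (hφ.intm (by fun_prop)) (hφ.int.mul_const c), integral_mul_const, hφ.one, one_mul, mo]
  rw [e]
  calc |∫ a, φ a * (w (y - a) - c) ∂ν| ≤ ∫ a, |φ a * (w (y - a) - c)| ∂ν := abs_integral_le_integral_abs
    _ ≤ ∫ a, φ a * δ ∂ν := by
      refine integral_mono (hφ.intm (g := fun a => w (y-a) - c) (by fun_prop)).abs (hφ.int.mul_const δ) fun a => ?_
      simp only [abs_mul, abs_of_nonneg (hφ.nn a)]
      by_cases ha : ε ≤ ‖a‖
      · rw [hφ.supp a ha]; simp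
      · refine mul_le_mul_of_nonneg_left (h _ ?_) (hφ.nn a)
        push Not at ha
        simpa using ha
    _ = δ := by rw [integral_mul_const, hφ.one, one_mul]

lemma Moll.zero (hφ : Moll ν ε φ) {y : Y} (h : ∀ z, ‖z - y‖ < ε → w z = 0) : mo ν φ w y = 0 := by
  rw [mo, ← integral_zero (α := Y) (G := ℝ) (μ := ν)]
  congr 1
  ext a
  by_cases ha : ε ≤ ‖a‖
  · rw [hφ.supp a ha]; simp
  · rw [h (y - a) (by push Not at ha; simpa using ha), mul_zero]

lemma Moll.mono (hφ : Moll ν ε φ) {v : Y → ℝ} (hw : Continuous w) (hv : Continuous v) (h : ∀ z, w z ≤ v z) (y : Y) :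
    mo ν φ w y ≤ mo ν φ v y :=
  integral_mono (hφ.intm (by fun_prop)) (hφ.intm (by fun_prop)) fun a => mul_le_mul_of_nonneg_left (h _) (hφ.nn a)

lemma Moll.deriv (hφ : Moll ν ε φ) {a : Y} {g : Y → ℝ} (hw : Continuous w) (hg : Continuous g) {C : ℝ} (hC : ∀ y, |g y| ≤ C)
    (hd : ∀ y, HasDerivAt (fun h : ℝ => w (y + h • a)) (g y) 0) (y : Y) : d a (mo ν φ w) y = mo ν φ g y := by
  have hd' : ∀ y, ∀ h : ℝ, HasDerivAt (fun h : ℝ => w (y + h • a)) (g (y + h • a)) h := fun y h => by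
    have h1 := hd (y + h • a)
    have h2 : HasDerivAt (fun k : ℝ => k - h) 1 h := by simpa using (hasDerivAt_id h).sub_const h
    have h3 : HasDerivAt (fun h' : ℝ => w (y + h • a + h' • a)) (g (y + h • a)) (h - h) := by simpa using h1
    have := HasDerivAt.comp (h₂ := fun h' : ℝ => w (y + h • a + h' • a)) (h := fun k : ℝ => k - h) h h3 h2
    rw [mul_one] at this
    refine this.congr_of_eventuallyEq (Eventually.of_forall fun k => ?_)
    simp only [Function.comp]
    congr 1; rw [add_assoc, ← add_smul]; congr 2; ring
  have key : HasDerivAt (fun h : ℝ => mo ν φ w (y + h • a)) (mo ν φ g (y + (0:ℝ) • a)) 0 := by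
    refine (hasDerivAt_integral_of_dominated_loc_of_deriv_le (bound := fun z => φ z * C) (s := univ) univ_mem
      (Eventually.of_forall fun h => (hφ.intm (by fun_prop)).aestronglyMeasurable)
      (hφ.intm (by fun_prop))
      (F' := fun h z => φ z * g (y + h • a - z))
      ((hφ.intm (by fun_prop)).aestronglyMeasurable)
      (Eventually.of_forall fun z h _ => ?_)
      (hφ.int.mul_const _) (Eventually.of_forall fun z h _ => ?_)).2
    · rw [Real.norm_eq_abs, abs_mul, abs_of_nonneg (hφ.nn z)]
      exact mul_le_mul_of_nonneg_left (hC _) (hφ.nn z)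
    · refine HasDerivAt.const_mul _ ?_
      have := hd' (y - z) h
      have e : ∀ h : ℝ, y + h • a - z = y - z + h • a := fun h => by abel
      simpa only [e] using this
  have h1 : HasDerivAt (fun h : ℝ => y + h • a) a 0 := by
    simpa using ((hasDerivAt_id (0:ℝ)).smul_const a).const_add y
  have h2 : HasFDerivAt (mo ν φ w) (fderiv ℝ (mo ν φ w) y) (y + (0:ℝ) • a) := by
    simpa using ((hφ.smooth hw).differentiable (by simp) y).hasFDerivAt
  have h3 := h2.comp_hasDerivAt 0 h1
  have := h3.unique key
  simpa [d] using this

lemma Moll.csupp (hφ : Moll ν ε φ) (hc : HasCompactSupport w) : HasCompactSupport (mo ν φ w) := by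
  have := hφ.cs.convolution (ContinuousLinearMap.mul ℝ ℝ) hc (μ := ν)
  exact this

lemma smooth_approx (ν : Measure Y) [ν.IsAddHaarMeasure] (hw : Continuous w) (hc : HasCompactSupport w) {δ : ℝ} (hδ : 0 < δ) :
    ∃ v : Y → ℝ, ContDiff ℝ ∞ v ∧ HasCompactSupport v ∧ ∀ y, |v y - w y| ≤ δ := by
  have huc := hc.uniformContinuous_of_continuous hw
  rw [Metric.uniformContinuous_iff] at huc
  obtain ⟨ε, hε, h⟩ := huc δ hδ
  obtain ⟨φ, hφ⟩ := exists_moll ν hε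
  refine ⟨mo ν φ w, hφ.smooth hw, hφ.csupp hc, fun y => hφ.close hw fun z hz => ?_⟩
  have := h (a := z) (b := y) (by rwa [dist_eq_norm])
  rw [Real.dist_eq] at this
  exact this.le
end
end CU

namespace CU
open Set MeasureTheory Filter Topology
open scoped ContDiff
section
variable {n : ℕ}
local notation "E" => EuclideanSpace ℝ (Fin n)

lemma min_pr {D : EuclideanSpace ℝ (Fin n) → ℝ → ℝ} {a b R : ℝ} (hc : Continuous (fun p : E × ℝ => D p.1 p.2))
    (hb : ∀ x, 0 ≤ D x b) (hR : ∀ x t, t ∈ Icc a b → R < ‖x‖ → 0 ≤ D x t)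
    (hd : ∀ x, ∀ t ∈ Ico a b, ∃ p : ℝ, ∃ q : Fin n → ℝ, HasDerivAt (D x) p t ∧
      (∀ i, HasD2 (fun h => D (x + h • EuclideanSpace.single i 1) t) (q i)) ∧ p + ∑ i, q i < 0) :
    ∀ x, ∀ t ∈ Icc a b, 0 ≤ D x t := by
  intro x t ht
  by_contra! hneg
  have hcomp : IsCompact (Metric.closedBall (0:E) R ×ˢ Icc a b) := (isCompact_closedBall _ _).prod isCompact_Icc
  have hxR : ‖x‖ ≤ R := by
    by_contra! h; linarith [hR x t ht h]
  obtain ⟨⟨x1, t1⟩, ⟨h1, h2⟩, hmin⟩ := hcomp.exists_isMinOn ⟨(x, t), by simpa using hxR, ht⟩ hc.continuousOn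
  have hm : ∀ x' t', t' ∈ Icc a b → D x1 t1 ≤ D x' t' := fun x' t' ht' => by
    have h0 : D x1 t1 ≤ D x t := hmin (show (x, t) ∈ _ from ⟨by simpa using hxR, ht⟩)
    by_cases h : ‖x'‖ ≤ R
    · exact hmin (show (x', t') ∈ _ from ⟨by simpa using h, ht'⟩)
    · push Not at h
      linarith [hR x' t' ht' h]
  have hneg1 : D x1 t1 < 0 := lt_of_le_of_lt (hm x t ht) hneg
  simp only at h2
  have ht1 : t1 < b := lt_of_le_of_ne h2.2 fun h => by
    rw [h] at hneg1; linarith [hb x1]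
  obtain ⟨p, q, hp, hq, hs⟩ := hd x1 t1 ⟨h2.1, ht1⟩
  have hq0 : ∀ i, 0 ≤ q i := fun i => (hq i).nonneg (Eventually.of_forall fun h => by
    simpa using hm _ t1 h2)
  have hp0 : -p ≤ 0 := right_deriv_le hp.neg ht1 fun s hs => by
    simpa using hm x1 s ⟨h2.1.trans hs.1, hs.2⟩
  have := Finset.sum_nonneg (s := Finset.univ) fun i _ => hq0 i
  linarith

lemma min_pr2 {D : EuclideanSpace ℝ (Fin n) → ℝ → ℝ} {a b R τ : ℝ} (hc : Continuous (fun p : E × ℝ => D p.1 p.2))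
    (hb : ∀ x, 0 ≤ D x b) (hR : ∀ x t, t ∈ Icc a b → R < ‖x‖ → 0 ≤ D x t)
    (hd : ∀ x, ∀ t ∈ Ico a b, t ≠ τ → ∃ p : ℝ, ∃ q : Fin n → ℝ, HasDerivAt (D x) p t ∧
      (∀ i, HasD2 (fun h => D (x + h • EuclideanSpace.single i 1) t) (q i)) ∧ p + ∑ i, q i < 0) :
    ∀ x, ∀ t ∈ Icc a b, 0 ≤ D x t := by
  by_cases hτ : τ ∈ Ico a b
  · have h1 : ∀ x t, t ∈ Ioc τ b → 0 ≤ D x t := fun x t ht =>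
      min_pr hc hb (a := t) (R := R) (fun x s hs => hR x s ⟨hτ.1.trans (ht.1.le.trans hs.1), hs.2⟩)
        (fun x s hs => hd x s ⟨hτ.1.trans (ht.1.le.trans hs.1), hs.2⟩ (ht.1.trans_le hs.1).ne') x t ⟨le_rfl, ht.2⟩
    have h2 : ∀ x, 0 ≤ D x τ := fun x => by
      have hcx : Continuous (D x) := hc.comp (Continuous.prodMk_right x)
      have : Tendsto (D x) (𝓝[>] τ) (𝓝 (D x τ)) := hcx.continuousAt.tendsto.mono_left nhdsWithin_le_nhds
      refine ge_of_tendsto this ?_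
      filter_upwards [Ioc_mem_nhdsGT hτ.2] with t ht using h1 x t ht
    have h3 := min_pr hc h2 (a := a) (R := R) (fun x s hs => hR x s ⟨hs.1, hs.2.trans hτ.2.le⟩)
      (fun x s hs => hd x s ⟨hs.1, hs.2.trans hτ.2⟩ hs.2.ne)
    intro x t ht
    by_cases h : t ≤ τ
    · exact h3 x t ⟨ht.1, h⟩
    · exact h1 x t ⟨not_le.1 h, ht.2⟩
  · exact min_pr hc hb hR fun x t ht => hd x t ht fun h => hτ (h ▸ ht)

def PW (w Kc : YY n → ℝ) (τ : ℝ) : Prop :=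
  ∀ x : EuclideanSpace ℝ (Fin n), ∀ t : ℝ, t ≠ τ → ∃ p : ℝ, ∃ q : Fin n → ℝ, HasDerivAt (fun s => w (x, s)) p t ∧
      (∀ i, HasD2 (fun h => w (x + h • EuclideanSpace.single i 1, t)) (q i)) ∧ |p + ∑ i, q i| ≤ Kc (x, t)

lemma PW.neg {w Kc : YY n → ℝ} {τ : ℝ} (h : PW w Kc τ) : PW (fun y => - w y) Kc τ := fun x t ht => by
  obtain ⟨p, q, h1, h2, h3⟩ := h x t ht
  refine ⟨-p, fun i => -1 * q i, h1.neg, fun i => ((h2 i).cmul (-1)).congr (Eventually.of_forall fun _ => by simp), ?_⟩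
  rw [← Finset.mul_sum, ← abs_neg]
  convert h3 using 2; ring

lemma nice_of_cs {f : YY n → ℝ} (hf : ContDiff ℝ ∞ f) (hc : HasCompactSupport f) : Nice f := by
  refine ⟨hf, ?_, ?_, ?_⟩
  · obtain ⟨R, hR⟩ := hc.isCompact.isBounded.subset_closedBall (0 : YY n)
    refine ⟨R, fun y hy => ?_⟩
    by_contra h
    have h2 := hR (subset_tsupport f h)
    rw [mem_closedBall_zero_iff] at h2
    have h3 : ‖y.1‖ ≤ ‖y‖ := norm_fst_le y
    linarith
  · obtain ⟨C, hC⟩ := hc.exists_bound_of_continuous hf.continuous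
    exact ⟨C, hC⟩
  · obtain ⟨C, hC⟩ := (hc.fderiv (𝕜 := ℝ)).exists_bound_of_continuous (hf.continuous_fderiv (by simp))
    exact ⟨C, hC⟩

lemma fd_fst {v : EuclideanSpace ℝ (Fin n) → ℝ} (hv : ContDiff ℝ ∞ v) (y : YY n) :
    fderiv ℝ (fun y : YY n => v y.1) y = (fderiv ℝ v y.1).comp (ContinuousLinearMap.fst ℝ E ℝ) := by
  have h1 : HasFDerivAt v (fderiv ℝ v y.1) y.1 := (hv.differentiable (by simp) y.1).hasFDerivAt
  exact (h1.comp y hasFDerivAt_fst).fderiv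

lemma nice_fst {v : EuclideanSpace ℝ (Fin n) → ℝ} (hv : ContDiff ℝ ∞ v) (hc : HasCompactSupport v) : Nice (fun y : YY n => v y.1) := by
  refine ⟨hv.comp contDiff_fst, ?_, ?_, ?_⟩
  · obtain ⟨R, hR⟩ := hc.isCompact.isBounded.subset_closedBall (0 : E)
    refine ⟨R, fun y hy => ?_⟩
    by_contra h
    have h2 := hR (subset_tsupport v h)
    rw [mem_closedBall_zero_iff] at h2
    linarith
  · obtain ⟨C, hC⟩ := hc.exists_bound_of_continuous hv.continuous
    exact ⟨C, fun y => hC y.1⟩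
  · obtain ⟨C, hC⟩ := (hc.fderiv (𝕜 := ℝ)).exists_bound_of_continuous (hv.continuous_fderiv (by simp))
    refine ⟨C, fun y => ?_⟩
    rw [fd_fst hv]
    refine (ContinuousLinearMap.opNorm_comp_le _ _).trans ?_
    have : ‖ContinuousLinearMap.fst ℝ E ℝ‖ ≤ 1 := ContinuousLinearMap.norm_fst_le ..
    calc _ ≤ ‖fderiv ℝ v y.1‖ * 1 := by gcongr
      _ ≤ C := by rw [mul_one]; exact hC _

lemma d_ev_fst {v : EuclideanSpace ℝ (Fin n) → ℝ} (hv : ContDiff ℝ ∞ v) (i : Fin n) :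
    d (ev i) (fun y : YY n => v y.1) = fun y : YY n => d (EuclideanSpace.single i 1) v y.1 := by
  ext y; simp [d, fd_fst hv, ev]

lemma d_et_fst {v : EuclideanSpace ℝ (Fin n) → ℝ} (hv : ContDiff ℝ ∞ v) :
    d et (fun y : YY n => v y.1) = fun _ => 0 := by
  ext y; simp [d, fd_fst hv, et]

lemma SG_D2 {f : YY n → ℝ} (hf : Nice f) (i : Fin n) (hf' : Nice (d (ev i) f)) (x : E) (t s : ℝ) :
    HasD2 (fun h => SG f (x + h • EuclideanSpace.single i 1, t) s) (SG (d (ev i) (d (ev i) f)) (x, t) s) := by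
  have e : ∀ h : ℝ, ((x + h • EuclideanSpace.single i 1, t) : YY n) = (x, t) + h • ev i := fun h => by simp [ev]
  refine ⟨fun h => SG (d (ev i) f) ((x, t) + h • ev i) s, Eventually.of_forall fun h => ?_, ?_⟩
  · simp only [e]; exact SG_dx hf (x, t) (ev i) s h
  · simpa using SG_dx hf' (x, t) (ev i) s 0

lemma SG_sum {f : Fin n → YY n → ℝ} (hf : ∀ i, Nice (f i)) (y : YY n) (s : ℝ) :
    SG (fun y => ∑ i, f i y) y s = ∑ i, SG (f i) y s := by
  simp only [SG, Finset.mul_sum]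
  rw [integral_finsetSum]
  intro i _
  obtain ⟨C, hC⟩ := (hf i).b0
  have := (hf i).sm.continuous
  exact ga_bd_int (by fun_prop) (fun z => hC _)
end
end CU

namespace CU
open Set MeasureTheory Filter Topology
open scoped ContDiff
section
variable {n : ℕ}
local notation "E" => EuclideanSpace ℝ (Fin n)

lemma Kc_quad {Kc : YY n → ℝ} (hK : Continuous Kc) (hc : HasCompactSupport Kc) {δ : ℝ} (hδ : 0 < δ) :
    ∃ C : ℝ, 0 ≤ C ∧ ∃ s0 : ℝ, 0 < s0 ∧ ∀ x x0 : E, ∀ t α : ℝ, |t - α| ≤ s0 → Kc (x, t) ≤ Kc (x0, α) + δ + C * ‖x - x0‖^2 := by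
  obtain ⟨B, hB⟩ := hc.exists_bound_of_continuous hK
  have hB0 : 0 ≤ B := (norm_nonneg _).trans (hB 0)
  have huc := hc.uniformContinuous_of_continuous hK
  rw [Metric.uniformContinuous_iff] at huc
  obtain ⟨r, hr, h⟩ := huc δ hδ
  refine ⟨2*B/r^2, by positivity, r/2, by positivity, fun x x0 t α ht => ?_⟩
  by_cases hx : ‖x - x0‖ < r
  · have h1 := h (a := (x,t)) (b := (x0, α)) (by
      rw [dist_eq_norm]
      refine max_lt hx ?_
      change |t - α| < r; linarith)
    rw [Real.dist_eq] at h1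
    have := (abs_lt.1 h1).2
    have : 0 ≤ 2*B/r^2 * ‖x - x0‖^2 := by positivity
    linarith
  · push Not at hx
    have h1 := (abs_le.1 (hB (x,t))).2
    have h2 := (abs_le.1 (hB (x0,α))).1
    have h3 : 2 * B ≤ 2*B/r^2 * ‖x - x0‖^2 := by
      rw [div_mul_eq_mul_div, le_div_iff₀ (by positivity)]
      gcongr
    linarith

lemma D2_normsq (x x0 : E) (i : Fin n) : HasD2 (fun h : ℝ => ‖x + h • EuclideanSpace.single i 1 - x0‖^2) 2 := by
  refine ((HasD2.quad (‖x - x0‖^2) (2 * inner ℝ (x - x0) (EuclideanSpace.single i 1)) 1).congr (Eventually.of_forall fun h => ?_)).congr (Eventually.of_forall fun h => rfl) |> fun h => by simpa using h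
  simp only
  rw [show x + h • EuclideanSpace.single i 1 - x0 = (x - x0) + h • EuclideanSpace.single i 1 by abel, norm_add_sq_real]
  rw [inner_smul_right, norm_smul]
  simp; ring

lemma compare {w Kc : YY n → ℝ} {τ : ℝ} (hw : Continuous w) (hwc : HasCompactSupport w)
    (hK : Continuous Kc) (hKc : HasCompactSupport Kc) (hpw : PW w Kc τ) {δ : ℝ} (hδ : 0 < δ) :
    ∃ s0 : ℝ, 0 < s0 ∧ ∀ y : YY n, ∀ s, 0 < s → s < s0 → SG w y s ≤ w y + s * (Kc y + δ) := by
  obtain ⟨C, hC, s1, hs1, hq⟩ := Kc_quad hK hKc (half_pos hδ)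
  refine ⟨min s1 (δ / (2 * (n * C + 1))), lt_min hs1 (by positivity), ?_⟩
  rintro ⟨x0, α⟩ s hs hss
  have hsa := hss.trans_le (min_le_left _ _)
  have hsb := hss.trans_le (min_le_right _ _)
  set β := α + s with hβ
  obtain ⟨Bw, hBw⟩ := hwc.exists_bound_of_continuous hw
  have main : ∀ ε : ℝ, 0 < ε → SG w (x0, α) s ≤ w (x0, α) + s * (Kc (x0,α) + δ/2) + n * C * s^2 + 2 * ε + ε * ((2*n+1)*s) := by
    intro ε hε
    have hwβ : Continuous (fun x : E => w (x, β)) := by fun_prop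
    have hwβc : HasCompactSupport (fun x : E => w (x, β)) := by
      refine HasCompactSupport.intro (hwc.isCompact.image continuous_fst) fun x hx => ?_
      by_contra h
      exact hx ⟨(x, β), subset_tsupport w h, rfl⟩
    obtain ⟨v, hv, hvc, hvw⟩ := smooth_approx (volume : Measure E) hwβ hwβc hε
    have hNf := nice_fst hv hvc
    set f : YY n → ℝ := fun y => v y.1 with hf
    have hdv : ∀ i, ContDiff ℝ ∞ (d (EuclideanSpace.single i (1:ℝ)) v) := fun i => d_contDiff hv
    have hdvc : ∀ i, HasCompactSupport (d (EuclideanSpace.single i (1:ℝ)) v) := fun i =>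
      (hvc.fderiv (𝕜 := ℝ)).comp_left (g := fun L : E →L[ℝ] ℝ => L (EuclideanSpace.single i 1)) (by simp)
    have hd1 : ∀ i, d (ev i) f = fun y : YY n => d (EuclideanSpace.single i 1) v y.1 := fun i => d_ev_fst hv i
    have hNd : ∀ i, Nice (d (ev i) f) := fun i => by rw [hd1]; exact nice_fst (hdv i) (hdvc i)
    have hNdd : ∀ i, Nice (d (ev i) (d (ev i) f)) := fun i => by
      rw [hd1, d_ev_fst (hdv i)]
      exact nice_fst (d_contDiff (hdv i)) 
        (((hdvc i).fderiv (𝕜 := ℝ)).comp_left (g := fun L : E →L[ℝ] ℝ => L (EuclideanSpace.single i 1)) (by simp))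
    have hLf : Lh f = fun y => ∑ i, d (ev i) (d (ev i) f) y := by
      ext y; simp only [Lh]; rw [d_et_fst hv]; simp
    obtain ⟨Bv, hBv⟩ := hNf.b0
    have hHb : ∀ y s, |SG f y s| ≤ Bv := fun y s => by
      calc |SG f y s| ≤ ∫ z : E, |ga z * f (y.1 + √(2*s) • z, y.2 + s)| := abs_integral_le_integral_abs
        _ ≤ ∫ z : E, ga z * Bv := by
          have := hNf.sm.continuous
          refine integral_mono (ga_bd_int (by fun_prop) (fun _ => hBv _)).abs (ga_int.mul_const _) fun z => ?_
          simp only [abs_mul, abs_of_pos (ga_pos z)]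
          exact mul_le_mul_of_nonneg_left (hBv _) (ga_pos z).le
        _ = Bv := by rw [integral_mul_const, ga_one, one_mul]
    have hHc := SG_cont hNf.sm.continuous hBv
    let D : E → ℝ → ℝ := fun x t => w (x,t) - SG f (x, 0) (β - t) + (β - t) * (Kc (x0,α) + δ/2 + C * ‖x - x0‖^2)
      + n * C * (β - t)^2 + ε + ε * (‖x - x0‖^2 + (2*n+1)*(β-t))
    have hD := min_pr2 (D := D) (a := α) (b := β) (τ := τ) (R := ‖x0‖ + (Bw + Bv)/ε + 1) ?_ ?_ ?_ ?_ x0 α ⟨le_rfl, by linarith⟩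
    · simp only [D, sub_self, norm_zero] at hD
      have e1 : β - α = s := by rw [hβ]; ring
      rw [e1] at hD
      have e2 : SG w (x0, α) s ≤ SG f (x0, 0) s + ε := by
        have h1 : SG f (x0,0) s + ε = ∫ z : E, ga z * (f (x0 + √(2*s) • z, 0 + s) + ε) := by
          have := hNf.sm.continuous
          simp only [mul_add, SG]
          rw [integral_add (ga_bd_int (by fun_prop) (fun _ => hBv _)) (ga_int.mul_const _), integral_mul_const, ga_one, one_mul]
        rw [h1]
        have := hNf.sm.continuous
        refine integral_mono (ga_bd_int (by fun_prop) (fun _ => hBw _)) ?_ fun z => ?_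
        · simp only [mul_add]
          exact (ga_bd_int (by fun_prop) (fun _ => hBv _)).add (ga_int.mul_const _)
        · refine mul_le_mul_of_nonneg_left ?_ (ga_pos z).le
          have := (abs_le.1 (hvw (x0 + √(2*s) • z))).1
          simp only [hf]; linarith
      linarith
    · have h1 : Continuous (fun p : E × ℝ => SG f (p.1, 0) (β - p.2)) :=
        hHc.comp (g := fun p : YY n × ℝ => SG f p.1 p.2) (f := fun p : E × ℝ => (((p.1, 0) : YY n), β - p.2)) (by fun_prop)
      have h2 : Continuous (fun p : E × ℝ => w (p.1, p.2)) := by fun_prop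
      simp only [D]
      fun_prop
    · intro x
      simp only [D, sub_self, SG_zero, hf]
      have := (abs_le.1 (hvw x)).2
      have : 0 ≤ ε * ‖x - x0‖^2 := by positivity
      simp only [zero_mul, mul_zero]
      nlinarith
    · intro x t ht hx
      have h1 := (abs_le.1 (hHb (x,0) (β - t))).2
      have h2 := (abs_le.1 (hBw (x,t))).1
      have h3 : (Bw + Bv)/ε + 1 ≤ ‖x - x0‖ := by
        have := norm_sub_norm_le x x0; linarith
      have hb : 0 ≤ (Bw + Bv)/ε := div_nonneg (add_nonneg ((norm_nonneg _).trans (hBw 0)) ((abs_nonneg _).trans (hBv 0))) hε.le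
      have h4 : (Bw + Bv)/ε ≤ ‖x - x0‖^2 := by nlinarith
      have h5 : Bw + Bv ≤ ε * ‖x - x0‖^2 := by
        rw [div_le_iff₀ hε] at h4; linarith
      have hbt : 0 ≤ β - t := by linarith [ht.2]
      have hk : |α - α| ≤ s1 := by simp [hs1.le]
      have hKn : 0 ≤ Kc (x0, α) := by
        by_cases hα : α = τ
        · have : ∀ᶠ t' in 𝓝[≠] τ, 0 ≤ Kc (x0, t') := by
            filter_upwards [self_mem_nhdsWithin] with t' ht'
            obtain ⟨p, q, -, -, h⟩ := hpw x0 t' ht'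
            exact (abs_nonneg _).trans h
          have hcc : Continuous (fun t' => Kc (x0, t')) := by fun_prop
          rw [hα]
          exact ge_of_tendsto (hcc.continuousAt.tendsto.mono_left nhdsWithin_le_nhds) this
        · obtain ⟨p, q, -, -, h⟩ := hpw x0 α hα
          exact (abs_nonneg _).trans h
      have a1 : 0 ≤ (β - t) * (Kc (x0,α) + δ/2 + C * ‖x - x0‖^2) := by positivity
      have a2 : 0 ≤ n * C * (β - t)^2 := by positivity
      have a3 : 0 ≤ ε * ((2*n+1)*(β-t)) := by positivity
      simp only [D]
      rw [mul_add ε]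
      have h2' : -Bw ≤ w (x, t) := h2
      linarith
    · intro x t ht htτ
      obtain ⟨p, q, hp, hq', hpq⟩ := hpw x t htτ
      have hbt : 0 < β - t := by linarith [ht.2]
      have hKt : Kc (x,t) ≤ Kc (x0, α) + δ/2 + C * ‖x - x0‖^2 := hq x x0 t α (by
        rw [abs_of_nonneg (by linarith [ht.1])]; linarith [ht.2])
      have ddt : HasDerivAt (fun t => β - t) (-1) t := by simpa using (hasDerivAt_id t).const_sub β
      have hS : HasDerivAt (fun t => SG f (x,0) (β - t)) (SG (Lh f) (x,0) (β - t) * (-1)) t :=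
        HasDerivAt.comp (h₂ := fun s => SG f (x,0) s) (h := fun t => β - t) t (SG_ds hNf (x,0) hbt) ddt
      refine ⟨_, fun i => q i - SG (d (ev i) (d (ev i) f)) (x,0) (β - t) + ((β - t) * C * 2 + ε * 2), 
        ((((hp.sub hS).add (ddt.mul_const (Kc (x0,α) + δ/2 + C * ‖x - x0‖^2))).add ((ddt.pow 2).const_mul (n*C))).add_const ε).add
          ((((ddt.const_mul (2*n+1 : ℝ)).const_add (‖x-x0‖^2)).const_mul ε)), fun i => ?_, ?_⟩
      · refine HasD2.congr (((hq' i).sub (SG_D2 hNf i (hNd i) x 0 (β - t))).add ((((D2_normsq x x0 i).cmul ((β - t) * C)).add ((D2_normsq x x0 i).cmul ε)).add (HasD2.quad ((β - t) * (Kc (x0,α) + δ/2) + n * C * (β - t)^2 + ε + ε * ((2*n+1)*(β-t))) 0 0)) |> fun h => by simpa using h) (Eventually.of_forall fun h => ?_)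
        simp only [D]; ring
      · have hsum : SG (Lh f) (x,0) (β - t) = ∑ i, SG (d (ev i) (d (ev i) f)) (x,0) (β - t) := by
          rw [hLf, SG_sum hNdd]
        rw [Finset.sum_add_distrib, Finset.sum_sub_distrib, ← hsum]
        simp only [Finset.sum_const, Finset.card_univ, Fintype.card_fin, nsmul_eq_mul]
        have := (abs_le.1 hpq).2
        push_cast
        ring_nf at *
        nlinarith
  have hlim : SG w (x0, α) s ≤ w (x0, α) + s * (Kc (x0,α) + δ/2) + n * C * s^2 := by
    refine le_of_forall_pos_le_add fun η hη => ?_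
    have hpos : 0 < 2 + (2*(n:ℝ)+1)*s := by positivity
    have := main (η / (2 + (2*n+1)*s)) (by positivity)
    have e : 2 * (η / (2 + (2*n+1)*s)) + η / (2 + (2*n+1)*s) * ((2*n+1)*s) = η := by field_simp
    linarith
  have h1 : s * (2 * (n * C + 1)) ≤ δ := by
    rw [lt_div_iff₀ (by positivity)] at hsb; exact hsb.le
  nlinarith
end
end CU

namespace CU
open Set MeasureTheory Filter Topology
open scoped ContDiff
section
variable {n : ℕ}
local notation "E" => EuclideanSpace ℝ (Fin n)

instance : (volume : Measure (YY n)).IsAddHaarMeasure :=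
  inferInstanceAs ((volume : Measure (EuclideanSpace ℝ (Fin n))).prod (volume : Measure ℝ)).IsAddHaarMeasure

lemma SG_mo {w φ : YY n → ℝ} {ε : ℝ} (hφ : Moll volume ε φ) (hw : Continuous w) (hwc : HasCompactSupport w) (y : YY n) (s : ℝ) :
    SG (mo volume φ w) y s = ∫ a, φ a * SG w (y - a) s := by
  obtain ⟨B, hB⟩ := hwc.exists_bound_of_continuous hw
  have hφc := hφ.sm.continuous
  have hgc : Continuous (fun z : E => ga z) := ga_cont
  simp only [SG, mo, ← integral_const_mul]
  rw [integral_integral_swap]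
  · congr 1; ext a; congr 1; ext z
    rw [mul_left_comm]
    congr 3
    ext1
    · simp only [Prod.fst_sub]; abel_nf
    · simp only [Prod.snd_sub]; ring
  · have h1 : Integrable (fun p : E × YY n => ga p.1 * φ p.2) (volume.prod volume) := ga_int.mul_prod hφ.int
    refine (h1.mul_const B).mono' ?_ (Eventually.of_forall fun p => ?_)
    · refine Continuous.aestronglyMeasurable ?_
      have e1 : Continuous fun p : E × YY n => ga p.1 := hgc.comp continuous_fst
      have e2 : Continuous fun p : E × YY n => φ p.2 := hφc.comp continuous_snd
      have e3 : Continuous fun p : E × YY n => w ((y.1 + √(2*s) • p.1, y.2 + s) - p.2) := by fun_prop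
      exact e1.mul (e2.mul e3)
    · simp only [Function.uncurry, Real.norm_eq_abs, abs_mul, abs_of_pos (ga_pos p.1), abs_of_nonneg (hφ.nn p.2)]
      rw [← mul_assoc]
      exact mul_le_mul_of_nonneg_left (hB _) (mul_nonneg (ga_pos _).le (hφ.nn _))

lemma moll_le {w Kc φ : YY n → ℝ} {τ ε : ℝ} (hφ : Moll volume ε φ) (hw : Continuous w) (hwc : HasCompactSupport w)
    (hK : Continuous Kc) (hKc : HasCompactSupport Kc) (hpw : PW w Kc τ) (y : YY n) :
    Lh (mo volume φ w) y ≤ mo volume φ Kc y := by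
  set W := mo volume φ w with hW
  have hWs : ContDiff ℝ ∞ W := hφ.smooth hw
  have hWc : HasCompactSupport W := hφ.csupp hwc
  have hN : Nice W := nice_of_cs hWs hWc
  have hLN : Continuous (Lh W) := by
    unfold Lh
    refine Continuous.add (continuous_finsetSum _ fun i _ => ?_) ?_
    · exact (d_contDiff (d_contDiff hWs)).continuous
    · exact (d_contDiff hWs).continuous
  have hLb : ∃ C, ∀ y, |Lh W y| ≤ C := by
    have hcs : HasCompactSupport (Lh W) := by
      refine HasCompactSupport.intro hWc.isCompact fun z hz => ?_
      have hz1 : ∀ a, z ∉ tsupport (d a W) := fun a h => hz (tsupport_fderiv_apply_subset ℝ a h)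
      have hz2 : ∀ a, d a (d a W) z = 0 := fun a => by
        by_contra h
        exact hz1 a (tsupport_fderiv_apply_subset ℝ a (subset_tsupport _ h))
      have hz3 : d et W z = 0 := by
        by_contra h
        exact hz1 et (subset_tsupport _ h)
      simp [Lh, hz2, hz3]
    obtain ⟨C, hC⟩ := hcs.exists_bound_of_continuous hLN
    exact ⟨C, hC⟩
  obtain ⟨C, hC⟩ := hLb
  obtain ⟨B, hB⟩ := hN.b0
  obtain ⟨Bw, hBw⟩ := hwc.exists_bound_of_continuous hw
  refine le_of_forall_pos_le_add fun δ hδ => ?_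
  obtain ⟨s0, hs0, hcmp⟩ := compare hw hwc hK hKc hpw hδ
  have h1 : ∀ s, 0 < s → s < s0 → SG W y s ≤ W y + s * (mo volume φ Kc y + δ) := fun s hs hss => by
    rw [hW, SG_mo hφ hw hwc]
    have hcS : Continuous fun a : YY n => SG w (y - a) s :=
      (SG_cont hw hBw).comp (g := fun p : YY n × ℝ => SG w p.1 p.2) (f := fun a : YY n => (y - a, s)) (by fun_prop)
    calc ∫ a, φ a * SG w (y - a) s ≤ ∫ a, φ a * (w (y - a) + s * (Kc (y - a) + δ)) := by
          refine integral_mono (hφ.intm hcS) (hφ.intm (by fun_prop)) fun a => ?_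
          exact mul_le_mul_of_nonneg_left (hcmp _ s hs hss) (hφ.nn a)
      _ = ∫ a, (φ a * w (y - a) + s * (φ a * Kc (y - a)) + s * δ * φ a) := by
          congr 1; ext a; ring
      _ = _ := by
          rw [integral_add, integral_add, integral_const_mul, integral_const_mul, hφ.one]
          · simp only [mo]; ring
          · exact hφ.intm (by fun_prop)
          · exact (hφ.intm (by fun_prop)).const_mul _
          · exact (hφ.intm (by fun_prop)).add ((hφ.intm (by fun_prop)).const_mul _)
          · exact hφ.int.const_mul _
  have hgc : Continuous fun s => SG W y s :=
    (SG_cont hN.sm.continuous hB).comp (g := fun p : YY n × ℝ => SG W p.1 p.2) (f := fun s : ℝ => (y, s)) (by fun_prop)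
  have hGc : Continuous fun s => SG (Lh W) y s :=
    (SG_cont hLN hC).comp (g := fun p : YY n × ℝ => SG (Lh W) p.1 p.2) (f := fun s : ℝ => (y, s)) (by fun_prop)
  by_contra! hlt
  have hev : ∀ᶠ s in 𝓝 (0:ℝ), mo volume φ Kc y + δ < SG (Lh W) y s := by
    refine hGc.continuousAt.eventually_const_lt ?_
    simpa only [SG_zero] using hlt
  obtain ⟨r, hr, hb⟩ := Metric.eventually_nhds_iff.1 hev
  set s := min (s0/2) (r/2) with hs
  have hs1 : 0 < s := lt_min (by linarith) (by linarith)
  have hs2 : s < s0 := (min_le_left _ _).trans_lt (by linarith)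
  have hs3 : s < r := (min_le_right _ _).trans_lt (by linarith)
  obtain ⟨c, hc, hce⟩ := exists_hasDerivAt_eq_slope (fun s => SG W y s) (fun s => SG (Lh W) y s) hs1 hgc.continuousOn
    (fun s hs => SG_ds hN y hs.1)
  have h2 := hb (y := c) (by rw [Real.dist_eq, sub_zero, abs_of_pos hc.1]; linarith [hc.2])
  rw [hce, SG_zero, sub_zero, lt_div_iff₀ hs1] at h2
  linarith [h1 s hs1 hs2]

lemma moll_abs {w Kc φ : YY n → ℝ} {τ ε : ℝ} (hφ : Moll volume ε φ) (hw : Continuous w) (hwc : HasCompactSupport w)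
    (hK : Continuous Kc) (hKc : HasCompactSupport Kc) (hpw : PW w Kc τ) (y : YY n) :
    |Lh (mo volume φ w) y| ≤ mo volume φ Kc y := by
  rw [abs_le]
  refine ⟨?_, moll_le hφ hw hwc hK hKc hpw y⟩
  have h := moll_le hφ hw.neg (w := fun y => -w y) hwc.neg hK hKc hpw.neg y
  have e : mo volume φ (fun y => -w y) = fun y => - mo volume φ w y := by
    ext y; simp [mo, integral_neg]
  have e2 : ∀ (a : YY n) (f : YY n → ℝ), d a (fun y => - f y) = fun y => - d a f y := fun a f => by
    ext y; simp [d]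
  have e3 : Lh (fun y => - mo volume φ w y) y = - Lh (mo volume φ w) y := by
    simp only [Lh, e2, Finset.sum_neg_distrib]; ring
  rw [e, e3] at h
  linarith
end
end CU

namespace CU
open Set MeasureTheory Filter Topology
open scoped ContDiff Manifold
section
variable {n : ℕ}
local notation "E" => EuclideanSpace ℝ (Fin n)

lemma exists_cutoff {Y : Type*} [NormedAddCommGroup Y] [NormedSpace ℝ Y] [FiniteDimensional ℝ Y] {K U : Set Y} (hK : IsCompact K) (hU : IsOpen U) (hKU : K ⊆ U) :
    ∃ ζ : Y → ℝ, ContDiff ℝ ∞ ζ ∧ HasCompactSupport ζ ∧ tsupport ζ ⊆ U ∧ (∀ y, 0 ≤ ζ y ∧ ζ y ≤ 1) ∧ ∀ᶠ y in 𝓝ˢ K, ζ y = 1 := by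
  obtain ⟨K', hK', h1, h2⟩ := exists_compact_between hK hU hKU
  obtain ⟨f, hf1, hf2, hf3⟩ := exists_contMDiffMap_one_nhds_of_subset_interior (n := (⊤ : ℕ∞)) (𝓘(ℝ, Y)) hK.isClosed h1
  have hs : tsupport (f : Y → ℝ) ⊆ K' := closure_minimal (fun y hy => by
    by_contra h; exact hy (hf2 y h)) hK'.isClosed
  exact ⟨f, f.contMDiff.contDiff, HasCompactSupport.of_support_subset_isCompact hK' ((subset_tsupport _).trans hs), hs.trans h2,
    fun y => hf3 y, hf1⟩

lemma HasD2.mul {φ ψ : ℝ → ℝ} {q r a b : ℝ} (h1 : HasD2 φ q) (h2 : HasD2 ψ r) (ha : HasDerivAt φ a 0) (hb : HasDerivAt ψ b 0) :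
    HasD2 (fun h => φ h * ψ h) (q * ψ 0 + 2 * (a * b) + φ 0 * r) := by
  obtain ⟨φ', a1, b1⟩ := h1
  obtain ⟨ψ', a2, b2⟩ := h2
  refine ⟨fun h => φ' h * ψ h + φ h * ψ' h, by filter_upwards [a1, a2] with h u v using u.mul v, ?_⟩
  have e1 : φ' 0 = a := a1.self_of_nhds.unique ha
  have e2 : ψ' 0 = b := a2.self_of_nhds.unique hb
  refine ((b1.mul hb).add (ha.mul b2)).congr_deriv ?_
  simp only [e1, e2]; ring

lemma line_d {f : YY n → ℝ} (hf : ContDiff ℝ ∞ f) (y a : YY n) (h : ℝ) :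
    HasDerivAt (fun h : ℝ => f (y + h • a)) (d a f (y + h • a)) h := by
  have hl : HasDerivAt (fun h : ℝ => y + h • a) a h := by
    simpa using ((hasDerivAt_id h).smul_const a).const_add y
  exact (hf.differentiable (by simp) _).hasFDerivAt.comp_hasDerivAt h hl

lemma eev (x : E) (t h : ℝ) (i : Fin n) : ((x + h • EuclideanSpace.single i 1, t) : YY n) = (x, t) + h • ev i := by simp [ev]

lemma line_D2 {f : YY n → ℝ} (hf : ContDiff ℝ ∞ f) (x : E) (t : ℝ) (i : Fin n) :
    HasD2 (fun h : ℝ => f (x + h • EuclideanSpace.single i 1, t)) (d (ev i) (d (ev i) f) (x, t)) := by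
  simp only [eev]
  refine ⟨_, Eventually.of_forall fun h => line_d hf _ _ _, ?_⟩
  simpa using line_d (d_contDiff hf) (x, t) (ev i) 0

lemma line_t {f : YY n → ℝ} (hf : ContDiff ℝ ∞ f) (x : E) (t : ℝ) :
    HasDerivAt (fun s : ℝ => f (x, s)) (d et f (x, t)) t := by
  have := line_d hf (x, 0) et t
  simpa [et] using this

lemma cont_glue {f ζ : YY n → ℝ} {U : Set (YY n)} (hU : IsOpen U) (hs : tsupport ζ ⊆ U) (hf : ContinuousOn f U)
    (h0 : ∀ y, y ∉ tsupport ζ → f y = 0) : Continuous f := by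
  rw [continuous_iff_continuousAt]
  intro y
  by_cases hy : y ∈ U
  · exact hf.continuousAt (hU.mem_nhds hy)
  · have : f =ᶠ[𝓝 y] fun _ => 0 := by
      filter_upwards [(isClosed_tsupport ζ).isOpen_compl.mem_nhds (fun h => hy (hs h))] with z hz using h0 z hz
    exact continuousAt_const.congr this.symm

variable {Ω : Set (EuclideanSpace ℝ (Fin n))} {τ T M : ℝ} {u : EuclideanSpace ℝ (Fin n) → ℝ → ℝ}

lemma d_off {ζ : YY n → ℝ} {y : YY n} (hy : y ∉ tsupport ζ) (a : YY n) : d a ζ y = 0 := by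
  by_contra h
  exact hy (tsupport_fderiv_apply_subset ℝ a (subset_tsupport _ h))
lemma d_off2 {ζ : YY n → ℝ} {y : YY n} (hy : y ∉ tsupport ζ) (a b : YY n) : d b (d a ζ) y = 0 := 
  d_off (fun h => hy (tsupport_fderiv_apply_subset ℝ a h)) b
lemma Lh_off {ζ : YY n → ℝ} {y : YY n} (hy : y ∉ tsupport ζ) : Lh ζ y = 0 := by
  simp [Lh, d_off2 hy, d_off hy]

noncomputable def du (u : EuclideanSpace ℝ (Fin n) → ℝ → ℝ) (i : Fin n) (y : YY n) : ℝ :=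
  fderiv ℝ (fun z => u z y.2) y.1 (EuclideanSpace.single i 1)

noncomputable def Kf (M : ℝ) (u : EuclideanSpace ℝ (Fin n) → ℝ → ℝ) (ζ : YY n → ℝ) (y : YY n) : ℝ :=
  ζ y * (M * (|u y.1 y.2| + ‖fderiv ℝ (fun z => u z y.2) y.1‖)) + |u y.1 y.2| * |Lh ζ y| + 2 * |∑ i, d (ev i) ζ y * du u i y|

lemma Sol.pw (S : Sol Ω τ T M u) {ζ : YY n → ℝ} (hζ : ContDiff ℝ ∞ ζ) (hs : tsupport ζ ⊆ Ω ×ˢ Iio T) (h01 : ∀ y, 0 ≤ ζ y ∧ ζ y ≤ 1) :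
    PW (fun y => ζ y * u y.1 y.2) (Kf M u ζ) τ := by
  intro x t ht
  have hKn : 0 ≤ Kf M u ζ (x, t) := by
    have := (h01 (x,t)).1
    have := S.M0
    unfold Kf; positivity
  by_cases hA : x ∈ Ω ∧ t ∈ Ioo τ T
  · obtain ⟨hx, ht2⟩ := hA
    refine ⟨_, fun i => _, (line_t hζ x t).mul (S.ht x hx t ht2).hasDerivAt, fun i =>
      HasD2.mul (line_D2 hζ x t i) (HasD2.line (S.hx x hx t ht2) (EuclideanSpace.single i 1)) ?_ ?_ (a := d (ev i) ζ (x,t)) (b := du u i (x,t)), ?_⟩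
    · simp only [eev]; simpa using line_d hζ (x,t) (ev i) 0
    · have hl : HasDerivAt (fun h : ℝ => x + h • EuclideanSpace.single i 1) (EuclideanSpace.single i 1) 0 := by
        simpa using ((hasDerivAt_id (0:ℝ)).smul_const (EuclideanSpace.single i (1:ℝ))).const_add x
      have hd : HasFDerivAt (fun z => u z t) (fderiv ℝ (fun z => u z t) x) (x + (0:ℝ) • EuclideanSpace.single i 1) := by
        simpa using ((S.hx x hx t ht2).differentiableAt (by simp)).hasFDerivAt
      exact hd.comp_hasDerivAt 0 hl
    · have h := S.heq x hx t ht2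
      have e : d et ζ (x,t) * u x t + ζ (x,t) * deriv (u x) t + ∑ i, (d (ev i) (d (ev i) ζ) (x,t) * u (x + (0:ℝ) • EuclideanSpace.single i 1) t
          + 2 * (d (ev i) ζ (x,t) * du u i (x,t)) + ζ (x + (0:ℝ) • EuclideanSpace.single i 1, t) * iteratedFDeriv ℝ 2 (fun y => u y t) x ![EuclideanSpace.single i 1, EuclideanSpace.single i 1])
          = ζ (x,t) * heat u x t + u x t * Lh ζ (x,t) + 2 * ∑ i, d (ev i) ζ (x,t) * du u i (x,t) := by
        simp only [zero_smul, add_zero, Finset.sum_add_distrib, heat, lap, Lh, mul_add, ← Finset.mul_sum, ← Finset.sum_mul]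
        ring
      rw [e]
      refine (abs_add_le _ _).trans ?_
      unfold Kf
      have h1 : |2 * ∑ i, d (ev i) ζ (x,t) * du u i (x,t)| = 2 * |∑ i, d (ev i) ζ (x,t) * du u i (x,t)| := by
        rw [abs_mul, abs_of_pos (by norm_num : (0:ℝ) < 2)]
      rw [h1]
      have h2 := abs_add_le (ζ (x,t) * heat u x t) (u x t * Lh ζ (x,t))
      rw [abs_mul, abs_mul, abs_of_nonneg (h01 (x,t)).1] at h2
      have h3 := mul_le_mul_of_nonneg_left h (h01 (x,t)).1
      simp only
      linarith
  · have hev : ∀ᶠ y in 𝓝 ((x, t) : YY n), ζ y * u y.1 y.2 = 0 := by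
      by_cases hB : (x,t) ∈ tsupport ζ
      · have hB' := hs hB
        have htt : t < τ := by
          by_contra! h
          exact hA ⟨hB'.1, lt_of_le_of_ne h ht.symm, hB'.2⟩
        filter_upwards [(S.op.prod isOpen_Iio).mem_nhds (show ((x,t) : YY n) ∈ Ω ×ˢ Iio τ from ⟨hB'.1, htt⟩)] with y hy
        rw [S.zero _ hy.1 _ (le_of_lt hy.2), mul_zero]
      · filter_upwards [(isClosed_tsupport ζ).isOpen_compl.mem_nhds hB] with z hz
        rw [image_eq_zero_of_notMem_tsupport hz, zero_mul]
    refine ⟨0, fun _ => 0, ?_, fun i => ?_, by simpa using hKn⟩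
    · have hc : ContinuousAt (fun s : ℝ => ((x, s) : YY n)) t := by fun_prop
      exact (hasDerivAt_const t (0:ℝ)).congr_of_eventuallyEq (hc.eventually hev)
    · have hc : ContinuousAt (fun h : ℝ => ((x + h • EuclideanSpace.single i 1, t) : YY n)) 0 := by fun_prop
      have := HasD2.quad 0 0 0
      simp only [zero_mul, mul_zero, add_zero] at this
      refine this.congr (hc.eventually (p := fun y => ζ y * u y.1 y.2 = 0) ?_)
      simpa using hev
end
end CU

namespace CU
open Set MeasureTheory Filter Topology
open scoped ContDiff Manifold
section
variable {n : ℕ}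
local notation "E" => EuclideanSpace ℝ (Fin n)
variable {Ω : Set (EuclideanSpace ℝ (Fin n))} {τ T M : ℝ} {u : EuclideanSpace ℝ (Fin n) → ℝ → ℝ}

lemma Sol.fcont (S : Sol Ω τ T M u) : ContinuousOn (fun y : YY n => fderiv ℝ (fun z => u z y.2) y.1) (Ω ×ˢ Iio T) :=
  continuousOn_clm_apply.2 fun v => S.gcont v

lemma unif {f : YY n → ℝ} (hf : Continuous f) (hc : HasCompactSupport f) {δ : ℝ} (hδ : 0 < δ) :
    ∃ r > 0, ∀ z y : YY n, ‖z - y‖ < r → |f z - f y| ≤ δ := by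
  have huc := hc.uniformContinuous_of_continuous hf
  rw [Metric.uniformContinuous_iff] at huc
  obtain ⟨r, hr, h⟩ := huc δ hδ
  refine ⟨r, hr, fun z y hz => ?_⟩
  have := h (a := z) (b := y) (by rwa [dist_eq_norm])
  rw [Real.dist_eq] at this
  exact this.le

lemma Sol.approx (S : Sol Ω τ T M u) (hτ : 0 < τ) {K : Set (YY n)} (hK : IsCompact K) (hKU : K ⊆ Ω ×ˢ Iio T) {δ : ℝ} (hδ : 0 < δ) :
    ∃ v : YY n → ℝ, ContDiff ℝ ∞ v ∧ (∀ y, y.2 ≤ τ/2 → v y = 0) ∧ ∀ y ∈ K, |v y - u y.1 y.2| ≤ δ ∧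
      (∀ i, |d (ev i) v y - du u i y| ≤ δ) ∧ |Lh v y| ≤ M * (|u y.1 y.2| + ‖fderiv ℝ (fun z => u z y.2) y.1‖) + δ := by
  have hU : IsOpen (Ω ×ˢ Iio T) := S.op.prod isOpen_Iio
  obtain ⟨ζ, hζ, hζc, hζs, h01, hζ1⟩ := exists_cutoff hK hU hKU
  have hpw := S.pw hζ hζs h01
  set w : YY n → ℝ := fun y => ζ y * u y.1 y.2 with hw
  have hLζ : Continuous (Lh ζ) := by
    unfold Lh
    refine Continuous.add (continuous_finsetSum _ fun i _ => ?_) ?_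
    · exact (d_contDiff (d_contDiff hζ)).continuous
    · exact (d_contDiff hζ).continuous
  have hdζ : ∀ a, Continuous (d a ζ) := fun a => (d_contDiff hζ).continuous
  have hζcont := hζ.continuous
  have hduc : ∀ i, ContinuousOn (du u i) (Ω ×ˢ Iio T) := fun i => S.gcont _
  have hwc : Continuous w := cont_glue hU hζs (hζcont.continuousOn.mul S.cont) fun y hy => by
    simp [hw, image_eq_zero_of_notMem_tsupport hy]
  have hws : HasCompactSupport w := HasCompactSupport.intro hζc.isCompact fun y hy => by
    simp [hw, image_eq_zero_of_notMem_tsupport hy]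
  have hK0 : ∀ y, y ∉ tsupport ζ → Kf M u ζ y = 0 := fun y hy => by
    simp [Kf, image_eq_zero_of_notMem_tsupport hy, Lh_off hy, d_off hy]
  have hKc : Continuous (Kf M u ζ) := cont_glue hU hζs (by
    have h1 := S.cont
    have h2 := S.fcont
    have h1' : ContinuousOn (fun y : YY n => |u y.1 y.2|) (Ω ×ˢ Iio T) := h1.abs
    have h2' : ContinuousOn (fun y : YY n => ‖fderiv ℝ (fun z => u z y.2) y.1‖) (Ω ×ˢ Iio T) := h2.norm
    have h3 : ContinuousOn (fun y : YY n => |∑ i, d (ev i) ζ y * du u i y|) (Ω ×ˢ Iio T) :=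
      (continuousOn_finsetSum _ fun i _ => (hdζ _).continuousOn.mul (hduc i)).abs
    have h4 : ContinuousOn (fun y : YY n => |Lh ζ y|) (Ω ×ˢ Iio T) := hLζ.continuousOn.abs
    unfold Kf
    exact ((hζcont.continuousOn.mul ((h1'.add h2').const_smul M)).add (h1'.mul h4)).add (h3.const_smul (2:ℝ))) hK0
  have hKs : HasCompactSupport (Kf M u ζ) := HasCompactSupport.intro hζc.isCompact hK0
  let g : Fin n → YY n → ℝ := fun i y => d (ev i) ζ y * u y.1 y.2 + ζ y * du u i y
  have hg0 : ∀ i y, y ∉ tsupport ζ → g i y = 0 := fun i y hy => by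
    simp [g, image_eq_zero_of_notMem_tsupport hy, d_off hy]
  have hgc : ∀ i, Continuous (g i) := fun i => cont_glue hU hζs
    (((hdζ _).continuousOn.mul S.cont).add (hζcont.continuousOn.mul (hduc i))) (hg0 i)
  have hgs : ∀ i, HasCompactSupport (g i) := fun i => HasCompactSupport.intro hζc.isCompact (hg0 i)
  have hgd : ∀ i y, HasDerivAt (fun h : ℝ => w (y + h • ev i)) (g i y) 0 := fun i y => by
    by_cases hy : y ∈ tsupport ζ
    · obtain ⟨hx, ht⟩ := hζs hy
      have h1 := line_d hζ y (ev i) 0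
      have hl : HasDerivAt (fun h : ℝ => y.1 + h • EuclideanSpace.single i 1) (EuclideanSpace.single i 1) 0 := by
        simpa using ((hasDerivAt_id (0:ℝ)).smul_const (EuclideanSpace.single i (1:ℝ))).const_add y.1
      have hd : HasFDerivAt (fun z => u z y.2) (fderiv ℝ (fun z => u z y.2) y.1) (y.1 + (0:ℝ) • EuclideanSpace.single i 1) := by
        simpa using ((S.cd hx ht).differentiableAt (by simp)).hasFDerivAt
      have h2 := hd.comp_hasDerivAt 0 hl
      refine ((h1.mul h2).congr_deriv ?_).congr_of_eventuallyEq (Eventually.of_forall fun h => ?_)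
      · simp [g, du]
      · simp [hw, ev]
    · rw [hg0 i y hy]
      have hc : ContinuousAt (fun h : ℝ => y + h • ev i) 0 := by fun_prop
      refine (hasDerivAt_const 0 (0:ℝ)).congr_of_eventuallyEq ?_
      have : ∀ᶠ z in 𝓝 (y + (0:ℝ) • ev i), w z = 0 := by
        rw [zero_smul, add_zero]
        filter_upwards [(isClosed_tsupport ζ).isOpen_compl.mem_nhds hy] with z hz
        simp [hw, image_eq_zero_of_notMem_tsupport hz]
      exact hc.eventually this
  obtain ⟨r1, hr1, H1⟩ := unif hwc hws hδ
  obtain ⟨r2, hr2, H2⟩ := unif hKc hKs hδ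
  have H3 := fun i => unif (hgc i) (hgs i) hδ
  choose r3 hr3 H3 using H3
  have hex : ∃ ε > 0, ε ≤ r1 ∧ ε ≤ r2 ∧ (∀ i, ε ≤ r3 i) ∧ ε ≤ τ/2 := by
    have : ∀ᶠ ε in 𝓝[>] (0:ℝ), 0 < ε ∧ ε ≤ r1 ∧ ε ≤ r2 ∧ (∀ i, ε ≤ r3 i) ∧ ε ≤ τ/2 := by
      have key : ∀ c : ℝ, 0 < c → ∀ᶠ ε in 𝓝[>] (0:ℝ), ε ≤ c := fun c hc => by
        filter_upwards [Ioc_mem_nhdsGT hc] with x hx using hx.2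
      filter_upwards [self_mem_nhdsWithin, key r1 hr1, key r2 hr2, eventually_all.2 fun i => key _ (hr3 i), key (τ/2) (by linarith)] with ε a b c dd e
      exact ⟨a, b, c, dd, e⟩
    obtain ⟨ε, h⟩ := this.exists
    exact ⟨ε, h⟩
  obtain ⟨ε, hε, e1, e2, e3, e4⟩ := hex
  obtain ⟨φ, hφ⟩ := exists_moll (volume : Measure (YY n)) hε
  refine ⟨mo volume φ w, hφ.smooth hwc, fun y hy => hφ.zero fun z hz => ?_, fun y hy => ?_⟩
  · by_cases hzs : z ∈ tsupport ζ
    · have h1 : ‖(z - y).2‖ ≤ ‖z - y‖ := norm_snd_le _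
      rw [Prod.snd_sub, Real.norm_eq_abs] at h1
      have := (abs_le.1 h1).2
      simp only [hw]
      rw [S.zero _ (hζs hzs).1 _ (by linarith), mul_zero]
    · simp [hw, image_eq_zero_of_notMem_tsupport hzs]
  · have hy1 : ∀ᶠ z in 𝓝 y, ζ z = 1 := hζ1.filter_mono (nhds_le_nhdsSet hy)
    have hζy : ζ y = 1 := hy1.self_of_nhds
    have hdy : ∀ a, d a ζ =ᶠ[𝓝 y] fun _ => 0 := fun a => by
      filter_upwards [hy1.eventually_nhds] with z hz
      have : fderiv ℝ ζ z = fderiv ℝ (fun _ => (1:ℝ)) z := Filter.EventuallyEq.fderiv_eq hz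
      simp [d, this]
    have hddy : ∀ a b, d b (d a ζ) y = 0 := fun a b => by
      have : fderiv ℝ (d a ζ) y = fderiv ℝ (fun _ => (0:ℝ)) y := Filter.EventuallyEq.fderiv_eq (hdy a)
      simp [d, this]
    have hdy0 : ∀ a, d a ζ y = 0 := fun a => (hdy a).self_of_nhds
    have hLy : Lh ζ y = 0 := by simp [Lh, hddy, hdy0]
    refine ⟨?_, fun i => ?_, ?_⟩
    · have := hφ.close hwc (y := y) (c := w y) (δ := δ) fun z hz => H1 z y (hz.trans_le e1)
      simpa [hw, hζy] using this
    · obtain ⟨C, hC⟩ := (hgs i).exists_bound_of_continuous (hgc i)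
      rw [hφ.deriv hwc (hgc i) hC (hgd i)]
      have := hφ.close (hgc i) (y := y) (c := g i y) (δ := δ) fun z hz => H3 i z y (hz.trans_le (e3 i))
      simpa [g, hζy, hdy0] using this
    · refine (moll_abs hφ hwc hws hKc hKs hpw y).trans ?_
      have h := hφ.close hKc (y := y) (c := Kf M u ζ y) (δ := δ) fun z hz => H2 z y (hz.trans_le e2)
      have h2 := (abs_le.1 h).2
      have e : Kf M u ζ y = M * (|u y.1 y.2| + ‖fderiv ℝ (fun z => u z y.2) y.1‖) := by
        simp [Kf, hζy, hLy, hdy0]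
      linarith
end
end CU

namespace CU
open Set MeasureTheory Filter Topology
open scoped ContDiff
section
variable {n : ℕ}
local notation "E" => EuclideanSpace ℝ (Fin n)

lemma pw_bd (β : ℝ) (hβ : β ≤ 2) {ρ : ℝ} (hρ : 0 < ρ) : ∃ C : ℝ, 0 < C ∧ ∀ r : ℝ, ρ ≤ r → r ^ β ≤ C * Real.exp (r^2) := by
  refine ⟨1 + ρ ^ β, by positivity, fun r hr => ?_⟩
  have hr0 : 0 < r := hρ.trans_le hr
  have h1 : r^2 + 1 ≤ Real.exp (r^2) := Real.add_one_le_exp _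
  have hp : 0 < ρ ^ β := by positivity
  have hx : 1 ≤ Real.exp (r^2) := by nlinarith [sq_nonneg r]
  have key : r ^ β ≤ Real.exp (r^2) ∨ r ^ β ≤ ρ ^ β := by
    rcases le_total 1 r with h | h
    · left
      have := Real.rpow_le_rpow_of_exponent_le h hβ
      rw [Real.rpow_two] at this
      linarith
    · rcases le_total 0 β with h2 | h2
      · left
        have := Real.rpow_le_one hr0.le h h2
        linarith
      · right
        exact Real.rpow_le_rpow_of_nonpos hρ hr h2
  rcases key with h | h
  · nlinarith
  · nlinarith

lemma FF_bd (i0 : Fin n) (β : ℝ) (hβ : β ≤ 2) (p : Polynomial ℝ) {ρ : ℝ} (hρ : 0 < ρ) :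
    ∃ C : ℝ, 0 < C ∧ ∀ y : YY n, ρ ≤ ‖y.1‖ → |FF i0 β p y| ≤ C * Real.exp (‖y.1‖^2) := by
  obtain ⟨C, hC, h⟩ := pw_bd β hβ hρ
  obtain ⟨D, hD⟩ := (isCompact_Icc (a := (-1:ℝ)) (b := 1)).exists_bound_of_continuousOn (p.continuous.continuousOn (s := Icc (-1:ℝ) 1))
  have hD0 : 0 ≤ D := (norm_nonneg _).trans (hD 0 (by norm_num))
  refine ⟨C * (D + 1), by positivity, fun y hy => ?_⟩
  have hc := c_le_one (i0 := i0) y.1 (norm_pos_iff.1 (hρ.trans_le hy))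
  have h2 := hD (y.1 i0 / ‖y.1‖) (abs_le.1 hc)
  rw [Real.norm_eq_abs] at h2
  rw [FF, abs_mul, abs_of_nonneg (by positivity)]
  calc _ ≤ (C * Real.exp (‖y.1‖^2)) * (D + 1) := by
        apply mul_le_mul (h _ hy) (by linarith) (abs_nonneg _) (by positivity)
    _ = _ := by ring

lemma coord_le (x : E) (i : Fin n) : |x i| ≤ ‖x‖ := by
  simpa using PiLp.norm_apply_le x i

lemma le_exp_sq (r : ℝ) : r ≤ Real.exp (r^2) := by
  have := Real.add_one_le_exp (r^2)
  nlinarith [sq_nonneg (r-1)]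

lemma gF_bd (i0 i : Fin n) (β : ℝ) (hβ : β ≤ 2) (p : Polynomial ℝ) {ρ : ℝ} (hρ : 0 < ρ) :
    ∃ C : ℝ, 0 < C ∧ ∀ y : YY n, ρ ≤ ‖y.1‖ → |gF i0 β p i y| ≤ C * Real.exp (2*‖y.1‖^2) := by
  obtain ⟨C, hC, h⟩ := FF_bd i0 (β-2) (by linarith) (p1 β p) hρ
  obtain ⟨D, hD, h'⟩ := FF_bd i0 (β-1) (by linarith) p.derivative hρ
  refine ⟨C + D, by positivity, fun y hy => ?_⟩
  have h1 := h y hy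
  have h2 := h' y hy
  have h3 := (coord_le y.1 i).trans (le_exp_sq _)
  have h4 : |dl i0 i| ≤ 1 := by unfold dl; split_ifs <;> simp
  have h5 : 1 ≤ Real.exp (‖y.1‖^2) := Real.one_le_exp (by positivity)
  rw [gF, two_mul, Real.exp_add]
  set e := Real.exp (‖y.1‖^2)
  refine (abs_add_le _ _).trans ?_
  rw [abs_mul, abs_mul]
  have a1 := mul_le_mul h1 h3 (abs_nonneg _) (by positivity)
  have a2 := mul_le_mul h4 h2 (abs_nonneg _) (by positivity)
  have a3 : D * e ≤ D * e * e := le_mul_of_one_le_right (by positivity) h5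
  linarith

noncomputable def psi (i0 : Fin n) (s l : ℝ) (y : YY n) : ℝ :=
  hh s y.2 * FF i0 (999/500) PP y - l * ‖y.1‖^2

lemma psi_smooth {i0 : Fin n} {s l : ℝ} {y : YY n} (hy : y.1 ≠ 0) (ht : 0 < y.2) : ContDiffAt ℝ ∞ (psi i0 s l) y :=
  ((tm_smooth (hh_smooth s ht)).mul (FF_smooth _ _ _ hy)).sub (contDiffAt_const.mul nsq_smooth)

lemma d_psi {i0 : Fin n} {s l : ℝ} {y : YY n} (i : Fin n) (hy : y.1 ≠ 0) (ht : 0 < y.2) :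
    d (ev i) (psi i0 s l) y = hh s y.2 * gF i0 (999/500) PP i y - l * (2 * y.1 i) := by
  unfold psi
  rw [d_sub (ds ((tm_smooth (hh_smooth s ht)).mul (FF_smooth _ _ _ hy))) (ds (contDiffAt_const.mul nsq_smooth)),
    dx_mul i (hh_deriv s ht).differentiableAt (ds (FF_smooth _ _ _ hy)), d_FF' _ _ _ _ hy, d_cmul (ds nsq_smooth), d_normsq]

lemma dt_psi {i0 : Fin n} {s l : ℝ} {y : YY n} (hy : y.1 ≠ 0) (ht : 0 < y.2) :
    d et (psi i0 s l) y = -4/y.2^5 * FF i0 (999/500) PP y := by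
  unfold psi
  rw [d_sub (ds ((tm_smooth (hh_smooth s ht)).mul (FF_smooth _ _ _ hy))) (ds (contDiffAt_const.mul nsq_smooth)),
    dt_mul (hh_deriv s ht) (ds (FF_smooth _ _ _ hy)), dt_FF _ _ _ hy, d_cmul (ds nsq_smooth), dt_nsq]
  ring

lemma pos_ev {y : YY n} (hy : y.1 ≠ 0) (ht : 0 < y.2) : ∀ᶠ z : YY n in 𝓝 y, z.1 ≠ 0 ∧ 0 < z.2 :=
  (ne_ev hy).and (continuousAt_snd.eventually (lt_mem_nhds ht))

lemma Lh_psi {i0 : Fin n} {s l : ℝ} {y : YY n} (hy : y.1 ≠ 0) (ht : 0 < y.2) :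
    Lh (psi i0 s l) y = hh s y.2 * FF i0 (999/500-2) (LL n (999/500) PP) y - l * (2 * n)
      + -4/y.2^5 * FF i0 (999/500) PP y := by
  unfold Lh
  rw [dt_psi hy ht]
  congr 1
  have : ∀ i, d (ev i) (d (ev i) (psi i0 s l)) y = hh s y.2 * d (ev i) (gF i0 (999/500) PP i) y - l * 2 := by
    intro i
    have e : d (ev i) (psi i0 s l) =ᶠ[𝓝 y] fun y => hh s y.2 * gF i0 (999/500) PP i y - (l * 2) * y.1 i := by
      filter_upwards [pos_ev hy ht] with z hz
      rw [d_psi i hz.1 hz.2]; ring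
    rw [(d_congr e).self_of_nhds,
      d_sub (ds ((tm_smooth (hh_smooth s ht)).mul (gF_smooth _ _ _ _ hy))) (ds (contDiffAt_const.mul (coord_smooth i y))),
      dx_mul i (hh_deriv s ht).differentiableAt (ds (gF_smooth _ _ _ _ hy)), d_cmul (ds (coord_smooth i y)), d_fst_coord]
    simp [dl]
  simp only [this]
  rw [Finset.sum_sub_distrib, ← Finset.mul_sum, lap_gF _ _ _ hy]
  simp; ring

lemma hh_bd {s t τ : ℝ} (hτ : 0 < τ) (h1 : τ ≤ t) (h2 : t ≤ s) : 0 ≤ hh s t ∧ hh s t ≤ (τ^4)⁻¹ := by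
  have ht : 0 < t := hτ.trans_le h1
  have hs : 0 < s := ht.trans_le h2
  have a : (s^4)⁻¹ ≤ (t^4)⁻¹ := by gcongr
  have b : (t^4)⁻¹ ≤ (τ^4)⁻¹ := by gcongr
  have c : 0 < (s^4)⁻¹ := by positivity
  unfold hh
  constructor <;> linarith

lemma psi_bd (i0 : Fin n) {ρ τ : ℝ} (s : ℝ) (hρ : 0 < ρ) (hτ : 0 < τ) : ∃ C : ℝ, 0 < C ∧ ∀ l : ℝ, 0 ≤ l → l ≤ 1 →
    ∀ y : YY n, ρ ≤ ‖y.1‖ → τ ≤ y.2 → y.2 ≤ s →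
    (∀ i, |d (ev i) (psi i0 s l) y| ≤ C * Real.exp (2*‖y.1‖^2)) ∧ |Lh (psi i0 s l) y| ≤ C * Real.exp (2*‖y.1‖^2) := by
  choose C1 hC1 h1 using fun i => gF_bd i0 i (999/500) (by norm_num) PP hρ
  obtain ⟨C2, hC2, h2⟩ := FF_bd i0 (999/500-2) (by norm_num) (LL n (999/500) PP) hρ
  obtain ⟨C3, hC3, h3⟩ := FF_bd i0 (999/500) (by norm_num) PP hρ
  have hS : 0 ≤ ∑ i, C1 i := Finset.sum_nonneg fun i _ => (hC1 i).le
  refine ⟨(τ^4)⁻¹ * (∑ i, C1 i) + 2 + (τ^4)⁻¹ * C2 + 2 * n + 4/τ^5*C3, by positivity, fun l hl hl1 y hy ht hts => ?_⟩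
  have ht0 : 0 < y.2 := hτ.trans_le ht
  have hy0 : y.1 ≠ 0 := norm_pos_iff.1 (hρ.trans_le hy)
  obtain ⟨b0, b1⟩ := hh_bd hτ ht hts
  have h5 : 1 ≤ Real.exp (‖y.1‖^2) := Real.one_le_exp (by positivity)
  have hτ4 : 0 < (τ^4)⁻¹ := by positivity
  have e2 : Real.exp (2*‖y.1‖^2) = Real.exp (‖y.1‖^2) * Real.exp (‖y.1‖^2) := by rw [← Real.exp_add]; congr 1; ring
  have h6 : Real.exp (‖y.1‖^2) ≤ Real.exp (2*‖y.1‖^2) := by rw [e2]; nlinarith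
  have g2 := h2 y hy
  have g3 := h3 y hy
  have g4 : ∀ i, |y.1 i| ≤ Real.exp (2*‖y.1‖^2) := fun i => ((coord_le y.1 i).trans (le_exp_sq _)).trans h6
  set e := Real.exp (2*‖y.1‖^2)
  have he : 1 ≤ e := h5.trans h6
  have k2 : |hh s y.2 * FF i0 (999/500-2) (LL n (999/500) PP) y| ≤ (τ^4)⁻¹ * (C2 * e) := by
    rw [abs_mul, abs_of_nonneg b0]
    refine mul_le_mul b1 (g2.trans ?_) (abs_nonneg _) hτ4.le
    gcongr
  have k3 : |-4/y.2^5 * FF i0 (999/500) PP y| ≤ 4/τ^5 * (C3 * e) := by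
    rw [abs_mul, abs_div, abs_of_pos (pow_pos ht0 5)]
    refine mul_le_mul ?_ (g3.trans ?_) (abs_nonneg _) (by positivity)
    · norm_num; gcongr
    · gcongr
  have p2 : 0 ≤ (τ^4)⁻¹ * (C2 * e) := by positivity
  have p3 : 0 ≤ 4/τ^5 * (C3 * e) := by positivity
  have p4 : 0 ≤ (τ^4)⁻¹ * (∑ i, C1 i) * e := by positivity
  have p5 : 0 ≤ 2 * (n:ℝ) * e := by positivity
  refine ⟨fun i => ?_, ?_⟩
  · rw [d_psi i hy0 ht0]
    have k1 : |hh s y.2 * gF i0 (999/500) PP i y| ≤ (τ^4)⁻¹ * ((∑ i, C1 i) * e) := by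
      rw [abs_mul, abs_of_nonneg b0]
      refine mul_le_mul b1 ((h1 i y hy).trans ?_) (abs_nonneg _) hτ4.le
      gcongr
      exact Finset.single_le_sum (f := C1) (fun i _ => (hC1 i).le) (Finset.mem_univ i)
    have k4 : |l * (2 * y.1 i)| ≤ 2 * e := by
      rw [abs_mul, abs_mul, abs_of_nonneg hl, abs_two]
      have := g4 i
      nlinarith [abs_nonneg (y.1 i)]
    refine (abs_sub _ _).trans ?_
    linarith
  · rw [Lh_psi hy0 ht0]
    have k4 : |l * (2 * (n:ℝ))| ≤ 2 * n * e := by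
      rw [abs_of_nonneg (by positivity)]
      have : (0:ℝ) ≤ n := by positivity
      nlinarith [mul_le_mul_of_nonneg_right hl1 (show (0:ℝ) ≤ 2*n by positivity), mul_le_mul_of_nonneg_left he (show (0:ℝ) ≤ 2*n by positivity)]
    refine (abs_add_le _ _).trans ?_
    have := abs_sub (hh s y.2 * FF i0 (999/500-2) (LL n (999/500) PP) y) (l * (2 * (n:ℝ)))
    linarith

lemma Lh_mul {f g : YY n → ℝ} {y : YY n} (hf' : ∀ᶠ z in 𝓝 y, ContDiffAt ℝ ∞ f z) (hg' : ContDiff ℝ ∞ g) :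
    Lh (fun y => f y * g y) y = f y * Lh g y + 2 * ∑ i, d (ev i) f y * d (ev i) g y + g y * Lh f y := by
  have hf := hf'.self_of_nhds
  have hg := hg'.contDiffAt (x := y)
  have e : ∀ a : YY n, d a (fun y => f y * g y) =ᶠ[𝓝 y] fun y => d a f y * g y + f y * d a g y := fun a => by
    filter_upwards [hf'] with z h1
    exact d_mul (ds h1) (ds hg'.contDiffAt)
  have e2 : ∀ a : YY n, d a (d a (fun y => f y * g y)) y = d a (d a f) y * g y + 2 * (d a f y * d a g y) + f y * d a (d a g) y := fun a => by
    rw [(d_congr (e a)).self_of_nhds, d_add ((ds (d_contDiffAt hf)).fun_mul (ds hg)) ((ds hf).fun_mul (ds (d_contDiffAt hg))),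
      d_mul (ds (d_contDiffAt hf)) (ds hg), d_mul (ds hf) (ds (d_contDiffAt hg))]
    ring
  unfold Lh
  simp only [e2, (e et).self_of_nhds, Finset.sum_add_distrib, ← Finset.sum_mul, ← Finset.mul_sum]
  ring

lemma d_comp {g : ℝ → ℝ} {f : YY n → ℝ} {y : YY n} (a : YY n) (hg : ContDiff ℝ ∞ g) (hf : ContDiffAt ℝ ∞ f y) :
    d a (fun y => g (f y)) y = deriv g (f y) * d a f y :=
  d_comp1 ((hg.differentiable (by simp)) _).hasDerivAt (ds hf)

lemma Lh_comp {g : ℝ → ℝ} {f : YY n → ℝ} {y : YY n} (hg : ContDiff ℝ ∞ g) (hf' : ∀ᶠ z in 𝓝 y, ContDiffAt ℝ ∞ f z) :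
    Lh (fun y => g (f y)) y = deriv (deriv g) (f y) * ∑ i, d (ev i) f y ^ 2 + deriv g (f y) * Lh f y := by
  have hf := hf'.self_of_nhds
  have hg' : ContDiff ℝ ∞ (deriv g) := (contDiff_infty_iff_deriv.1 hg).2
  have e : ∀ a : YY n, d a (fun y => g (f y)) =ᶠ[𝓝 y] fun y => deriv g (f y) * d a f y := fun a => by
    filter_upwards [hf'] with z h1
    exact d_comp a hg h1
  have hc : DifferentiableAt ℝ (fun y => deriv g (f y)) y := (hg'.contDiffAt.comp y hf).differentiableAt (by simp)
  have e2 : ∀ a : YY n, d a (d a (fun y => g (f y))) y = deriv (deriv g) (f y) * d a f y ^2 + deriv g (f y) * d a (d a f) y := fun a => by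
    rw [(d_congr (e a)).self_of_nhds, d_mul hc (ds (d_contDiffAt hf)), d_comp a hg' hf]
    ring
  unfold Lh
  simp only [e2, (e et).self_of_nhds, Finset.sum_add_distrib, ← Finset.mul_sum]
  ring
end
end CU

namespace CU
open Set MeasureTheory Filter Topology
open scoped ContDiff
section
variable {n : ℕ}
local notation "E" => EuclideanSpace ℝ (Fin n)

def Ks (i0 : Fin n) (s l B τ : ℝ) : Set (YY n) := {y | τ ≤ y.2 ∧ y.2 ≤ s ∧ y.1 ≠ 0 ∧ B ≤ psi i0 s l y}

lemma Ks_geo {i0 : Fin n} {s l B τ : ℝ} (hτ : 0 < τ) (hB : 0 < B) (hl : 0 < l) {y : YY n} (hy : y ∈ Ks i0 s l B τ) :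
    y.2 < s ∧ 0 < FF i0 (999/500) PP y ∧ 13/20 * ‖y.1‖ ≤ y.1 i0 ∧ min 1 (B * τ^4/2) ≤ ‖y.1‖ ∧ ‖y.1‖ ≤ (2 * (τ^4)⁻¹ / l)^500 := by
  obtain ⟨h1, h2, h3, h4⟩ := hy
  have hr : 0 < ‖y.1‖ := norm_pos_iff.2 h3
  obtain ⟨b0, b1⟩ := hh_bd hτ h1 h2
  have hlr : 0 < l * ‖y.1‖^2 := by positivity
  have h5 : B + l * ‖y.1‖^2 ≤ hh s y.2 * FF i0 (999/500) PP y := by unfold psi at h4; linarith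
  have h6 : 0 < hh s y.2 * FF i0 (999/500) PP y := by linarith
  have hh0 : 0 < hh s y.2 := by
    rcases b0.eq_or_lt with h | h
    · rw [← h] at h6; simp at h6
    · exact h
  have hF : 0 < FF i0 (999/500) PP y := (pos_iff_pos_of_mul_pos h6).1 hh0
  have hp : 0 < ‖y.1‖ ^ (999/500:ℝ) := by positivity
  have hP : 0 < PP.eval (y.1 i0 / ‖y.1‖) := (pos_iff_pos_of_mul_pos hF).1 hp
  have hc := c_le_one (i0 := i0) y.1 h3
  have hP2 := P_le hc
  have hcb := c_big hc hP
  have hF2 : FF i0 (999/500) PP y ≤ ‖y.1‖ ^ (999/500:ℝ) * 2 := mul_le_mul_of_nonneg_left hP2 hp.le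
  have h7 : hh s y.2 * FF i0 (999/500) PP y ≤ (τ^4)⁻¹ * (‖y.1‖ ^ (999/500:ℝ) * 2) := mul_le_mul b1 hF2 hF.le (by positivity)
  refine ⟨?_, hF, (le_div_iff₀ hr).1 hcb, ?_, ?_⟩
  · rcases h2.eq_or_lt with h | h
    · rw [h] at hh0; simp [hh] at hh0
    · exact h
  · by_contra! h
    rw [lt_min_iff] at h
    have h8 : ‖y.1‖ ^ (999/500:ℝ) ≤ ‖y.1‖ := by
      have := Real.rpow_le_rpow_of_exponent_ge hr h.1.le (show (1:ℝ) ≤ 999/500 by norm_num)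
      simpa using this
    have h9 : B < (τ^4)⁻¹ * (‖y.1‖ * 2) := by
      refine (show B < (τ^4)⁻¹ * (‖y.1‖ ^ (999/500:ℝ) * 2) by linarith).trans_le ?_
      gcongr
    have h10 := h.2
    rw [lt_div_iff₀ two_pos] at h10
    rw [inv_mul_eq_div, lt_div_iff₀ (by positivity)] at h9
    linarith
  · have e : ‖y.1‖^2 = ‖y.1‖ ^ (999/500:ℝ) * ‖y.1‖^(1/500:ℝ) := by
      rw [← Real.rpow_add hr, ← Real.rpow_two]; norm_num
    rw [e] at h5
    have h8 : ‖y.1‖ ^ (999/500:ℝ) * (l * ‖y.1‖^(1/500:ℝ)) ≤ ‖y.1‖ ^ (999/500:ℝ) * (2 * (τ^4)⁻¹) := by linarith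
    have h9 := le_of_mul_le_mul_left h8 hp
    have h10 : ‖y.1‖^(1/500:ℝ) ≤ 2 * (τ^4)⁻¹ / l := by rw [le_div_iff₀ hl]; linarith
    have h11 : (‖y.1‖^(1/500:ℝ))^500 ≤ (2 * (τ^4)⁻¹ / l)^500 := pow_le_pow_left₀ (by positivity) h10 _
    rwa [← Real.rpow_mul_natCast hr.le, show (1/500:ℝ) * (500:ℕ) = 1 by norm_num, Real.rpow_one] at h11

lemma Ks_compact {i0 : Fin n} {s l B τ : ℝ} (hτ : 0 < τ) (hB : 0 < B) (hl : 0 < l) : IsCompact (Ks i0 s l B τ) := by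
  set ρ := min 1 (B * τ^4/2)
  have hρ : 0 < ρ := lt_min one_pos (by positivity)
  set R := (2 * (τ^4)⁻¹ / l)^500
  let C : Set (YY n) := {y | τ ≤ y.2 ∧ y.2 ≤ s ∧ ρ ≤ ‖y.1‖}
  have hC : IsClosed C := (isClosed_le continuous_const continuous_snd).inter
    ((isClosed_le continuous_snd continuous_const).inter (isClosed_le continuous_const continuous_fst.norm))
  have hc : ContinuousOn (psi i0 s l) C := fun y hy =>
    (psi_smooth (norm_pos_iff.1 (hρ.trans_le hy.2.2)) (hτ.trans_le hy.1)).continuousAt.continuousWithinAt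
  have e : Ks i0 s l B τ = C ∩ psi i0 s l ⁻¹' Ici B := by
    ext y
    constructor
    · intro hy
      exact ⟨⟨hy.1, hy.2.1, (Ks_geo hτ hB hl hy).2.2.2.1⟩, hy.2.2.2⟩
    · rintro ⟨⟨h1, h2, h3⟩, h4⟩
      exact ⟨h1, h2, norm_pos_iff.1 (hρ.trans_le h3), h4⟩
  refine IsCompact.of_isClosed_subset ((isCompact_closedBall (0:E) R).prod (isCompact_Icc (a := τ) (b := s))) ?_ ?_
  · rw [e]; exact hc.preimage_isClosed_of_isClosed hC isClosed_Ici
  · intro y hy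
    exact ⟨by simpa using (Ks_geo hτ hB hl hy).2.2.2.2, hy.1, hy.2.1⟩

noncomputable def gc (B r : ℝ) : ℝ := Real.smoothTransition (r/B - 1)

lemma gc_smooth (B : ℝ) : ContDiff ℝ ∞ (gc B) :=
  Real.smoothTransition.contDiff.comp ((contDiff_id.div_const B).sub contDiff_const)
lemma gc_zero {B r : ℝ} (hB : 0 < B) (h : r ≤ B) : gc B r = 0 :=
  Real.smoothTransition.zero_of_nonpos (by rw [sub_nonpos, div_le_one hB]; exact h)
lemma gc_one {B r : ℝ} (hB : 0 < B) (h : 2 * B ≤ r) : gc B r = 1 :=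
  Real.smoothTransition.one_of_one_le (by rw [le_sub_iff_add_le, le_div_iff₀ hB]; linarith)
lemma gc_abs (B r : ℝ) : |gc B r| ≤ 1 := by
  unfold gc
  rw [abs_of_nonneg (Real.smoothTransition.nonneg _)]; exact Real.smoothTransition.le_one _

lemma gc_bd {B : ℝ} : ∃ C : ℝ, 0 < C ∧ ∀ r ∈ Icc B (2*B), |deriv (gc B) r| ≤ C ∧ |deriv (deriv (gc B)) r| ≤ C := by
  have h1 : ContDiff ℝ ∞ (deriv (gc B)) := (contDiff_infty_iff_deriv.1 (gc_smooth B)).2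
  have h2 : ContDiff ℝ ∞ (deriv (deriv (gc B))) := (contDiff_infty_iff_deriv.1 h1).2
  obtain ⟨C, hC⟩ := (isCompact_Icc (a := B) (b := 2*B)).exists_bound_of_continuousOn h1.continuous.continuousOn
  obtain ⟨D, hD⟩ := (isCompact_Icc (a := B) (b := 2*B)).exists_bound_of_continuousOn h2.continuous.continuousOn
  refine ⟨max 1 (max C D), by positivity, fun r hr => ⟨(hC r hr).trans (by simp), (hD r hr).trans (by simp)⟩⟩

lemma cutU {i0 : Fin n} {s l B τ : ℝ} (hτ : 0 < τ) (hB : 0 < B) (hl : 0 < l) {v : YY n → ℝ} (hv : ContDiff ℝ ∞ v)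
    (hv0 : ∀ y, y.2 ≤ τ → v y = 0) : ∃ U : YY n → ℝ, ContDiff ℝ ∞ U ∧ tsupport U ⊆ Ks i0 s l B τ ∧
      (∀ y ∈ Ks i0 s l B τ, 2 * B < psi i0 s l y → U =ᶠ[𝓝 y] v) ∧
      (∀ y ∈ Ks i0 s l B τ, U =ᶠ[𝓝 y] fun y => gc B (psi i0 s l y) * v y) := by
  classical
  let U : YY n → ℝ := fun y => if y.1 ≠ 0 ∧ 0 < y.2 ∧ y.2 < s then gc B (psi i0 s l y) * v y else 0
  have hsup : tsupport U ⊆ Ks i0 s l B τ := by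
    refine closure_minimal (fun y hy => ?_) (Ks_compact hτ hB hl).isClosed
    rw [Function.mem_support] at hy
    simp only [U] at hy
    split_ifs at hy with h
    · refine ⟨?_, h.2.2.le, h.1, ?_⟩
      · by_contra! h'
        exact hy (by rw [hv0 y h'.le, mul_zero])
      · by_contra! h'
        exact hy (by rw [gc_zero hB h'.le, zero_mul])
    · exact absurd rfl hy
  have hloc : ∀ y ∈ Ks i0 s l B τ, U =ᶠ[𝓝 y] fun y => gc B (psi i0 s l y) * v y := by
    intro y hy
    have hs := (Ks_geo hτ hB hl hy).1
    filter_upwards [pos_ev hy.2.2.1 (hτ.trans_le hy.1), continuousAt_snd.eventually (gt_mem_nhds hs)] with z h1 h2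
    simp only [U]
    rw [if_pos ⟨h1.1, h1.2, h2⟩]
  refine ⟨U, contDiff_iff_contDiffAt.2 fun y => ?_, hsup, fun y hy h2 => ?_, hloc⟩
  · by_cases hy : y ∈ Ks i0 s l B τ
    · refine ContDiffAt.congr_of_eventuallyEq ?_ (hloc y hy)
      exact ((gc_smooth B).contDiffAt.comp y (psi_smooth hy.2.2.1 (hτ.trans_le hy.1))).mul hv.contDiffAt
    · have : U =ᶠ[𝓝 y] fun _ => 0 := notMem_tsupport_iff_eventuallyEq.1 fun h => hy (hsup h)
      exact contDiffAt_const.congr_of_eventuallyEq this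
  · have hc := (psi_smooth (i0 := i0) (s := s) (l := l) hy.2.2.1 (hτ.trans_le hy.1)).continuousAt.eventually (lt_mem_nhds h2)
    filter_upwards [hloc y hy, hc] with z h3 h4
    rw [h3, gc_one hB (le_of_lt h4), one_mul]
end
end CU

namespace CU
open Set MeasureTheory Filter Topology
open scoped ContDiff
section
variable {n : ℕ}
local notation "E" => EuclideanSpace ℝ (Fin n)
variable {Ω : Set (EuclideanSpace ℝ (Fin n))} {τ T M : ℝ} {u : EuclideanSpace ℝ (Fin n) → ℝ → ℝ}

lemma Sol.gradbd (S : Sol Ω τ T M u) {ρ s C0 A : ℝ} (hρ : 0 < ρ) (hρ1 : ρ ≤ 1) (hs : s < T)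
    (hC0 : 0 < C0) (hA : 0 ≤ A) {N : Set E} (hN : ∀ x ∈ N, Metric.closedBall x ρ ⊆ Ω)
    (hg : ∀ x ∈ Ω, ∀ t < T, |u x t| ≤ C0 * Real.exp (A * ‖x‖^2)) :
    ∃ C1 : ℝ, 0 < C1 ∧ ∀ x ∈ N, ∀ t ≤ s, |u x t| ≤ C1 * Real.exp (2 * A * ‖x‖^2) ∧
      ‖fderiv ℝ (fun y => u y t) x‖ ≤ C1 * Real.exp (2 * A * ‖x‖^2) := by
  have hM := S.M0
  obtain ⟨R, hR0, hR⟩ : ∃ R : ℝ, 0 < R ∧ R < min ρ (min (T - s) (1/M)) :=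
    exists_between (lt_min hρ (lt_min (by linarith) (by positivity)))
  simp only [lt_min_iff] at hR
  obtain ⟨h1, h3, h4⟩ := hR
  refine ⟨C0 * Real.exp (2*A) * (1 + (100 * n + 100) * (1 / R + R * M)), by positivity, fun x hx t ht => ?_⟩
  set K := C0 * Real.exp (2*A) * Real.exp (2 * A * ‖x‖^2) with hKd
  have hKpos : 0 < K := by positivity
  have hball : Metric.closedBall x R ⊆ Ω := (Metric.closedBall_subset_closedBall h1.le).trans (hN x hx)
  have hK : ∀ z ∈ Metric.closedBall x R, ∀ t < T, |u z t| ≤ K := fun z hz t ht => by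
    refine (hg z (hball hz) t ht).trans ?_
    rw [hKd, mul_assoc, ← Real.exp_add]
    have h5 : ‖z‖ ≤ ‖x‖ + 1 := by
      have : ‖z - x‖ ≤ R := by simpa [dist_eq_norm] using hz
      have := norm_le_norm_add_norm_sub' z x
      linarith
    have h6 : ‖z‖^2 ≤ 2 + 2 * ‖x‖^2 := by
      have := pow_le_pow_left₀ (norm_nonneg z) h5 2
      nlinarith [sq_nonneg (‖x‖ - 1)]
    have := mul_le_mul_of_nonneg_left h6 hA
    gcongr
    linarith
  have hxR : x ∈ Metric.closedBall x R := by simp [hR0.le]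
  have e : C0 * Real.exp (2*A) * (1 + (100 * n + 100) * (1 / R + R * M)) * Real.exp (2 * A * ‖x‖^2) =
      K + (100 * n + 100) * (K / R + R * (M * K)) := by rw [hKd]; ring
  have hC : 0 ≤ (100 * (n:ℝ) + 100) * (K / R + R * (M * K)) := by positivity
  rw [e]
  refine ⟨(hK x hxR t (by linarith)).trans (by linarith), ?_⟩
  rcases le_or_gt t τ with h | h
  · rw [S.g0 (hball hxR) h, norm_zero]; positivity
  have hRR : R^2 ≤ R := by nlinarith
  have hti : ∀ s ∈ Icc t (t + R^2), s ∈ Ioo τ T := fun s hs => by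
    refine ⟨?_, ?_⟩ <;> linarith [hs.1, hs.2]
  have := grad_est (u := u) (x0 := x) (t0 := t) (ρ := R) (M := M) (F0 := M * K) (K := K) hR0 hM.le (by positivity) hKpos
    (by rw [lt_div_iff₀ hM] at h4; linarith)
    (S.cont.mono fun p hp => ⟨hball hp.1, (hti _ hp.2).2⟩)
    (fun z hz s hs => S.hx z (hball hz) s (hti s hs))
    (fun z hz s hs => S.ht z (hball hz) s (hti s hs))
    (fun z hz s hs => (S.heq z (hball hz) s (hti s hs)).trans (by
      have := mul_le_mul_of_nonneg_left (hK z hz s (hti s hs).2) hM.le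
      linarith))
    (fun z hz s hs => hK z hz s (hti s hs).2)
  linarith

lemma cut_bd (i0 : Fin n) {s B D A τ : ℝ} (hτ : 0 < τ) (hB : 0 < B) (hD : 0 ≤ D) (hA : 0 ≤ A) :
    ∃ C : ℝ, 0 < C ∧ ∀ l : ℝ, 0 < l → l ≤ 1 → ∀ v : YY n → ℝ, ContDiff ℝ ∞ v → ∀ y ∈ Ks i0 s l B τ, psi i0 s l y ≤ 2 * B →
      |v y| ≤ D * Real.exp (A * ‖y.1‖^2) → (∀ i, |d (ev i) v y| ≤ D * Real.exp (A * ‖y.1‖^2)) →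
      |Lh v y| ≤ D * Real.exp (A * ‖y.1‖^2) →
      |Lh (fun y => gc B (psi i0 s l y) * v y) y| ≤ C * Real.exp ((A + 4) * ‖y.1‖^2) := by
  obtain ⟨G, hG, hg⟩ := gc_bd (B := B)
  obtain ⟨P, hP, hp⟩ := psi_bd i0 (ρ := min 1 (B * τ^4/2)) (τ := τ) s (lt_min one_pos (by positivity)) hτ
  refine ⟨1 + D + 2 * (n * (G * P * D)) + D * (G * (n * P^2) + G * P), by positivity, fun l hl hl1 v hv y hy hψ hv0 hv1 hv2 => ?_⟩
  have hgeo := Ks_geo hτ hB hl hy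
  have hy0 := hy.2.2.1
  have ht0 := hτ.trans_le hy.1
  obtain ⟨p1, p2⟩ := hp l hl.le hl1 y hgeo.2.2.2.1 hy.1 hy.2.1
  obtain ⟨g1, g2⟩ := hg _ ⟨hy.2.2.2, hψ⟩
  have hev : ∀ᶠ z in 𝓝 y, ContDiffAt ℝ ∞ (psi i0 s l) z := by
    filter_upwards [pos_ev hy0 ht0] with z hz using psi_smooth hz.1 hz.2
  have hev2 : ∀ᶠ z in 𝓝 y, ContDiffAt ℝ ∞ (fun y => gc B (psi i0 s l y)) z := by
    filter_upwards [hev] with z hz using (gc_smooth B).contDiffAt.comp z hz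
  rw [Lh_mul hev2 hv, Lh_comp (gc_smooth B) hev]
  simp only [d_comp _ (gc_smooth B) hev.self_of_nhds]
  set e2 := Real.exp (2 * ‖y.1‖^2) with he2
  set eA := Real.exp (A * ‖y.1‖^2) with heA
  have e : Real.exp ((A + 4) * ‖y.1‖^2) = eA * (e2 * e2) := by
    rw [he2, heA, ← Real.exp_add, ← Real.exp_add]; congr 1; ring
  have h2 : 1 ≤ e2 := Real.one_le_exp (by positivity)
  have hA1 : 1 ≤ eA := Real.one_le_exp (by positivity)
  have h22 : e2 ≤ e2 * e2 := le_mul_of_one_le_left (by linarith) h2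
  have t1 : |gc B (psi i0 s l y) * Lh v y| ≤ D * (eA * (e2 * e2)) := by
    rw [abs_mul]
    calc _ ≤ 1 * (D * eA) := mul_le_mul (gc_abs _ _) hv2 (abs_nonneg _) one_pos.le
      _ ≤ _ := by
        rw [one_mul]
        refine mul_le_mul_of_nonneg_left ?_ hD
        exact le_mul_of_one_le_right (by linarith) (by linarith)
  have t2 : |∑ i, deriv (gc B) (psi i0 s l y) * d (ev i) (psi i0 s l) y * d (ev i) v y| ≤ n * (G * P * D * (eA * (e2 * e2))) := by
    refine (Finset.abs_sum_le_sum_abs _ _).trans ?_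
    have : ∀ i ∈ Finset.univ, |deriv (gc B) (psi i0 s l y) * d (ev i) (psi i0 s l) y * d (ev i) v y| ≤ G * P * D * (eA * (e2 * e2)) := by
      intro i _
      rw [abs_mul, abs_mul]
      calc _ ≤ G * (P * e2) * (D * eA) := by
            apply mul_le_mul (mul_le_mul g1 (p1 i) (abs_nonneg _) hG.le) (hv1 i) (abs_nonneg _) (by positivity)
        _ = G * P * D * (eA * e2) := by ring
        _ ≤ _ := by gcongr
    refine (Finset.sum_le_sum this).trans ?_
    simp
  have t3 : |∑ i, d (ev i) (psi i0 s l) y ^ 2| ≤ n * (P^2 * (e2 * e2)) := by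
    refine (Finset.abs_sum_le_sum_abs _ _).trans ?_
    have : ∀ i ∈ Finset.univ, |d (ev i) (psi i0 s l) y ^2| ≤ P^2 * (e2*e2) := by
      intro i _
      rw [abs_pow]
      calc _ ≤ (P * e2)^2 := pow_le_pow_left₀ (abs_nonneg _) (p1 i) 2
        _ = _ := by ring
    refine (Finset.sum_le_sum this).trans ?_
    simp
  have t4 : |deriv (deriv (gc B)) (psi i0 s l y) * ∑ i, d (ev i) (psi i0 s l) y ^ 2 + deriv (gc B) (psi i0 s l y) * Lh (psi i0 s l) y| ≤
      (G * (n * P^2) + G * P) * (e2 * e2) := by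
    refine (abs_add_le _ _).trans ?_
    rw [abs_mul, abs_mul]
    have a1 := mul_le_mul g2 t3 (abs_nonneg _) hG.le
    have a2 := mul_le_mul g1 (p2.trans (mul_le_mul_of_nonneg_left h22 hP.le)) (abs_nonneg _) hG.le
    linarith
  have t5 := mul_le_mul hv0 t4 (abs_nonneg _) (by positivity)
  rw [← abs_mul] at t5
  rw [e]
  have t0 : 0 ≤ eA * (e2 * e2) := by positivity
  refine (abs_add_le _ _).trans ?_
  have := abs_add_le (gc B (psi i0 s l y) * Lh v y) (2 * ∑ i, deriv (gc B) (psi i0 s l y) * d (ev i) (psi i0 s l) y * d (ev i) v y)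
  rw [abs_mul 2, abs_two] at this
  linarith
end
end CU

namespace CU
open Set MeasureTheory Filter Topology
open scoped ContDiff
section
variable {n : ℕ}
local notation "E" => EuclideanSpace ℝ (Fin n)
variable {Ω : Set (EuclideanSpace ℝ (Fin n))} {τ T M : ℝ} {u : EuclideanSpace ℝ (Fin n) → ℝ → ℝ}

lemma opn_le (L : E →L[ℝ] ℝ) : ‖L‖ ≤ ∑ i, |L (EuclideanSpace.single i 1)| := by
  refine L.opNorm_le_bound (Finset.sum_nonneg fun _ _ => abs_nonneg _) fun x => ?_
  have h : L x = ∑ i, x i * L (EuclideanSpace.single i 1) := by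
    conv_lhs => rw [← (EuclideanSpace.basisFun (Fin n) ℝ).sum_repr x]
    simp
  rw [h, Real.norm_eq_abs, Finset.sum_mul]
  refine (Finset.abs_sum_le_sum_abs _ _).trans (Finset.sum_le_sum fun i _ => ?_)
  rw [abs_mul, mul_comm]
  exact mul_le_mul_of_nonneg_left (coord_le x i) (abs_nonneg _)

lemma coe_le (L : E →L[ℝ] ℝ) (i : Fin n) : |L (EuclideanSpace.single i 1)| ≤ ‖L‖ := by
  have := L.le_opNorm (EuclideanSpace.single i 1)
  simpa using this

lemma Lh_congr {f g : YY n → ℝ} {y : YY n} (h : f =ᶠ[𝓝 y] g) : Lh f y = Lh g y := by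
  unfold Lh
  simp only [(d_congr h).self_of_nhds, (d_congr (d_congr h)).self_of_nhds]

noncomputable def JJ (s : ℝ) (y : YY n) : ℝ := Real.exp (-1 * ‖y.1‖^2) * (Icc 0 s).indicator (fun _ => (1:ℝ)) y.2

lemma JJ_int (s : ℝ) : Integrable (JJ (n := n) s) := by
  have h2 : Integrable ((Icc 0 s).indicator (fun _ => (1:ℝ))) := by
    rw [integrable_indicator_iff measurableSet_Icc]
    exact integrableOn_const (by simp)
  exact (int_gauss n one_pos).mul_prod h2

lemma JJ_nn (s : ℝ) (y : YY n) : 0 ≤ JJ s y :=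
  mul_nonneg (Real.exp_pos _).le (indicator_nonneg (fun _ _ => zero_le_one) _)

lemma sq_bd {m : ℕ} {X M δ : ℝ} {v : ℝ} {w : Fin m → ℝ} (hM : 0 ≤ M) (hX : |X| ≤ M * (|v| + ∑ i, |w i|) + δ) :
    X^2 ≤ 2 * M^2 * (m+1) * (∑ i, w i^2 + v^2) + 2 * δ^2 := by
  have h1 : (∑ i, |w i|)^2 ≤ m * ∑ i, w i^2 := by
    have := sq_sum_le_card_mul_sum_sq (s := Finset.univ) (f := fun i => |w i|)
    simpa using this
  have hS : 0 ≤ ∑ i, |w i| := Finset.sum_nonneg fun _ _ => abs_nonneg _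
  set S := ∑ i, |w i|
  set Q := ∑ i, w i^2
  have hQ : 0 ≤ Q := Finset.sum_nonneg fun _ _ => sq_nonneg _
  have h2 : (|v| + S)^2 ≤ (m+1) * (Q + v^2) := by
    have hm : (0:ℝ) ≤ m := by positivity
    rcases hm.eq_or_lt with h | h
    · rw [← h] at h1 ⊢
      have : S = 0 := by nlinarith
      rw [this]; simp; exact hQ
    · have h3 : 2 * |v| * S ≤ m * v^2 + S^2/m := by
        rw [← sub_nonneg]
        have : m * v^2 + S^2/m - 2 * |v| * S = (m * |v| - S)^2/m := by
          rw [← sq_abs v]; field_simp; ring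
        rw [this]; positivity
      have h4 : S^2/m ≤ Q := by rw [div_le_iff₀ h]; linarith
      have : (|v| + S)^2 = v^2 + 2 * |v| * S + S^2 := by rw [← sq_abs v]; ring
      rw [this]; linarith
  have h5 : X^2 ≤ (M * (|v| + S) + δ)^2 := by rw [← sq_abs]; exact pow_le_pow_left₀ (abs_nonneg _) hX 2
  have h6 : (M * (|v| + S) + δ)^2 ≤ 2 * (M^2 * (|v| + S)^2) + 2 * δ^2 := by
    nlinarith [sq_nonneg (M * (|v| + S) - δ)]
  have h7 := mul_le_mul_of_nonneg_left h2 (sq_nonneg M)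
  linarith

set_option maxHeartbeats 1000000 in
lemma Sol.step (S : Sol Ω τ T M u) (hτ : 0 < τ) (i0 : Fin n) {N : Set E}
    (hNc : ∀ x, 13/20 * ‖x‖ ≤ x i0 → x ∈ N) (hNΩ : N ⊆ Ω) {s B C1 A a A0 C m : ℝ} (hs0 : 0 < s) (hs1 : s ≤ 1) (hsT : s < T) (hB : 0 < B)
    (hC1 : 0 < C1) (hA : 0 ≤ A) (hb : ∀ x ∈ N, ∀ t ≤ s, |u x t| ≤ C1 * Real.exp (A * ‖x‖^2) ∧
      ‖fderiv ℝ (fun y => u y t) x‖ ≤ C1 * Real.exp (A * ‖x‖^2))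
    (h8 : 2 * (A + 4) + 1 ≤ 1/(8*s)) (hκ : 2 * M^2 * (n+1) ≤ 1/(8*s)) (ha : 0 < a) (haB : A0 ≤ a * B)
    (hl1 : 1/(16*s*a) ≤ 1) (hm : 0 < m)
    (hcar : ∀ s a B : ℝ, 0 < s → s ≤ 1 → 0 < a → 0 < B →
      A0 ≤ a * B → ∀ U : YY n → ℝ, ContDiff ℝ ∞ U → HasCompactSupport U →
      (∀ y ∈ tsupport U, 0 < y.2 ∧ y.2 < s ∧ y.1 ≠ 0 ∧ B ≤ hh s y.2 * FF i0 (999/500) PP y) →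
      ∫ y, Real.exp (2 * ph i0 s a y) * (1/(4*s) * (∑ i, d (ev i) U y ^ 2 + U y ^ 2)) ≤
      ∫ y, Real.exp (2 * ph i0 s a y) * (∑ i, d (ev i) (d (ev i) U) y + d et U y) ^ 2)
    (hcut : ∀ l : ℝ, 0 < l → l ≤ 1 → ∀ v : YY n → ℝ, ContDiff ℝ ∞ v → ∀ y ∈ Ks i0 s l B (τ/2), psi i0 s l y ≤ 2 * B →
      |v y| ≤ (2*M*C1+C1+1) * Real.exp (A * ‖y.1‖^2) → (∀ i, |d (ev i) v y| ≤ (2*M*C1+C1+1) * Real.exp (A * ‖y.1‖^2)) →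
      |Lh v y| ≤ (2*M*C1+C1+1) * Real.exp (A * ‖y.1‖^2) →
      |Lh (fun y => gc B (psi i0 s l y) * v y) y| ≤ C * Real.exp ((A + 4) * ‖y.1‖^2)) :
    ∃ U : YY n → ℝ, Integrable (fun y => Real.exp (2 * ph i0 s a y) * U y ^2) ∧
      (∀ y ∈ Ks i0 s (1/(16*s*a)) B (τ/2), 2 * B < psi i0 s (1/(16*s*a)) y → |U y - u y.1 y.2| ≤ m) ∧
      1/(8*s) * ∫ y, Real.exp (2 * ph i0 s a y) * U y ^2 ≤ (C^2 * Real.exp (4*a*B) + 1) * ∫ y : YY n, JJ s y := by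
  have hM := S.M0
  have hτ2 : 0 < τ/2 := by linarith
  set l := 1/(16*s*a) with hl
  have hl0 : 0 < l := by positivity
  set K := Ks i0 s l B (τ/2) with hK
  have hKc : IsCompact K := Ks_compact hτ2 hB hl0
  have hgeo : ∀ y ∈ K, _ := fun y hy => Ks_geo hτ2 hB hl0 hy
  have hKN : ∀ y ∈ K, y.1 ∈ N := fun y hy => hNc _ (hgeo y hy).2.2.1
  have hKU : K ⊆ Ω ×ˢ Iio T := fun y hy => ⟨hNΩ (hKN y hy), (hgeo y hy).1.trans hsT⟩
  have hphs : ∀ y ∈ K, ContDiffAt ℝ ∞ (ph i0 s a) y := fun y hy => ph_smooth hy.2.2.1 (hτ2.trans_le hy.1)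
  obtain ⟨Λ, hΛ⟩ := hKc.exists_bound_of_continuousOn (f := fun y : YY n => 2 * (M*(n+1)+1)^2 * Real.exp (2 * ph i0 s a y + ‖y.1‖^2))
    (fun y hy => by
      have := (hphs y hy).continuousAt
      have h3 : ContinuousAt (fun y : YY n => 2 * (M*(n+1)+1)^2 * Real.exp (2 * ph i0 s a y + ‖y.1‖^2)) y := by fun_prop
      exact h3.continuousWithinAt)
  obtain ⟨δ, hδ0, hδ⟩ : ∃ δ : ℝ, 0 < δ ∧ δ < min m (min 1 (1/(|Λ|+1))) := exists_between (lt_min hm (lt_min one_pos (by positivity)))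
  simp only [lt_min_iff] at hδ
  obtain ⟨hδm, hδ1, hδΛ⟩ := hδ
  obtain ⟨v, hv, hv0, hvK⟩ := S.approx hτ hKc hKU hδ0
  obtain ⟨U, hU, hUs, hU1, hU2⟩ := cutU (i0 := i0) (s := s) hτ2 hB hl0 hv hv0
  have hUc : HasCompactSupport U := HasCompactSupport.of_support_subset_isCompact hKc ((subset_tsupport _).trans hUs)
  have hdc : ∀ a : YY n, Continuous (d a U) := fun a => (d_contDiff hU).continuous
  have hi1 : Integrable (fun y => Real.exp (2 * ph i0 s a y) * (∑ i, d (ev i) U y ^ 2 + U y ^ 2)) := by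
    refine glue hUc (fun y hy => ?_) fun y hy => ?_
    · have h1 := (hphs y (hUs hy)).continuousAt
      have h2 := hU.continuous
      have h3 := fun i => hdc (ev i)
      fun_prop
    · simp [image_eq_zero_of_notMem_tsupport hy, (d_zero_off _ hy).self_of_nhds]
  have hi2 : Integrable (fun y => Real.exp (2 * ph i0 s a y) * U y ^ 2) := by
    refine glue hUc (fun y hy => ?_) fun y hy => ?_
    · have h1 := (hphs y (hUs hy)).continuousAt
      have h2 := hU.continuous
      fun_prop
    · simp [image_eq_zero_of_notMem_tsupport hy]
  refine ⟨U, hi2, fun y hy h => ?_, ?_⟩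
  · rw [(hU1 y hy h).self_of_nhds]
    exact (hvK y hy).1.trans hδm.le
  have h1 := hcar s a B hs0 hs1 ha hB haB U hU hUc (fun y hy => by
    have h := hUs hy
    have h' := hgeo y h
    refine ⟨hτ2.trans_le h.1, h'.1, h.2.2.1, ?_⟩
    have h2 := h.2.2.2
    unfold psi at h2
    have : 0 ≤ l * ‖y.1‖^2 := by positivity
    linarith)
  set κ := 2 * M^2 * ((n:ℝ)+1)
  have hpt : ∀ y : YY n, Real.exp (2 * ph i0 s a y) * (∑ i, d (ev i) (d (ev i) U) y + d et U y) ^ 2 ≤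
      κ * (Real.exp (2 * ph i0 s a y) * (∑ i, d (ev i) U y ^ 2 + U y ^ 2)) + (C^2 * Real.exp (4*a*B) + 1) * JJ s y := by
    intro y
    have hQ : 0 ≤ κ * (Real.exp (2 * ph i0 s a y) * (∑ i, d (ev i) U y ^ 2 + U y ^ 2)) := by
      have : 0 ≤ ∑ i, d (ev i) U y ^ 2 := Finset.sum_nonneg fun _ _ => sq_nonneg _
      positivity
    have hJ := JJ_nn s y
    by_cases hy : y ∈ tsupport U
    swap
    · have : ∀ b, d b (d b U) y = 0 := fun b => (d_zero_of (d_zero_off b hy)).self_of_nhds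
      have e : (∑ i, d (ev i) (d (ev i) U) y + d et U y) = 0 := by simp [this, (d_zero_off _ hy).self_of_nhds]
      rw [e, zero_pow two_ne_zero, mul_zero]
      positivity
    have hy := hUs hy
    have hg := hgeo y hy
    have hJe : JJ s y = Real.exp (-1 * ‖y.1‖^2) := by
      have hm : y.2 ∈ Icc 0 s := ⟨by linarith [hy.1], hy.2.1⟩
      rw [JJ, indicator_of_mem hm, mul_one]
    change Real.exp (2 * ph i0 s a y) * (Lh U y)^2 ≤ _
    obtain ⟨k0, k1, k2⟩ := hvK y hy
    obtain ⟨b0, b1⟩ := hb y.1 (hKN y hy) y.2 hy.2.1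
    rcases le_or_gt (psi i0 s l y) (2*B) with hc | hc
    · have eA : 1 ≤ Real.exp (A * ‖y.1‖^2) := Real.one_le_exp (by positivity)
      have hMe := mul_le_mul_of_nonneg_left b0 hM.le
      have hMe2 := mul_le_mul_of_nonneg_left b1 hM.le
      have hMp : 0 ≤ M * (C1 * Real.exp (A * ‖y.1‖^2)) := by positivity
      have hCp : 0 ≤ C1 * Real.exp (A * ‖y.1‖^2) := by positivity
      have hL := hcut l hl0 hl1 v hv y hy hc (by
          have := abs_sub_abs_le_abs_sub (v y) (u y.1 y.2)
          linarith) (fun i => by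
          have := abs_sub_abs_le_abs_sub (d (ev i) v y) (du u i y)
          have h3 := coe_le (fderiv ℝ (fun z => u z y.2) y.1) i
          have h4 := k1 i
          have h5 : |du u i y| ≤ ‖fderiv ℝ (fun z => u z y.2) y.1‖ := h3
          linarith) (by linarith)
      rw [← Lh_congr (hU2 y hy)] at hL
      have h5 : (Lh U y)^2 ≤ C^2 * Real.exp (2 * (A+4) * ‖y.1‖^2) := by
        rw [← sq_abs]
        refine (pow_le_pow_left₀ (abs_nonneg _) hL 2).trans (le_of_eq ?_)
        rw [mul_pow, ← Real.exp_nat_mul]; congr 2; push_cast; ring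
      have ht : 0 < y.2 := hτ2.trans_le hy.1
      have h6 : 2 * ph i0 s a y ≤ 4*a*B - 1/(8*s) * ‖y.1‖^2 := by
        have e1 : hh s y.2 * FF i0 (999/500) PP y ≤ 2*B + l * ‖y.1‖^2 := by unfold psi at hc; linarith
        have e2 := mul_le_mul_of_nonneg_left e1 ha.le
        have e3 : a * (l * ‖y.1‖^2) = 1/(16*s) * ‖y.1‖^2 := by rw [hl]; field_simp
        have e4 : 1/(8*s) ≤ 1/(8*y.2) := by
          have := hy.2.1
          gcongr
        have e5 := mul_le_mul_of_nonneg_right e4 (sq_nonneg ‖y.1‖)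
        have e6 : 1/(16*s) * ‖y.1‖^2 = (1/(8*s) * ‖y.1‖^2)/2 := by field_simp; ring
        have e7 : -1/(8*y.2) * ‖y.1‖^2 = -(1/(8*y.2) * ‖y.1‖^2) := by ring
        unfold ph
        simp only
        linarith
      have h7 := mul_le_mul_of_nonneg_right h8 (sq_nonneg ‖y.1‖)
      calc Real.exp (2 * ph i0 s a y) * (Lh U y)^2 ≤ Real.exp (4*a*B - 1/(8*s) * ‖y.1‖^2) * (C^2 * Real.exp (2 * (A+4) * ‖y.1‖^2)) := by
            gcongr
        _ = C^2 * Real.exp (4*a*B + (2 * (A+4) * ‖y.1‖^2 - 1/(8*s) * ‖y.1‖^2)) := by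
            rw [mul_left_comm, ← Real.exp_add]; congr 2; ring
        _ ≤ C^2 * Real.exp (4*a*B + (-1 * ‖y.1‖^2)) := by
            gcongr; linarith
        _ = C^2 * Real.exp (4*a*B) * JJ s y := by rw [hJe, Real.exp_add]; ring
        _ ≤ _ := by linarith
    · have e1 : Lh U y = Lh v y := Lh_congr (hU1 y hy hc)
      have e2 : ∀ i, d (ev i) U y = d (ev i) v y := fun i => (d_congr (hU1 y hy hc)).self_of_nhds
      have e3 : U y = v y := (hU1 y hy hc).self_of_nhds
      have h3 := opn_le (fderiv ℝ (fun z => u z y.2) y.1)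
      have h4 : ∑ i, |(fderiv ℝ (fun z => u z y.2) y.1) (EuclideanSpace.single i 1)| ≤ ∑ i, |d (ev i) v y| + n * δ := by
        have : ∀ i ∈ Finset.univ, |(fderiv ℝ (fun z => u z y.2) y.1) (EuclideanSpace.single i 1)| ≤ |d (ev i) v y| + δ := by
          intro i _
          have := abs_sub_abs_le_abs_sub (du u i y) (d (ev i) v y)
          rw [abs_sub_comm] at this
          have h4 := k1 i
          change |du u i y| ≤ _
          linarith
        refine (Finset.sum_le_sum this).trans ?_
        rw [Finset.sum_add_distrib]; simp
      have h5 : |u y.1 y.2| ≤ |v y| + δ := by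
        have := abs_sub_abs_le_abs_sub (u y.1 y.2) (v y)
        rw [abs_sub_comm] at this
        linarith
      have h6 : |Lh v y| ≤ M * (|v y| + ∑ i, |d (ev i) v y|) + (M*(n+1)+1)*δ := by
        have := mul_le_mul_of_nonneg_left (add_le_add h5 (h3.trans h4)) hM.le
        linarith
      have h7 := sq_bd hM.le h6
      rw [e1, e3]
      simp only [e2]
      have h9 : Real.exp (2 * ph i0 s a y) * (2 * ((M*(n+1)+1)*δ)^2) ≤ JJ s y := by
        have h10 := le_of_abs_le (hΛ y hy)
        rw [Real.exp_add] at h10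
        have h11 : δ^2 * |Λ| ≤ 1 := by
          rw [lt_div_iff₀ (by positivity)] at hδΛ
          have q1 : δ * |Λ| ≤ 1 := by linarith
          have q2 : 0 ≤ δ * |Λ| := by positivity
          calc δ^2 * |Λ| = δ * (δ * |Λ|) := by ring
            _ ≤ 1 * 1 := mul_le_mul hδ1.le q1 q2 zero_le_one
            _ = 1 := one_mul 1
        have h12 := mul_le_mul_of_nonneg_left (h10.trans (le_abs_self Λ)) (sq_nonneg δ)
        have h13 := mul_le_mul_of_nonneg_right (h12.trans h11) (Real.exp_pos (-1 * ‖y.1‖^2)).le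
        have h14 : Real.exp (‖y.1‖^2) * Real.exp (-1 * ‖y.1‖^2) = 1 := by rw [← Real.exp_add]; simp
        rw [hJe]
        calc _ = Real.exp (2 * ph i0 s a y) * (2 * ((M*(n+1)+1)*δ)^2) * (Real.exp (‖y.1‖^2) * Real.exp (-1 * ‖y.1‖^2)) := by rw [h14, mul_one]
          _ ≤ _ := by linarith
      have h15 := mul_le_mul_of_nonneg_left h7 (Real.exp_pos (2 * ph i0 s a y)).le
      have h16 : 0 ≤ C^2 * Real.exp (4*a*B) * JJ s y := by positivity
      simp only [κ]
      linarith
  have h2 : ∫ y, Real.exp (2 * ph i0 s a y) * (∑ i, d (ev i) (d (ev i) U) y + d et U y) ^ 2 ≤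
      κ * (∫ y, Real.exp (2 * ph i0 s a y) * (∑ i, d (ev i) U y ^ 2 + U y ^ 2)) + (C^2 * Real.exp (4*a*B) + 1) * ∫ y : YY n, JJ s y := by
    rw [← integral_const_mul, ← integral_const_mul, ← integral_add (hi1.const_mul _) ((JJ_int s).const_mul _)]
    refine integral_mono_of_nonneg (Eventually.of_forall fun y => ?_) ((hi1.const_mul _).add ((JJ_int s).const_mul _)) (Eventually.of_forall hpt)
    simp only [Pi.zero_apply]; positivity
  have h3 : ∫ y, Real.exp (2 * ph i0 s a y) * (1/(4*s) * (∑ i, d (ev i) U y ^ 2 + U y ^ 2)) =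
      1/(4*s) * ∫ y, Real.exp (2 * ph i0 s a y) * (∑ i, d (ev i) U y ^ 2 + U y ^ 2) := by
    rw [← integral_const_mul]; congr 1; ext y; ring
  rw [h3] at h1
  have h4 : ∫ y, Real.exp (2 * ph i0 s a y) * U y ^ 2 ≤ ∫ y, Real.exp (2 * ph i0 s a y) * (∑ i, d (ev i) U y ^ 2 + U y ^ 2) := by
    refine integral_mono hi2 hi1 fun y => ?_
    have : 0 ≤ ∑ i, d (ev i) U y ^ 2 := Finset.sum_nonneg fun _ _ => sq_nonneg _
    simp only
    gcongr
    linarith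
  have h40 : 0 ≤ ∫ y, Real.exp (2 * ph i0 s a y) * U y ^ 2 := integral_nonneg fun y => by positivity
  have h5 : 1/(4*s) = 1/(8*s) + 1/(8*s) := by field_simp; norm_num
  rw [h5] at h1
  set X := ∫ y, Real.exp (2 * ph i0 s a y) * (∑ i, d (ev i) U y ^ 2 + U y ^ 2)
  have h6 := mul_le_mul_of_nonneg_right hκ (h40.trans h4)
  have h7 : 1/(8*s) * ∫ y, Real.exp (2 * ph i0 s a y) * U y ^ 2 ≤ 1/(8*s) * X := mul_le_mul_of_nonneg_left h4 (by positivity)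
  linarith
end
end CU

namespace CU
open Set MeasureTheory Filter Topology
open scoped ContDiff
section
variable {n : ℕ}
local notation "E" => EuclideanSpace ℝ (Fin n)
variable {Ω : Set (EuclideanSpace ℝ (Fin n))} {τ T M : ℝ} {u : EuclideanSpace ℝ (Fin n) → ℝ → ℝ}

theorem Sol.vanish (S : Sol Ω τ T M u) (hτ : 0 < τ) (i0 : Fin n) {ρ C0 A s : ℝ} (hρ : 0 < ρ) (hρ1 : ρ ≤ 1)
    (hN : ∀ x : E, 13/20 * ‖x‖ ≤ x i0 → Metric.closedBall x ρ ⊆ Ω) (hC0 : 0 < C0) (hA : 0 ≤ A)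
    (hg : ∀ x ∈ Ω, ∀ t < T, |u x t| ≤ C0 * Real.exp (A * ‖x‖^2)) (hs0 : 0 < s) (hs1 : s ≤ 1) (hsT : s < T)
    (h8 : 2 * (2 * A + 4) + 1 ≤ 1/(8*s)) (hκ : 2 * M^2 * (n+1) ≤ 1/(8*s)) {x : E} {t : ℝ} (ht : t < s)
    (hF : 0 < FF i0 (999/500) PP (x, t)) : u x t = 0 := by
  by_contra hu
  have hM := S.M0
  set N : Set E := {x | 13/20 * ‖x‖ ≤ x i0} with hNd
  have hNΩ : N ⊆ Ω := fun z hz => hN z hz (by simp [hρ.le])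
  have hx0 : x ≠ 0 := by
    rintro rfl
    rw [FF, norm_zero, Real.zero_rpow (by norm_num), zero_mul] at hF
    exact lt_irrefl _ hF
  have hr : 0 < ‖x‖ := norm_pos_iff.2 hx0
  have hxN : x ∈ N := by
    have hp : 0 < ‖x‖ ^ (999/500:ℝ) := by positivity
    have hP : 0 < PP.eval (x i0 / ‖x‖) := (pos_iff_pos_of_mul_pos hF).1 hp
    exact (le_div_iff₀ hr).1 (c_big (c_le_one x hx0) hP)
  have htτ : τ < t := by
    by_contra! h
    exact hu (S.zero x (hNΩ hxN) t h)
  have ht0 : 0 < t := hτ.trans htτ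
  have hh0 : 0 < hh s t := by
    unfold hh
    have : (s^4)⁻¹ < (t^4)⁻¹ := by gcongr
    linarith
  obtain ⟨B, hBd⟩ : ∃ B, B = hh s t * FF i0 (999/500) PP (x,t) / 4 := ⟨_, rfl⟩
  have hB : 0 < B := by rw [hBd]; positivity
  obtain ⟨m, hmd⟩ : ∃ m, m = |u x t| / 4 := ⟨_, rfl⟩
  have hut : 0 < |u x t| := abs_pos.2 hu
  have hm : 0 < m := by rw [hmd]; positivity
  obtain ⟨C1, hC1, hb⟩ := S.gradbd hρ hρ1 hsT hC0 hA (N := N) (fun z hz => hN z hz) hg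
  obtain ⟨C, hC, hcut⟩ := cut_bd i0 (s := s) (B := B) (D := 2*M*C1+C1+1) (A := 2 * A) (τ := τ/2) (by positivity) hB (by positivity) (by positivity)
  obtain ⟨A0, hA0, hcar⟩ := carleman_cone n i0
  have hcf : ContinuousAt (fun y : YY n => hh s y.2 * FF i0 (999/500) PP y) (x,t) :=
    ((tm_smooth (y := (x,t)) (hh_smooth s ht0)).mul (FF_smooth i0 (999/500) PP (y := (x,t)) hx0)).continuousAt
  have hcu : ContinuousAt (fun p : E × ℝ => u p.1 p.2) (x,t) :=
    S.cont.continuousAt ((S.op.prod isOpen_Iio).mem_nhds ⟨hNΩ hxN, ht.trans hsT⟩)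
  have hev : ∀ᶠ y : YY n in 𝓝 (x,t), (y.1 ≠ 0 ∧ 0 < y.2) ∧ τ/2 < y.2 ∧ y.2 < s ∧ 3*B < hh s y.2 * FF i0 (999/500) PP y ∧
      2 * m < |u y.1 y.2| ∧ ‖y.1‖ < ‖x‖ + 1 := by
    refine (pos_ev (y := (x,t)) hx0 ht0).and ?_
    refine (continuousAt_snd.eventually (lt_mem_nhds (show τ/2 < t by linarith))).and ?_
    refine (continuousAt_snd.eventually (gt_mem_nhds ht)).and ?_
    refine (hcf.eventually (lt_mem_nhds (show 3*B < hh s t * FF i0 (999/500) PP (x,t) by linarith))).and ?_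
    refine (hcu.abs.eventually (lt_mem_nhds (show 2*m < |u x t| by linarith))).and ?_
    exact (continuousAt_fst.norm.eventually (gt_mem_nhds (show ‖x‖ < ‖x‖ + 1 by linarith)))
  obtain ⟨ε, hε, hW⟩ := Metric.eventually_nhds_iff_ball.1 hev
  set W := Metric.ball ((x,t) : YY n) ε
  have hWpos : 0 < volume.real W := by
    rw [measureReal_def, ENNReal.toReal_pos_iff]
    exact ⟨Metric.measure_ball_pos _ _ hε, measure_ball_lt_top⟩
  obtain ⟨R, hR⟩ : ∃ R, R = (‖x‖+1)^2 := ⟨_, rfl⟩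
  have hR0 : 0 < R := by rw [hR]; positivity
  obtain ⟨I, hI⟩ : ∃ I, I = ∫ y : YY n, JJ s y := ⟨_, rfl⟩
  have hI0 : 0 ≤ I := by rw [hI]; exact integral_nonneg fun y => JJ_nn s y
  obtain ⟨c, hc⟩ : ∃ c, c = 1/(8*s) * (volume.real W * (Real.exp (-(R/(2*τ))) * m^2)) := ⟨_, rfl⟩
  have hc0 : 0 < c := by rw [hc]; positivity
  obtain ⟨a, ha⟩ : ∃ a, a = A0/B + 1/(16*s) + R/(16*s*B) + (C^2+1)*I/(c*(2*B)) + 1 := ⟨_, rfl⟩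
  have q1 : 0 < A0/B := by positivity
  have q2 : 0 < 1/(16*s) := by positivity
  have q3 : 0 < R/(16*s*B) := by positivity
  have q4 : 0 ≤ (C^2+1)*I/(c*(2*B)) := by positivity
  have ha0 : 0 < a := by linarith
  have a1 : A0 ≤ a * B := by rw [← div_le_iff₀ hB]; linarith
  have a2 : 1/(16*s*a) ≤ 1 := by
    rw [div_le_one (by positivity)]
    have : 1/(16*s) ≤ a := by linarith
    rw [div_le_iff₀ (by positivity)] at this
    linarith
  have a3 : 1/(16*s*a) * R < B := by
    have : R/(16*s*B) < a := by linarith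
    rw [div_lt_iff₀ (by positivity)] at this
    rw [one_div_mul_eq_div, div_lt_iff₀ (by positivity)]
    linarith
  have a4 : (C^2+1)*I < c * (2*a*B+1) := by
    have : (C^2+1)*I/(c*(2*B)) ≤ a := by linarith
    rw [div_le_iff₀ (by positivity)] at this
    linarith
  obtain ⟨U, hUi, hU1, hU2⟩ := S.step hτ i0 (N := N) (fun z hz => hz) hNΩ hs0 hs1 hsT hB hC1 (by positivity) hb h8 hκ ha0 a1 a2 hm hcar hcut
  have hlow : volume.real W * (Real.exp (6*a*B - R/(2*τ)) * m^2) ≤ ∫ y, Real.exp (2 * ph i0 s a y) * U y ^2 := by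
    have e1 : ∫ y in W, (Real.exp (6*a*B - R/(2*τ)) * m^2) = volume.real W * (Real.exp (6*a*B - R/(2*τ)) * m^2) := by
      rw [setIntegral_const, smul_eq_mul]
    rw [← e1]
    refine le_trans ?_ (setIntegral_le_integral (s := W) hUi (Eventually.of_forall fun y => by simp only [Pi.zero_apply]; positivity))
    refine setIntegral_mono_on (integrableOn_const measure_ball_lt_top.ne) hUi.integrableOn measurableSet_ball fun y hy => ?_
    obtain ⟨⟨w1, w2⟩, w3, w4, w5, w6, w7⟩ := hW y hy
    have w8 : ‖y.1‖^2 ≤ R := by rw [hR]; exact pow_le_pow_left₀ (norm_nonneg _) w7.le 2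
    have w9 : 2 * B < psi i0 s (1/(16*s*a)) y := by
      unfold psi
      have := mul_le_mul_of_nonneg_left w8 (show 0 ≤ 1/(16*s*a) by positivity)
      linarith
    have w10 := hU1 y ⟨w3.le, w4.le, w1, by linarith⟩ w9
    have w11 : m ≤ |U y| := by
      have := abs_sub_abs_le_abs_sub (u y.1 y.2) (U y)
      rw [abs_sub_comm] at this
      linarith
    have w12 : m^2 ≤ U y^2 := by rw [← sq_abs (U y)]; exact pow_le_pow_left₀ hm.le w11 2
    have w13 : 6*a*B - R/(2*τ) ≤ 2 * ph i0 s a y := by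
      unfold ph
      simp only
      have e2 := mul_le_mul_of_nonneg_left w5.le ha0.le
      have e3 : 1/(8*y.2) * ‖y.1‖^2 ≤ 1/(4*τ) * R := by
        refine mul_le_mul ?_ w8 (by positivity) (by positivity)
        exact one_div_le_one_div_of_le (by positivity) (by linarith)
      have e4 : R/(2*τ) = 2*(1/(4*τ)*R) := by field_simp; norm_num
      have e7 : -1/(8*y.2) * ‖y.1‖^2 = -(1/(8*y.2) * ‖y.1‖^2) := by ring
      linarith
    gcongr
  rw [← hI] at hU2
  have h1 : c * Real.exp (6*a*B) ≤ (C^2 * Real.exp (4*a*B) + 1) * I := by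
    refine le_trans (le_of_eq ?_) ((mul_le_mul_of_nonneg_left hlow (show 0 ≤ 1/(8*s) by positivity)).trans hU2)
    rw [hc, sub_eq_add_neg, Real.exp_add]; ring
  have h2 : Real.exp (6*a*B) = Real.exp (4*a*B) * Real.exp (2*a*B) := by rw [← Real.exp_add]; congr 1; ring
  have h3 : 1 ≤ Real.exp (4*a*B) := Real.one_le_exp (by positivity)
  have h4 : 2*a*B+1 ≤ Real.exp (2*a*B) := Real.add_one_le_exp _
  have h5 : (C^2 * Real.exp (4*a*B) + 1) * I ≤ Real.exp (4*a*B) * ((C^2+1)*I) := by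
    have := mul_le_mul_of_nonneg_right h3 hI0
    linarith
  have h6 : Real.exp (4*a*B) * ((C^2+1)*I) < Real.exp (4*a*B) * (c * (2*a*B+1)) := mul_lt_mul_of_pos_left a4 (Real.exp_pos _)
  have h7 : Real.exp (4*a*B) * (c * (2*a*B+1)) ≤ Real.exp (4*a*B) * (c * Real.exp (2*a*B)) := by gcongr
  rw [h2] at h1
  linarith
end
end CU

namespace CU
open Set MeasureTheory Filter Topology
open scoped ContDiff
section
variable {n : ℕ}
local notation "E" => EuclideanSpace ℝ (Fin n)
variable {Γ : Set (EuclideanSpace ℝ (Fin n))} {T M : ℝ} {u : EuclideanSpace ℝ (Fin n) → ℝ → ℝ}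

noncomputable def sh (u : EuclideanSpace ℝ (Fin n) → ℝ → ℝ) (z : EuclideanSpace ℝ (Fin n)) (a τ : ℝ)
    (x : EuclideanSpace ℝ (Fin n)) (t : ℝ) : ℝ := u (z + x) (max (t - τ) 0 + a)

lemma sh_sol (hop : IsOpen Γ) (hM : 0 < M)
    (hcont : ContinuousOn (fun p : E × ℝ => u p.1 p.2) (Γ ×ˢ Ico 0 T))
    (hreg_x : ∀ t ∈ Ioo (0 : ℝ) T, ContDiffOn ℝ 2 (fun x => u x t) Γ)
    (hreg_t : ∀ x ∈ Γ, ContDiffOn ℝ 1 (u x) (Ioo 0 T))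
    (heq : ∀ x ∈ Γ, ∀ t ∈ Ioo (0 : ℝ) T, |deriv (u x) t + lap (fun y => u y t) x|
        ≤ M * (|u x t| + ‖gradient (fun y => u y t) x‖))
    {a τ : ℝ} (ha : 0 ≤ a) (haT : a < T) (h0 : ∀ x ∈ Γ, u x a = 0) (z : E) :
    Sol {x : E | z + x ∈ Γ} τ (T - a + τ) M (sh u z a τ) := by
  have hti : ∀ t ∈ Ioo τ (T - a + τ), (t - τ + a) ∈ Ioo 0 T := fun t ht => ⟨by linarith [ht.1], by linarith [ht.2]⟩
  have hmx : ∀ t, τ < t → max (t - τ) 0 = t - τ := fun t ht => max_eq_left (by linarith)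
  have hd : ∀ x, z + x ∈ Γ → ∀ t ∈ Ioo τ (T - a + τ), HasDerivAt (sh u z a τ x) (deriv (u (z+x)) (t - τ + a)) t := fun x hx t ht => by
    have h1 : DifferentiableAt ℝ (u (z+x)) (t - τ + a) :=
      ((hreg_t _ hx).contDiffAt (isOpen_Ioo.mem_nhds (hti t ht))).differentiableAt (by norm_num)
    have h2 : HasDerivAt (fun t : ℝ => t - τ + a) 1 t := ((hasDerivAt_id t).sub_const τ).add_const a
    have h3 := h1.hasDerivAt.comp t h2
    rw [mul_one] at h3
    refine h3.congr_of_eventuallyEq ?_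
    filter_upwards [lt_mem_nhds ht.1] with r hr
    simp only [sh, Function.comp, hmx r hr]
  have hsl : ∀ t, τ < t → (fun y => sh u z a τ y t) = fun y => (fun w => u w (t - τ + a)) (z + y) := fun t ht => by
    funext y; simp only [sh, hmx t ht]
  refine ⟨hop.preimage (by fun_prop), hM, ?_, ?_, ?_, ?_, ?_⟩
  · refine ContinuousOn.comp (g := fun p : E × ℝ => u p.1 p.2) (f := fun p : E × ℝ => (z + p.1, max (p.2 - τ) 0 + a)) hcont (by fun_prop) ?_
    rintro ⟨x, t⟩ ⟨hx, ht⟩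
    simp only [mem_Iio] at ht
    refine ⟨hx, by positivity, ?_⟩
    simp only
    rcases max_cases (t - τ) 0 with h | h <;> rw [h.1] <;> linarith
  · intro x hx t ht
    simp only [sh]
    rw [max_eq_right (by linarith), zero_add]
    exact h0 _ hx
  · intro x hx t ht
    rw [hsl t ht.1]
    exact ContDiffAt.comp x ((hreg_x _ (hti t ht)).contDiffAt (hop.mem_nhds hx)) (by fun_prop)
  · intro x hx t ht
    exact (hd x hx t ht).differentiableAt
  · intro x hx t ht
    have h1 := heq _ hx _ (hti t ht)
    have h2 : lap (fun w => u w (t - τ + a)) (z + x) = lap (fun y => sh u z a τ y t) x := by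
      rw [hsl t ht.1]
      simp only [lap]
      refine Finset.sum_congr rfl fun i _ => ?_
      have h5 := iteratedFDeriv_comp_add_left (𝕜 := ℝ) (f := fun w => u w (t - τ + a)) 2 z x
      exact (DFunLike.congr_fun h5 _).symm
    have h3 : ‖gradient (fun w => u w (t - τ + a)) (z + x)‖ = ‖fderiv ℝ (fun y => sh u z a τ y t) x‖ := by
      have h5 := fderiv_comp_add_left (𝕜 := ℝ) (f := fun w => u w (t - τ + a)) (x := x) z
      rw [hsl t ht.1, h5, gradient, LinearIsometryEquiv.norm_map]
    have h4 : u (z+x) (t - τ + a) = sh u z a τ x t := by simp only [sh, hmx t ht.1]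
    rw [heat, (hd x hx t ht).deriv, ← h2, ← h3, ← h4]
    exact h1

set_option maxHeartbeats 1000000 in
theorem main (i0 : Fin n) {c0 : ℝ} (hc0 : 0 < c0) (hc1 : c0 < 13/20)
    (hΓ : Γ = {x : E | ‖x‖ * c0 < x i0}) (hM : 0 < M)
    (hcont : ContinuousOn (fun p : E × ℝ => u p.1 p.2) (Γ ×ˢ Ico 0 T))
    (hreg_x : ∀ t ∈ Ioo (0 : ℝ) T, ContDiffOn ℝ 2 (fun x => u x t) Γ)
    (hreg_t : ∀ x ∈ Γ, ContDiffOn ℝ 1 (u x) (Ioo 0 T))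
    (heq : ∀ x ∈ Γ, ∀ t ∈ Ioo (0 : ℝ) T, |deriv (u x) t + lap (fun y => u y t) x|
        ≤ M * (|u x t| + ‖gradient (fun y => u y t) x‖))
    (hgrowth : ∀ x ∈ Γ, ∀ t ∈ Ioo (0 : ℝ) T, |u x t| ≤ M * Real.exp (M * ‖x‖ ^ 2))
    (hinit : ∀ x ∈ Γ, u x 0 = 0) :
    ∀ x ∈ Γ, ∀ t ∈ Ioo (0 : ℝ) T, u x t = 0 := by
  have hop : IsOpen Γ := by rw [hΓ]; exact isOpen_lt (by fun_prop) (by fun_prop)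
  obtain ⟨K, hK0, hK1, hK2, hK3⟩ : ∃ K : ℝ, 0 < K ∧ 8 ≤ K ∧ 2 * (2 * (2*M) + 4) + 1 ≤ K ∧ 2 * M^2 * (n+1) ≤ K :=
    ⟨8 + (2 * (2 * (2*M) + 4) + 1) + 2 * M^2 * (n+1), by positivity, by
      have : 0 ≤ 2 * M^2 * ((n:ℝ)+1) := by positivity
      linarith, by
      have : 0 ≤ 2 * M^2 * ((n:ℝ)+1) := by positivity
      linarith, by linarith⟩
  set S := 1/(8*K) with hS
  have hS0 : 0 < S := by positivity
  have step : ∀ a, 0 ≤ a → a < T → (∀ x ∈ Γ, u x a = 0) → ∀ t, a < t → t < T → t < a + S → ∀ x ∈ Γ, u x t = 0 := by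
    intro a ha haT h0 t hat htT htS x hx
    set e : E := EuclideanSpace.single i0 1 with he
    have hne : ‖e‖ = 1 := by simp [he]
    obtain ⟨σ, hσ0, hz⟩ : ∃ σ : ℝ, 0 < σ ∧ x - σ • e ∈ Γ := by
      have hc : Tendsto (fun σ : ℝ => x - σ • e) (𝓝[>] 0) (𝓝 x) := by
        have : Continuous (fun σ : ℝ => x - σ • e) := by fun_prop
        have := this.tendsto 0
        simp only [zero_smul, sub_zero] at this
        exact this.mono_left nhdsWithin_le_nhds
      obtain ⟨σ, h1, h2⟩ := ((hc.eventually (hop.mem_nhds hx)).and self_mem_nhdsWithin).exists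
      exact ⟨σ, h2, h1⟩
    set z := x - σ • e with hzd
    obtain ⟨ρ', hρ'0, hρ'⟩ := Metric.nhds_basis_closedBall.mem_iff.1 (hop.mem_nhds hz)
    obtain ⟨τ, hτ0, hτ⟩ : ∃ τ : ℝ, 0 < τ ∧ τ < min S (T - a) - (t - a) :=
      exists_between (by rw [sub_pos]; exact lt_min (by linarith) (by linarith))
    set s := min S (T - a) with hs
    have hs0 : 0 < s := lt_min hS0 (by linarith)
    have hsS : s ≤ S := min_le_left _ _
    have hsT : s ≤ T - a := min_le_right _ _
    have hsK : K ≤ 1/(8*s) := by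
      have : 1/(8*S) = K := by rw [hS]; field_simp
      rw [← this]
      exact one_div_le_one_div_of_le (by positivity) (by linarith)
    have hS1 : S ≤ 1 := by rw [hS, div_le_one (by positivity)]; linarith
    have key := (sh_sol (τ := τ) hop hM hcont hreg_x hreg_t heq ha haT h0 z).vanish hτ0 i0 (ρ := min ρ' 1)
      (C0 := M * Real.exp (2 * M * ‖z‖^2)) (A := 2 * M) (s := s) (lt_min hρ'0 one_pos) (min_le_right _ _) ?_ (by positivity)
      (by positivity) ?_ hs0 (by linarith) (by linarith) (by linarith) (by linarith) (x := σ • e) (t := t - a + τ) (by linarith) ?_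
    · rw [sh] at key
      have e1 : z + σ • e = x := by rw [hzd]; abel
      have e2 : max (t - a + τ - τ) 0 + a = t := by rw [max_eq_left (by linarith)]; ring
      rwa [e1, e2] at key
    · intro y hy w hw
      have h1 : w - y + z ∈ Γ := hρ' (by
        rw [Metric.mem_closedBall, dist_eq_norm] at hw ⊢
        rw [add_sub_cancel_right]
        exact hw.trans (min_le_left _ _))
      rw [hΓ] at h1
      show z + w ∈ Γ
      rw [hΓ]
      simp only [mem_setOf_eq] at h1 ⊢
      have e1 : z + w = (w - y + z) + y := by abel
      rw [e1]
      have e2 := mul_le_mul_of_nonneg_right (norm_add_le (w - y + z) y) hc0.le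
      have e3 := mul_le_mul_of_nonneg_left hc1.le (norm_nonneg y)
      have e4 : (w - y + z + y) i0 = (w - y + z) i0 + y i0 := by simp
      rw [e4]
      linarith
    · intro y hy r hr
      simp only [sh]
      rcases le_or_gt r τ with h | h
      · rw [max_eq_right (by linarith), zero_add, h0 _ hy, abs_zero]; positivity
      · rw [max_eq_left (by linarith)]
        refine (hgrowth _ hy _ ⟨by linarith, by linarith⟩).trans ?_
        rw [mul_assoc, ← Real.exp_add]
        have h1 := pow_le_pow_left₀ (norm_nonneg _) (norm_add_le z y) 2
        have h2 : ‖z + y‖^2 ≤ 2 * ‖z‖^2 + 2 * ‖y‖^2 := by nlinarith [sq_nonneg (‖z‖ - ‖y‖)]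
        have h3 := mul_le_mul_of_nonneg_left h2 hM.le
        gcongr
        linarith
    · have h1 : ‖σ • e‖ = σ := by rw [norm_smul, hne, mul_one, Real.norm_of_nonneg hσ0.le]
      have h2 : (σ • e) i0 = σ := by simp [he]
      simp only [FF, h1, h2, div_self hσ0.ne', PP_ev]
      refine mul_pos (by positivity) (by norm_num)
  have ind : ∀ k : ℕ, ∀ t, 0 ≤ t → t < T → t ≤ k * (S/2) → ∀ x ∈ Γ, u x t = 0 := by
    intro k
    induction k with
    | zero =>
      intro t h1 h2 h3 x hx
      have : t = 0 := by simp at h3; linarith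
      rw [this]; exact hinit x hx
    | succ k ih =>
      intro t h1 h2 h3 x hx
      push_cast at h3
      rcases le_or_gt t (k * (S/2)) with h | h
      · exact ih t h1 h2 h x hx
      · have hk : 0 ≤ (k:ℝ) * (S/2) := by positivity
        exact step (k * (S/2)) hk (by linarith) (ih _ hk (by linarith) le_rfl) t h h2 (by linarith) x hx
  intro x hx t ht
  obtain ⟨k, hk⟩ := exists_nat_ge (t / (S/2))
  rw [div_le_iff₀ (by positivity)] at hk
  exact ind k t ht.1.le ht.2 hk x hx
end
end CU

theorem stmt_0 (n : ℕ) (hn : 2 ≤ n) (θ T M : ℝ)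
    (hθ : θ ∈ Ioo (2 * Real.arccos (Real.sqrt (73 / 173))) Real.pi)
    (hT : 0 < T) (hM : 0 < M)
    (u : EuclideanSpace ℝ (Fin n) → ℝ → ℝ)
    (hcont : ContinuousOn (fun p : EuclideanSpace ℝ (Fin n) × ℝ => u p.1 p.2)
      ((cone (by omega) θ) ×ˢ Ico 0 T))
    (hreg_x : ∀ t ∈ Ioo (0 : ℝ) T, ContDiffOn ℝ 2 (fun x => u x t) (cone (by omega) θ))
    (hreg_t : ∀ x ∈ cone (n := n) (by omega) θ, ContDiffOn ℝ 1 (u x) (Ioo 0 T))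
    (heq : ∀ x ∈ cone (n := n) (by omega) θ, ∀ t ∈ Ioo (0 : ℝ) T,
      |deriv (u x) t + lap (fun y => u y t) x|
        ≤ M * (|u x t| + ‖gradient (fun y => u y t) x‖))
    (hgrowth : ∀ x ∈ cone (n := n) (by omega) θ, ∀ t ∈ Ioo (0 : ℝ) T,
      |u x t| ≤ M * Real.exp (M * ‖x‖ ^ 2))
    (hinit : ∀ x ∈ cone (n := n) (by omega) θ, u x 0 = 0) :
    ∀ x ∈ cone (n := n) (by omega) θ, ∀ t ∈ Ioo (0 : ℝ) T, u x t = 0 := by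
  have hq : Real.sqrt (73/173) < 13/20 := by
    rw [Real.sqrt_lt' (by norm_num)]; norm_num
  have hq0 := Real.sqrt_nonneg (73/173)
  have h0 : 0 ≤ Real.arccos (Real.sqrt (73/173)) := Real.arccos_nonneg _
  have hc0 : 0 < Real.cos (θ/2) :=
    Real.cos_pos_of_mem_Ioo ⟨by linarith [hθ.1, Real.pi_pos], by linarith [hθ.2]⟩
  have hc1 : Real.cos (θ/2) < 13/20 := by
    have := Real.cos_lt_cos_of_nonneg_of_le_pi h0 (y := θ/2) (by linarith [hθ.2, Real.pi_pos]) (by linarith [hθ.1])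
    rw [Real.cos_arccos (by linarith) (by linarith)] at this
    linarith
  exact CU.main (⟨0, by omega⟩ : Fin n) hc0 hc1 rfl hM hcont hreg_x hreg_t heq hgrowth hinit
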